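/- Let A(Γ₀) be an Artin-Tits group of large type with generating set S, and let w be any word over S ∪ S⁻¹. Then w →_{0,1,2⋆} ε (the empty word) if and only if w̄ = 1. -/

import Mathlib

namespace ArtinTits

open Classical List

variable {S : Type*}

/-- A word over `S ∪ S⁻¹`: a list of letters, each a generator together with a sign
(`true` = the generator itself, `false` = its formal inverse). -/
abbrev Word (S : Type*) := List (S × Bool)

/-- The formal inverse of a word. -/
def wordInv (w : Word S) : Word S := w.reverse.map fun l => (l.1, !l.2)

/-- `[x,y,j⟩`: the alternating positive word `xyxy⋯` with `j` letters, beginning with `x`. -/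
def altWord (x y : S) : ℕ → Word S
  | 0 => []
  | j + 1 => (x, true) :: altWord y x j

/-- `⟨x,y,j]`: the alternating positive word `⋯xy` with `j` letters, ending with `y`. -/
def altWordR (x y : S) (j : ℕ) : Word S := (altWord y x j).reverse

/-- The data of a labelled finite complete simplicial graph `Γ₀`: a symmetric label map
with values in `{2,3,…} ∪ {∞}` on pairs of distinct vertices. -/
structure ArtinData (S : Type*) where
  m : S → S → ℕ∞
  symm : ∀ s t, m s t = m t s
  two_le : ∀ s t : S, s ≠ t → 2 ≤ m s t

/-- `u = v` is a defining (braid) relation of the Artin–Tits presentation. -/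
def IsRel (A : ArtinData S) (u v : Word S) : Prop :=
  ∃ (s t : S) (k : ℕ), s ≠ t ∧ A.m s t = (k : ℕ∞) ∧
    u = altWord s t k ∧ v = altWord t s k

/-- The relator set of the Artin–Tits presentation, inside the free group. -/
def rels (A : ArtinData S) : Set (FreeGroup S) :=
  {x | ∃ u v : Word S, IsRel A u v ∧ x = FreeGroup.mk u * (FreeGroup.mk v)⁻¹}

/-- The Artin–Tits group `A(Γ₀)` of the presentation. -/
abbrev ArtinGroup (A : ArtinData S) := PresentedGroup (rels A)

/-- `w̄`: the element of the Artin–Tits group represented by the word `w`. -/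
def wbar (A : ArtinData S) (w : Word S) : ArtinGroup A :=
  PresentedGroup.mk (rels A) (FreeGroup.mk w)

/-! ### Special transformations -/

/-- Type 0: delete a factor `s s⁻¹` or `s⁻¹ s`. -/
def Step0 (w w' : Word S) : Prop :=
  ∃ (w₁ w₂ : Word S) (s : S) (b : Bool),
    w = w₁ ++ [(s, b), (s, !b)] ++ w₂ ∧ w' = w₁ ++ w₂

/-- Type ∞: insert a factor `s s⁻¹` or `s⁻¹ s` (the inverse of type 0). -/
def StepInfty (w w' : Word S) : Prop := Step0 w' w

/-- Type 1: replace a factor `v` by `u`, or `v⁻¹` by `u⁻¹`, where `u = v` is a defining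
relation. -/
def Step1 (A : ArtinData S) (w w' : Word S) : Prop :=
  ∃ (w₁ w₂ u v : Word S), IsRel A u v ∧
    ((w = w₁ ++ v ++ w₂ ∧ w' = w₁ ++ u ++ w₂) ∨
     (w = w₁ ++ wordInv v ++ w₂ ∧ w' = w₁ ++ wordInv u ++ w₂))

/-- Type 2r: for a defining relation `u₁u₂ = v₁v₂` with `u₁, v₁` non-empty, replace a factor
`v₁⁻¹ u₁` by `v₂ u₂⁻¹`. -/
def Step2r (A : ArtinData S) (w w' : Word S) : Prop :=
  ∃ (w₁ w₂ u₁ u₂ v₁ v₂ : Word S), IsRel A (u₁ ++ u₂) (v₁ ++ v₂) ∧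
    u₁ ≠ [] ∧ v₁ ≠ [] ∧
    w = w₁ ++ wordInv v₁ ++ u₁ ++ w₂ ∧ w' = w₁ ++ v₂ ++ wordInv u₂ ++ w₂

/-- Type 2l: for a defining relation `u₁u₂ = v₁v₂` with `u₂, v₂` non-empty, replace a factor
`v₂ u₂⁻¹` by `v₁⁻¹ u₁`. -/
def Step2l (A : ArtinData S) (w w' : Word S) : Prop :=
  ∃ (w₁ w₂ u₁ u₂ v₁ v₂ : Word S), IsRel A (u₁ ++ u₂) (v₁ ++ v₂) ∧
    u₂ ≠ [] ∧ v₂ ≠ [] ∧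
    w = w₁ ++ v₂ ++ wordInv u₂ ++ w₂ ∧ w' = w₁ ++ wordInv v₁ ++ u₁ ++ w₂

/-- Type 2: a type 2r or type 2l transformation. -/
def Step2 (A : ArtinData S) (w w' : Word S) : Prop := Step2r A w w' ∨ Step2l A w w'

/-- `p` is the greatest (longest) common left factor of `x` and `y`. -/
def IsLCPrefix (p x y : Word S) : Prop :=
  p <+: x ∧ p <+: y ∧ ∀ q : Word S, q <+: x → q <+: y → q.length ≤ p.length

/-- `p` is the greatest (longest) common right factor of `x` and `y`. -/
def IsLCSuffix (p x y : Word S) : Prop :=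
  p <:+ x ∧ p <:+ y ∧ ∀ q : Word S, q <:+ x → q <:+ y → q.length ≤ p.length

/-- Type 2r⋆ : a type 2r transformation `w₁ v⁻¹ v' w₂ → w₁ u (u')⁻¹ w₂` (with `vu = v'u'` a
defining relation) such that `v` is the greatest common left factor of `vu` and `v w₁⁻¹`, and
`v'` is the greatest common left factor of `v'u'` and `v' w₂`. -/
def Step2rStar (A : ArtinData S) (w w' : Word S) : Prop :=
  ∃ (w₁ w₂ v u v' u' : Word S), IsRel A (v ++ u) (v' ++ u') ∧
    v ≠ [] ∧ v' ≠ [] ∧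
    w = w₁ ++ wordInv v ++ v' ++ w₂ ∧
    w' = w₁ ++ u ++ wordInv u' ++ w₂ ∧
    IsLCPrefix v (v ++ u) (v ++ wordInv w₁) ∧
    IsLCPrefix v' (v' ++ u') (v' ++ w₂)

/-- Type 2l⋆ : a type 2l transformation `w₁ v (v')⁻¹ w₂ → w₁ u⁻¹ u' w₂` (with `uv = u'v'` a
defining relation) such that `v` is the greatest common right factor of `uv` and `w₁ v`, and
`v'` is the greatest common right factor of `u'v'` and `w₂⁻¹ v'`. -/
def Step2lStar (A : ArtinData S) (w w' : Word S) : Prop :=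
  ∃ (w₁ w₂ v u v' u' : Word S), IsRel A (u ++ v) (u' ++ v') ∧
    v ≠ [] ∧ v' ≠ [] ∧
    w = w₁ ++ v ++ wordInv v' ++ w₂ ∧
    w' = w₁ ++ wordInv u ++ u' ++ w₂ ∧
    IsLCSuffix v (u ++ v) (w₁ ++ v) ∧
    IsLCSuffix v' (u' ++ v') (wordInv w₂ ++ v')

/-- Type 2⋆ : a type 2r⋆ or type 2l⋆ transformation. -/
def Step2Star (A : ArtinData S) (w w' : Word S) : Prop :=
  Step2rStar A w w' ∨ Step2lStar A w w'

/-- `w →_{0,1,2} w'`. -/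
def Steps012 (A : ArtinData S) : Word S → Word S → Prop :=
  Relation.ReflTransGen fun x y => Step0 x y ∨ Step1 A x y ∨ Step2 A x y

/-- `w →_{0,1,2⋆} w'`. -/
def Steps012Star (A : ArtinData S) : Word S → Word S → Prop :=
  Relation.ReflTransGen fun x y => Step0 x y ∨ Step1 A x y ∨ Step2Star A x y

/-- `w →_{2⋆} w'`. -/
def Steps2Star (A : ArtinData S) : Word S → Word S → Prop :=
  Relation.ReflTransGen (Step2Star A)

/-- `w →_{1,2⋆} w'`. -/
def Steps12Star (A : ArtinData S) : Word S → Word S → Prop :=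
  Relation.ReflTransGen fun x y => Step1 A x y ∨ Step2Star A x y

/-- `w →_{1,2} w'`. -/
def Steps12 (A : ArtinData S) : Word S → Word S → Prop :=
  Relation.ReflTransGen fun x y => Step1 A x y ∨ Step2 A x y

/-! ### Classes of words -/

/-- A positive word: written over `S`. -/
def Positive (w : Word S) : Prop := ∀ l ∈ w, l.2 = true

/-- A negative word: written over `S⁻¹`. -/
def Negative (w : Word S) : Prop := ∀ l ∈ w, l.2 = false

/-- A signed word: positive or negative. -/
def Signed (w : Word S) : Prop := Positive w ∨ Negative w

/-- An unsigned word: neither positive nor negative. -/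
def Unsigned (w : Word S) : Prop := ¬ Positive w ∧ ¬ Negative w

/-- A freely reduced word: no factor `s s⁻¹` or `s⁻¹ s`. -/
def FreelyReduced (w : Word S) : Prop :=
  ∀ (w₁ w₂ : Word S) (s : S) (b : Bool), w ≠ w₁ ++ [(s, b), (s, !b)] ++ w₂

/-- A square-free word: no factor `aa`. -/
def SquareFree (w : Word S) : Prop := ∀ a : S × Bool, ¬ [a, a] <:+: w

/-- `p̃(w)`: the length of the longest square-free positive factor of `w`. -/
noncomputable def ptilde (w : Word S) : ℕ :=
  sSup {n | ∃ v : Word S, v <:+: w ∧ Positive v ∧ SquareFree v ∧ v.length = n}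

/-- `ñ(w)`: the length of the longest negative factor of `w` whose formal inverse is
square-free. -/
noncomputable def ntilde (w : Word S) : ℕ :=
  sSup {n | ∃ v : Word S, v <:+: w ∧ Negative v ∧ SquareFree (wordInv v) ∧ v.length = n}

/-- `p(w) = min(p̃(w), m)`. -/
noncomputable def pfun (M : ℕ) (w : Word S) : ℕ := min (ptilde w) M

/-- `n(w) = min(ñ(w), m)`. -/
noncomputable def nfun (M : ℕ) (w : Word S) : ℕ := min (ntilde w) M

/-- `Ω(Γ₀)` (for a dihedral presentation with label `M`): the freely reduced words with
`max(p(w), n(w)) < M`. -/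
def Omega (M : ℕ) (w : Word S) : Prop :=
  FreelyReduced w ∧ max (pfun M w) (nfun M w) < M

/-- A signed square-free word (square-free positive, or negative with square-free inverse). -/
def SignedSF (w : Word S) : Prop :=
  (Positive w ∧ SquareFree w) ∨ (Negative w ∧ SquareFree (wordInv w))

/-- `v` is the maximal square-free signed left factor of `w`. -/
def MaxSignedSFPrefix (v w : Word S) : Prop :=
  v <+: w ∧ SignedSF v ∧ ∀ v' : Word S, v' <+: w → SignedSF v' → v'.length ≤ v.length

/-- `(v₁, …, v_k)` is the `⋆`-decomposition of `w`: the `v_i` are non-empty, `w = v₁⋯v_k`,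
and each `v_i` is the maximal square-free signed left factor of `v_i⋯v_k`. -/
def StarDecomp (w : Word S) (L : List (Word S)) : Prop :=
  w = L.flatten ∧ (∀ v ∈ L, v ≠ ([] : Word S)) ∧
    ∀ i (h : i < L.length), MaxSignedSFPrefix (L.get ⟨i, h⟩) ((L.drop i).flatten)

/-! ### Groups, parabolic subgroups, geodesics -/

/-- A word written over `T ∪ T⁻¹` for a subset `T` of the generators. -/
def WordOver (T : Set S) (w : Word S) : Prop := ∀ l ∈ w, l.1 ∈ T

/-- The standard parabolic subgroup `A_T` generated by the image of `T ⊆ S`. -/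
def parab (A : ArtinData S) (T : Set S) : Subgroup (ArtinGroup A) :=
  Subgroup.closure {x | ∃ s ∈ T, x = wbar A [(s, true)]}

/-- A geodesic word: of minimal length among all words representing the same element. -/
def Geodesic (A : ArtinData S) (w : Word S) : Prop :=
  ∀ w' : Word S, wbar A w' = wbar A w → w.length ≤ w'.length

/-- A word over `T ∪ T⁻¹` that is geodesic among the words over `T ∪ T⁻¹` representing the
same element. -/
def GeodesicOver (A : ArtinData S) (T : Set S) (w : Word S) : Prop :=
  WordOver T w ∧
    ∀ w' : Word S, WordOver T w' → wbar A w' = wbar A w → w.length ≤ w'.length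

/-- The length of a group element: the length of any geodesic representative word. -/
noncomputable def elLength (A : ArtinData S) (g : ArtinGroup A) : ℕ :=
  sInf {n | ∃ w : Word S, wbar A w = g ∧ w.length = n}

/-- A positive element: one represented by a positive word. -/
def IsPosElt (A : ArtinData S) (g : ArtinGroup A) : Prop :=
  ∃ w : Word S, Positive w ∧ wbar A w = g

/-- An `H`-transversal: a subset containing `1` and exactly one element of each left
`H`-coset. -/
def IsLeftTransversal {G : Type*} [Group G] (H : Subgroup G) (T : Set G) : Prop :=
  (1 : G) ∈ T ∧ ∀ g : G, ∃! x, x ∈ T ∧ g⁻¹ * x ∈ H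

/-! ### Properties H, H⁺, H# -/

/-- Property `H`: `w →_{0,1,2} ε ↔ w̄ = 1`. -/
def PropertyH (A : ArtinData S) : Prop :=
  ∀ w : Word S, Steps012 A w [] ↔ wbar A w = 1

/-- Property `H⁺`: every word representing an element of a standard parabolic subgroup
`A_{S₀}` can be transformed by `→_{0,1,2⋆}` into a word over `S₀ ∪ S₀⁻¹`. -/
def PropertyHPlus (A : ArtinData S) : Prop :=
  ∀ (S₀ : Set S) (w : Word S), wbar A w ∈ parab A S₀ →
    ∃ w₀ : Word S, WordOver S₀ w₀ ∧ Steps012Star A w w₀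

/-- Property `H#` with respect to an `S`-sequence of transversals `T`. -/
def PropertyHSharpWrt (A : ArtinData S) (T : Set S → Set (ArtinGroup A)) : Prop :=
  (∀ S₀ : Set S, IsLeftTransversal (parab A S₀) (T S₀)) ∧
    ∀ (S' S₀ : Set S) (w : Word S), wbar A w ∈ parab A S' →
      ∃ v u : Word S, WordOver S' v ∧ WordOver (S' ∩ S₀) u ∧
        Steps012 A w (v ++ u) ∧ wbar A v ∈ T S₀

/-- Property `H#`: property `H#` with respect to some `S`-sequence of transversals. -/
def PropertyHSharp (A : ArtinData S) : Prop :=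
  ∃ T : Set S → Set (ArtinGroup A), PropertyHSharpWrt A T

/-! ### Critical words and the involution τ (relative to a dihedral pair) -/

/-- The permutation `δ` induced by conjugation by `Δ`, extended letterwise to words:
the identity if `M` is even, and the swap of `s` and `t` if `M` is odd. -/
noncomputable def deltaMap (s t : S) (M : ℕ) (w : Word S) : Word S :=
  if Even M then w
  else w.map fun l => (if l.1 = s then t else if l.1 = t then s else l.1, l.2)

/-- `w` is an unsigned critical word (of the dihedral pair `{s,t}` with label `M`) and
`w' = τ(w)`. -/
def UCritTauPair (A : ArtinData S) (s t : S) (M : ℕ) (w w' : Word S) : Prop :=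
  WordOver {s, t} w ∧ FreelyReduced w ∧ Unsigned w ∧ GeodesicOver A {s, t} w ∧
  pfun M w + nfun M w = M ∧
  ∃ (x y z z' : S) (wm : Word S),
    ({x, y} : Set S) = {s, t} ∧ ({z, z'} : Set S) = {s, t} ∧
    ((w = altWord x y (pfun M w) ++ wm ++ wordInv (altWord z z' (nfun M w)) ∧
      w' = wordInv (altWordR x y (nfun M w)) ++ deltaMap s t M wm ++
        altWordR z z' (pfun M w)) ∨
     (w = wordInv (altWordR x y (nfun M w)) ++ wm ++ altWordR z z' (pfun M w) ∧
      w' = altWord x y (pfun M w) ++ deltaMap s t M wm ++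
        wordInv (altWord z z' (nfun M w))))

/-- `w` is a positive critical word (of the dihedral pair `{s,t}` with label `M`) and
`w' = τ(w)`. -/
def PosCritTauPair (A : ArtinData S) (s t : S) (M : ℕ) (w w' : Word S) : Prop :=
  WordOver {s, t} w ∧ Positive w ∧ pfun M w = M ∧
  ∃ (x y : S) (wm : Word S), ({x, y} : Set S) = {s, t} ∧ pfun M wm < M ∧
    ((w = altWord x y M ++ wm ∧
      (w' = deltaMap s t M wm ++ altWordR x y M ∨
       w' = deltaMap s t M wm ++ altWordR y x M) ∧
      w'.getLast? ≠ w.getLast?) ∨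
     (w = wm ++ altWordR x y M ∧
      (w' = altWord x y M ++ deltaMap s t M wm ∨
       w' = altWord y x M ++ deltaMap s t M wm) ∧
      w'.head? ≠ w.head?))

/-- `w` is a negative critical word and `w' = τ(w)` (defined via formal inverses). -/
def NegCritTauPair (A : ArtinData S) (s t : S) (M : ℕ) (w w' : Word S) : Prop :=
  PosCritTauPair A s t M (wordInv w) (wordInv w')

/-- `w` is a critical word (unsigned, positive or negative) and `w' = τ(w)`. -/
def CritTauPair (A : ArtinData S) (s t : S) (M : ℕ) (w w' : Word S) : Prop :=
  UCritTauPair A s t M w w' ∨ PosCritTauPair A s t M w w' ∨ NegCritTauPair A s t M w w'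

/-- A type β transformation relative to the dihedral pair `{s,t}` with label `M`:
replace a critical factor `v` by `τ(v)`. -/
def StepBetaPair (A : ArtinData S) (s t : S) (M : ℕ) (w w' : Word S) : Prop :=
  ∃ (w₁ w₂ v v' : Word S), w = w₁ ++ v ++ w₂ ∧ w' = w₁ ++ v' ++ w₂ ∧
    CritTauPair A s t M v v'

/-- A type β transformation (in an Artin–Tits group): a type β transformation relative to some
dihedral standard parabolic subgroup (a pair of generators with finite label). -/
def StepBeta (A : ArtinData S) (w w' : Word S) : Prop :=
  ∃ (s t : S) (M : ℕ), s ≠ t ∧ A.m s t = (M : ℕ∞) ∧ StepBetaPair A s t M w w'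

/-! ### Restriction, direct products, Coxeter graph notions -/

/-- The Artin–Tits presentation induced on a subset `T` of the generators (the presentation of
the standard parabolic subgroup `A_T`). -/
def ArtinData.restrict (A : ArtinData S) (T : Set S) : ArtinData T where
  m a b := A.m a b
  symm a b := A.symm a b
  two_le a b h := A.two_le a b fun h' => h (Subtype.ext h')

/-- The Artin–Tits presentation on the disjoint union `S₁ ⊕ S₂` obtained from presentations on
`S₁` and `S₂` by adding the commuting relations `s₁s₂ = s₂s₁` (label `2`) for `s₁ ∈ S₁`,
`s₂ ∈ S₂`. -/
def prodData {S₁ S₂ : Type*} (A₁ : ArtinData S₁) (A₂ : ArtinData S₂) :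
    ArtinData (S₁ ⊕ S₂) where
  m x y :=
    match x, y with
    | Sum.inl a, Sum.inl b => A₁.m a b
    | Sum.inr a, Sum.inr b => A₂.m a b
    | _, _ => 2
  symm x y := by
    cases x <;> cases y
    · exact A₁.symm _ _
    · rfl
    · rfl
    · exact A₂.symm _ _
  two_le x y h := by
    cases x <;> cases y
    · exact A₁.two_le _ _ fun h' => h (congrArg Sum.inl h')
    · exact le_rfl
    · exact le_rfl
    · exact A₂.two_le _ _ fun h' => h (congrArg Sum.inr h')

/-- Adjacency in the Coxeter graph `Γ` restricted to `T`: distinct vertices of `T` joined by an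
edge (i.e. with label `≠ 2`, edges labelled `2` being removed in `Γ`). -/
def coxAdj (A : ArtinData S) (T : Set S) (x y : S) : Prop :=
  x ∈ T ∧ y ∈ T ∧ x ≠ y ∧ A.m x y ≠ 2

/-- The full subgraph of the Coxeter graph on the vertex subset `T` is connected. -/
def CoxConnected (A : ArtinData S) (T : Set S) : Prop :=
  ∀ x ∈ T, ∀ y ∈ T, Relation.ReflTransGen (coxAdj A T) x y

/-- The relator set of the Coxeter presentation on `T`: the Artin relations together with the
squares of the generators. -/
def coxRels (A : ArtinData S) (T : Set S) : Set (FreeGroup T) :=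
  rels (A.restrict T) ∪ {g | ∃ x : T, g = FreeGroup.of x * FreeGroup.of x}

/-- The induced presentation on `T` is of spherical type: its Coxeter group is finite. -/
def SphericalType (A : ArtinData S) (T : Set S) : Prop :=
  Finite (PresentedGroup (coxRels A T))

/-- The induced presentation on `T` is of large type: all labels are `≥ 3` (possibly `∞`). -/
def LargeTypeOn (A : ArtinData S) (T : Set S) : Prop :=
  ∀ x ∈ T, ∀ y ∈ T, x ≠ y → 3 ≤ A.m x y

/-! ### Classes of words in presented groups -/

/-- The element of the group with relator set `R` represented by a word. -/
def cls (R : Set (FreeGroup S)) (u : Word S) : PresentedGroup R :=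
  PresentedGroup.mk R (FreeGroup.mk u)

theorem wbar_eq_cls (A : ArtinData S) (u : Word S) : wbar A u = cls (rels A) u := rfl

theorem cls_nil (R : Set (FreeGroup S)) : cls R [] = 1 := by
  rw [cls, ← FreeGroup.one_eq_mk, map_one]

theorem cls_append (R : Set (FreeGroup S)) (u v : Word S) :
    cls R (u ++ v) = cls R u * cls R v := by
  rw [cls, cls, cls, ← map_mul, FreeGroup.mul_mk]

theorem cls_pair (R : Set (FreeGroup S)) (s : S) (b : Bool) : cls R [(s, b), (s, !b)] = 1 := by
  have h : FreeGroup.mk [(s, b), (s, !b)] = FreeGroup.mk [] :=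
    Quot.sound (FreeGroup.Red.Step.not (L₁ := []) (L₂ := []))
  rw [cls, h, ← FreeGroup.one_eq_mk, map_one]

theorem cls_not (R : Set (FreeGroup S)) (s : S) (b : Bool) :
    cls R [(s, !b)] = (cls R [(s, b)])⁻¹ := by
  rw [eq_inv_iff_mul_eq_one, ← cls_append]
  simpa using cls_pair R s (!b)

theorem wordInv_append (u v : Word S) : wordInv (u ++ v) = wordInv v ++ wordInv u := by
  simp [wordInv]

theorem wordInv_cons (s : S) (b : Bool) (u : Word S) :
    wordInv ((s, b) :: u) = wordInv u ++ [(s, !b)] := by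
  simp [wordInv]

theorem wordInv_wordInv (u : Word S) : wordInv (wordInv u) = u := by
  simp [wordInv, Function.comp_def]

theorem wordInv_length (u : Word S) : (wordInv u).length = u.length := by
  simp [wordInv]

theorem cls_wordInv (R : Set (FreeGroup S)) (u : Word S) : cls R (wordInv u) = (cls R u)⁻¹ := by
  induction u with
  | nil => simp [wordInv, cls_nil]
  | cons g u ih =>
    obtain ⟨s, b⟩ := g
    rw [wordInv_cons, cls_append, ih, cls_not, ← mul_inv_rev, ← cls_append, List.singleton_append]

theorem cls_rel {R : Set (FreeGroup S)} {u v : Word S}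
    (h : FreeGroup.mk u * (FreeGroup.mk v)⁻¹ ∈ R) : cls R u = cls R v :=
  PresentedGroup.mk_eq_mk_of_mul_inv_mem h

/-- Let the letters of a word act successively on a point. -/
def run {X : Type*} (act : S × Bool → X → X) (u : Word S) (x : X) : X :=
  u.foldl (fun x g => act g x) x

@[simp] theorem run_nil {X : Type*} (act : S × Bool → X → X) (x : X) : run act [] x = x := rfl

@[simp] theorem run_cons {X : Type*} (act : S × Bool → X → X) (g : S × Bool) (u : Word S) (x : X) :
    run act (g :: u) x = run act u (act g x) := rfl

theorem run_append {X : Type*} (act : S × Bool → X → X) (u v : Word S) (x : X) :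
    run act (u ++ v) x = run act v (run act u x) := by
  simp [run]

/-- A system of letter actions that is compatible with inverses and with the relators respects
equality in the presented group. -/
theorem run_eq_of_cls_eq {X : Type*} {R : Set (FreeGroup S)} (act : S × Bool → X → X)
    (hinv : ∀ s b x, act (s, !b) (act (s, b) x) = x)
    (hR : ∀ r ∈ R, ∃ u v : Word S, r = FreeGroup.mk u * (FreeGroup.mk v)⁻¹ ∧
      ∀ x, run act u x = run act v x)
    {u v : Word S} (h : cls R u = cls R v) (x : X) : run act u x = run act v x := by
  let P : S → Equiv.Perm X := fun s =>
    ⟨act (s, true), act (s, false), hinv s true, hinv s false⟩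
  let φ : FreeGroup S →* (Equiv.Perm X)ᵐᵒᵖ := FreeGroup.lift fun s => MulOpposite.op (P s)
  have hφ : ∀ (w : Word S) (y : X), (φ (FreeGroup.mk w)).unop y = run act w y := by
    intro w
    induction w with
    | nil => intro y; rw [← FreeGroup.one_eq_mk, map_one]; rfl
    | cons g w ih =>
      intro y
      obtain ⟨s, b⟩ := g
      rw [← List.singleton_append, ← FreeGroup.mul_mk, map_mul, MulOpposite.unop_mul,
        Equiv.Perm.mul_apply, ih, List.singleton_append, run_cons]
      cases b <;> rfl
  have hφR : ∀ r ∈ R, FreeGroup.lift (fun s => MulOpposite.op (P s)) r = 1 := by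
    intro r hr
    obtain ⟨u, v, rfl, huv⟩ := hR r hr
    rw [map_mul, map_inv, mul_inv_eq_one]
    apply MulOpposite.unop_injective
    ext y
    exact (hφ u y).trans ((huv y).trans (hφ v y).symm)
  have key : φ (FreeGroup.mk u) = φ (FreeGroup.mk v) :=
    congrArg (PresentedGroup.toGroup hφR) h
  rw [← hφ, ← hφ, key]

/-- The exponent sum of a word. -/
def expSum (u : Word S) : ℤ := (u.map fun g => if g.2 then (1 : ℤ) else -1).sum

theorem expSum_altWord (s t : S) (k : ℕ) : expSum (altWord s t k) = k := by
  induction k generalizing s t with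
  | zero => rfl
  | succ k ih =>
    have := ih t s
    simp only [expSum, altWord, List.map_cons, List.sum_cons] at this ⊢
    rw [this, if_pos trivial]; push_cast; ring

theorem expSum_le_length (u : Word S) : |expSum u| ≤ u.length := by
  induction u with
  | nil => simp [expSum]
  | cons g u ih =>
    have h : expSum (g :: u) = (if g.2 then (1 : ℤ) else -1) + expSum u := by simp [expSum]
    rw [h, List.length_cons, abs_le] at *
    push_cast
    split_ifs <;> constructor <;> linarith [ih.1, ih.2]

theorem expSum_parity (u : Word S) : (expSum u - u.length) % 2 = 0 := by
  induction u with
  | nil => simp [expSum]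
  | cons g u ih =>
    have h : expSum (g :: u) = (if g.2 then (1 : ℤ) else -1) + expSum u := by simp [expSum]
    rw [h, List.length_cons]
    push_cast
    split_ifs <;> omega

theorem expSum_eq_of_cls_eq {R : Set (FreeGroup S)}
    (hR : ∀ r ∈ R, ∃ u v : Word S, r = FreeGroup.mk u * (FreeGroup.mk v)⁻¹ ∧
      expSum u = expSum v)
    {u v : Word S} (h : cls R u = cls R v) : expSum u = expSum v := by
  let act : S × Bool → ℤ → ℤ := fun g n => n + if g.2 then 1 else -1
  have hrun : ∀ (w : Word S) (n : ℤ), run act w n = n + expSum w := by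
    intro w
    induction w with
    | nil => simp [expSum]
    | cons g w ih =>
      intro n
      rw [run_cons, ih]
      simp only [act, expSum, List.map_cons, List.sum_cons]
      ring
  have := run_eq_of_cls_eq act (by intro s b x; cases b <;> simp [act])
    (fun r hr => by
      obtain ⟨u, v, h1, h2⟩ := hR r hr
      exact ⟨u, v, h1, fun x => by rw [hrun, hrun, h2]⟩) h 0
  simpa [hrun] using this

/-- All letters of the word have sign `σ`. -/
def Uniform (σ : Bool) (u : Word S) : Prop := ∀ g ∈ u, g.2 = σ

theorem Uniform.expSum {σ : Bool} {u : Word S} (h : Uniform σ u) :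
    expSum u = if σ then (u.length : ℤ) else -u.length := by
  induction u with
  | nil => simp [ArtinTits.expSum]
  | cons g u ih =>
    have h' := ih fun x hx => h x (List.mem_cons_of_mem _ hx)
    have hg := h g List.mem_cons_self
    simp only [ArtinTits.expSum, List.map_cons, List.sum_cons, List.length_cons] at h' ⊢
    rw [h', hg]
    cases σ
    · simp
    · simp; ring

theorem uniform_of_expSum {σ : Bool} {u : Word S}
    (h : expSum u = if σ then (u.length : ℤ) else -u.length) : Uniform σ u := by
  induction u with
  | nil => intro g hg; simp at hg
  | cons g u ih =>
    have h' : expSum (g :: u) = (if g.2 then (1 : ℤ) else -1) + expSum u := by simp [expSum]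
    have hle := abs_le.1 (expSum_le_length u)
    rw [h', List.length_cons] at h
    push_cast at h
    have hg : g.2 = σ := by
      cases hg : g.2 <;> cases σ <;> simp [hg] at h ⊢ <;> linarith [hle.1, hle.2]
    intro x hx
    rcases List.mem_cons.1 hx with rfl | hx
    · exact hg
    · refine ih ?_ x hx
      rw [hg] at h
      cases σ <;> simp at h ⊢ <;> linarith

/-! ### Alternating words of the dihedral presentation -/

/-- The name `c`, flipped `n` times. -/
def flipN (n : ℕ) (c : Bool) : Bool := xor c (decide (n % 2 = 1))

theorem flipN_congr {m n : ℕ} (h : m % 2 = n % 2) (c : Bool) : flipN m c = flipN n c := by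
  simp [flipN, h]

@[simp] theorem flipN_zero (c : Bool) : flipN 0 c = c := by simp [flipN]

theorem flipN_add (m n : ℕ) (c : Bool) : flipN m (flipN n c) = flipN (m + n) c := by
  unfold flipN
  rcases Nat.mod_two_eq_zero_or_one m with hm | hm <;>
    rcases Nat.mod_two_eq_zero_or_one n with hn | hn <;>
    simp [Nat.add_mod, hm, hn]

theorem not_eq_flipN (c : Bool) : (!c) = flipN 1 c := by simp [flipN]

theorem flipN_not (n : ℕ) (c : Bool) : flipN n (!c) = flipN (n + 1) c := by
  rw [not_eq_flipN, flipN_add]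

theorem not_flipN (n : ℕ) (c : Bool) : (!flipN n c) = flipN (n + 1) c := by
  rw [not_eq_flipN, flipN_add, Nat.add_comm]

@[simp] theorem flipN_flipN (n : ℕ) (c : Bool) : flipN n (flipN n c) = c := by
  rw [flipN_add, flipN_congr (show (n + n) % 2 = 0 % 2 by omega), flipN_zero]

theorem flipN_inj {n : ℕ} {c d : Bool} (h : flipN n c = flipN n d) : c = d := by
  simpa using congrArg (flipN n) h

/-- The alternating word with `n` letters of sign `σ`, beginning with the name `c`. -/
def alt (σ : Bool) (c : Bool) : ℕ → Word Bool
  | 0 => []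
  | n + 1 => (c, σ) :: alt σ (!c) n

theorem alt_succ (σ c : Bool) (n : ℕ) : alt σ c (n + 1) = (c, σ) :: alt σ (!c) n := rfl

theorem alt_length (σ c : Bool) (n : ℕ) : (alt σ c n).length = n := by
  induction n generalizing c with
  | zero => rfl
  | succ n ih => simp [alt, ih]

theorem alt_append (σ c : Bool) (n k : ℕ) :
    alt σ c n ++ alt σ (flipN n c) k = alt σ c (n + k) := by
  induction n generalizing c with
  | zero => simp [alt]
  | succ n ih =>
    rw [show n + 1 + k = (n + k) + 1 by omega, alt_succ, alt_succ, ← ih, ← flipN_not,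
      List.cons_append]

theorem alt_succ_last (σ c : Bool) (n : ℕ) :
    alt σ c (n + 1) = alt σ c n ++ [(flipN n c, σ)] := by
  rw [← alt_append]; rfl

theorem alt_uniform (σ c : Bool) (n : ℕ) : Uniform σ (alt σ c n) := by
  induction n generalizing c with
  | zero => intro g hg; simp [alt] at hg
  | succ n ih =>
    intro g hg
    rcases List.mem_cons.1 hg with rfl | hg
    · rfl
    · exact ih _ g hg

theorem wordInv_alt (σ c : Bool) (n : ℕ) :
    wordInv (alt σ c n) = alt (!σ) (flipN (n + 1) c) n := by
  induction n generalizing c with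
  | zero => rfl
  | succ n ih =>
    rw [alt_succ, wordInv_cons, ih, alt_succ_last, flipN_not, flipN_add,
      flipN_congr (m := n + (n + 1 + 1)) (n := 0) (by omega), flipN_zero]

theorem altWord_eq_alt (c d : Bool) (h : c ≠ d) (n : ℕ) : altWord c d n = alt true c n := by
  induction n generalizing c d with
  | zero => rfl
  | succ n ih =>
    rw [altWord, alt_succ, ih d c h.symm]
    congr 2
    revert h; cases c <;> cases d <;> simp

/-- The dihedral Artin data with label `M`. -/
def dih (M : ℕ) (hM : 2 ≤ M) : ArtinData Bool where
  m _ _ := M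
  symm _ _ := rfl
  two_le _ _ _ := by exact_mod_cast hM

theorem isRel_dih {M : ℕ} (hM : 2 ≤ M) (c : Bool) :
    IsRel (dih M hM) (alt true c M) (alt true (!c) M) :=
  ⟨c, !c, M, by simp, rfl, (altWord_eq_alt _ _ (by simp) _).symm,
    (altWord_eq_alt _ _ (by simp) _).symm⟩

theorem eq_alt_of_isRel_dih {M : ℕ} {hM : 2 ≤ M} {u v : Word Bool} (h : IsRel (dih M hM) u v) :
    ∃ c, u = alt true c M ∧ v = alt true (!c) M := by
  obtain ⟨s, t, k, hst, hk, rfl, rfl⟩ := h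
  have hk' : M = k := by exact_mod_cast (show (M : ℕ∞) = k from hk)
  subst hk'
  have ht : t = !s := by revert hst; cases s <;> cases t <;> simp
  subst ht
  exact ⟨s, altWord_eq_alt _ _ hst _, altWord_eq_alt _ _ hst.symm _⟩

theorem step1_alt {M : ℕ} (hM : 2 ≤ M) (σ c : Bool) (w₁ w₂ : Word Bool) :
    Step1 (dih M hM) (w₁ ++ alt σ c M ++ w₂) (w₁ ++ alt σ (!c) M ++ w₂) := by
  cases σ
  · refine ⟨w₁, w₂, alt true (flipN M c) M, alt true (flipN (M + 1) c) M, ?_, Or.inr ?_⟩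
    · simpa [not_flipN] using isRel_dih hM (flipN M c)
    · rw [wordInv_alt, wordInv_alt, flipN_add, flipN_add,
        flipN_congr (m := M + 1 + (M + 1)) (n := 0) (by omega), flipN_zero,
        flipN_congr (m := M + 1 + M) (n := 1) (by omega), ← not_eq_flipN]
      exact ⟨rfl, rfl⟩
  · exact ⟨w₁, w₂, alt true (!c) M, alt true c M, by simpa using isRel_dih hM (!c),
      Or.inl ⟨rfl, rfl⟩⟩

/-! ### The normal form model of the dihedral group -/

/-- States: the lengths of the proper simple factors (last one first), the name of the last
letter, and the exponent of the Garside element. -/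
abbrev DState := List ℕ × Bool × ℤ

/-- The state with given data; the name is normalized when there is no proper factor. -/
def mkState (Q : List ℕ) (c : Bool) (j : ℤ) : DState :=
  match Q with
  | [] => ([], false, j)
  | q :: Q => (q :: Q, c, j)

/-- Right multiplication by a letter, on states. -/
def dact (M : ℕ) : Bool × Bool → DState → DState
  | (x, true), ([], _, j) => ([1], x, j)
  | (x, true), (q :: Q, c, j) =>
    if x = c then (1 :: q :: Q, c, j)
    else if q + 1 = M then mkState Q c (j + 1) else ((q + 1) :: Q, !c, j)
  | (x, false), ([], _, j) => ([M - 1], !x, j - 1)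
  | (x, false), (q :: Q, c, j) =>
    if x = c then (if q = 1 then mkState Q c j else ((q - 1) :: Q, !c, j))
    else ((M - 1) :: q :: Q, c, j - 1)

/-- The admissible states. -/
def DValid (M : ℕ) (s : DState) : Prop :=
  (∀ q ∈ s.1, 1 ≤ q ∧ q < M) ∧ (s.1 = [] → s.2.1 = false)

theorem mkState_valid {M : ℕ} {Q : List ℕ} (h : ∀ q ∈ Q, 1 ≤ q ∧ q < M) (c : Bool) (j : ℤ) :
    DValid M (mkState Q c j) := by
  cases Q with
  | nil => exact ⟨by simp [mkState], fun _ => rfl⟩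
  | cons q Q => exact ⟨h, by simp [mkState]⟩

theorem dact_valid {M : ℕ} (hM : 2 ≤ M) (g : Bool × Bool) {s : DState} (hs : DValid M s) :
    DValid M (dact M g s) := by
  obtain ⟨Q, c, j⟩ := s
  obtain ⟨x, b⟩ := g
  obtain ⟨hQ, hc⟩ := hs
  rcases Q with _ | ⟨q, Q⟩
  · cases b
    · exact ⟨by simp [dact]; omega, by simp [dact]⟩
    · exact ⟨by simp [dact]; omega, by simp [dact]⟩
  · have hq := hQ q List.mem_cons_self
    have hQ' : ∀ p ∈ Q, 1 ≤ p ∧ p < M := fun p hp => hQ p (List.mem_cons_of_mem _ hp)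
    cases b
    · by_cases hx : x = c
      · by_cases h1 : q = 1
        · simpa [dact, hx, h1] using mkState_valid hQ' c j
        · refine ⟨?_, by simp [dact, hx, h1]⟩
          simp only [dact, hx, h1, if_true, if_false, List.forall_mem_cons]
          exact ⟨by omega, hQ'⟩
      · refine ⟨?_, by simp [dact, hx]⟩
        simp only [dact, hx, if_false, List.forall_mem_cons]
        exact ⟨by omega, hq, hQ'⟩
    · by_cases hx : x = c
      · refine ⟨?_, by simp [dact, hx]⟩
        simp only [dact, hx, if_true, List.forall_mem_cons]
        exact ⟨by omega, hq, hQ'⟩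
      · by_cases h1 : q + 1 = M
        · simpa only [dact, hx, h1, if_true, if_false] using mkState_valid hQ' c (j + 1)
        · refine ⟨?_, by simp [dact, hx, h1]⟩
          simp only [dact, hx, h1, if_false, List.forall_mem_cons]
          exact ⟨by omega, hQ'⟩

theorem ne_iff_eq_not {x c : Bool} : x ≠ c ↔ x = !c := by cases x <;> cases c <;> simp

theorem dact_inv {M : ℕ} (hM : 2 ≤ M) (x b : Bool) {s : DState} (hs : DValid M s) :
    dact M (x, !b) (dact M (x, b) s) = s := by
  obtain ⟨Q, c, j⟩ := s
  obtain ⟨hQ, hc⟩ := hs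
  rcases Q with _ | ⟨q, Q⟩
  · have hc' : c = false := hc rfl
    subst hc'
    cases b
    · have : M - 1 + 1 = M := by omega
      simp [dact, mkState, this]
    · simp [dact, mkState]
  · have hq : 1 ≤ q ∧ q < M := hQ q List.mem_cons_self
    cases b
    · by_cases hx : x = c
      · subst hx
        by_cases h1 : q = 1
        · subst h1
          rcases Q with _ | ⟨q', Q⟩ <;> simp [dact, mkState]
        · have h2 : q - 1 + 1 = q := by omega
          have h3 : q ≠ M := by omega
          simp [dact, h1, h2, h3]
      · have h2 : M - 1 + 1 = M := by omega
        simp [dact, hx, h2, mkState]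
    · by_cases hx : x = c
      · subst hx
        simp [dact, mkState]
      · by_cases h1 : q + 1 = M
        · subst h1
          obtain rfl := ne_iff_eq_not.1 hx
          rcases Q with _ | ⟨q', Q⟩ <;> simp [dact, mkState]
        · obtain rfl := ne_iff_eq_not.1 hx
          have h3 : q ≠ 0 := by omega
          simp [dact, h1, h3]

/-- A letter opening a new positive factor. -/
theorem dact_new_pos (M : ℕ) {x c : Bool} {Q : List ℕ} (h : Q = [] ∨ x = c) (j : ℤ) :
    dact M (x, true) (Q, c, j) = (1 :: Q, x, j) := by
  rcases Q with _ | ⟨q, Q⟩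
  · rfl
  · obtain rfl : x = c := by simpa using h
    simp [dact]

/-- A letter opening a new negative factor. -/
theorem dact_new_neg (M : ℕ) {x c : Bool} {Q : List ℕ} (h : Q = [] ∨ c = !x) (j : ℤ) :
    dact M (x, false) (Q, c, j) = ((M - 1) :: Q, !x, j - 1) := by
  rcases Q with _ | ⟨q, Q⟩
  · rfl
  · obtain rfl : c = !x := by simpa using h
    simp [dact]

theorem dact_ext_pos {M q : ℕ} (hq : q + 1 < M) (c : Bool) (Q : List ℕ) (j : ℤ) :
    dact M (!c, true) (q :: Q, c, j) = ((q + 1) :: Q, !c, j) := by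
  simp [dact, hq.ne]

theorem dact_ext_neg (M : ℕ) {q : ℕ} (hq : 1 < q) (c : Bool) (Q : List ℕ) (j : ℤ) :
    dact M (c, false) (q :: Q, c, j) = ((q - 1) :: Q, !c, j) := by
  simp [dact, hq.ne']

theorem run_ext_pos {M q k : ℕ} (hq : q + k < M) (c : Bool) (Q : List ℕ) (j : ℤ) :
    run (dact M) (alt true (!c) k) (q :: Q, c, j) = ((q + k) :: Q, flipN k c, j) := by
  induction k generalizing q c with
  | zero => simp [alt]
  | succ k ih =>
    rw [alt_succ, run_cons, dact_ext_pos (by omega), ih (by omega), flipN_not,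
      show q + 1 + k = q + (k + 1) by omega]

theorem run_ext_neg (M : ℕ) {q k : ℕ} (hq : k < q) (c : Bool) (Q : List ℕ) (j : ℤ) :
    run (dact M) (alt false c k) (q :: Q, c, j) = ((q - k) :: Q, flipN k c, j) := by
  induction k generalizing q c with
  | zero => simp [alt]
  | succ k ih =>
    rw [alt_succ, run_cons, dact_ext_neg _ (by omega), ih (by omega), flipN_not,
      show q - 1 - k = q - (k + 1) by omega]

theorem run_new_pos {M k : ℕ} (hk : k + 1 < M) {x c : Bool} {Q : List ℕ} (h : Q = [] ∨ x = c)
    (j : ℤ) : run (dact M) (alt true x (k + 1)) (Q, c, j) = ((k + 1) :: Q, flipN k x, j) := by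
  rw [alt_succ, run_cons, dact_new_pos M h, run_ext_pos (by omega), Nat.add_comm]

theorem run_new_neg {M k : ℕ} (hk : k + 1 < M) {x c : Bool} {Q : List ℕ} (h : Q = [] ∨ c = !x)
    (j : ℤ) : run (dact M) (alt false x (k + 1)) (Q, c, j) =
      ((M - (k + 1)) :: Q, flipN (k + 1) x, j - 1) := by
  rw [alt_succ, run_cons, dact_new_neg M h, run_ext_neg M (by omega), flipN_not,
    show M - 1 - k = M - (k + 1) by omega]

/-- The action of the Garside element. -/
def dshift (M : ℕ) (s : DState) : DState := mkState s.1 (flipN M s.2.1) (s.2.2 + 1)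

theorem run_garside {M : ℕ} (hM : 2 ≤ M) (x : Bool) {s : DState} (hs : DValid M s) :
    run (dact M) (alt true x M) s = dshift M s := by
  obtain ⟨Q, c, j⟩ := s
  obtain ⟨k, rfl⟩ : ∃ k, M = k + 1 + 1 := ⟨M - 2, by omega⟩
  by_cases h : Q = [] ∨ x = c
  · rw [alt_succ_last, run_append, run_new_pos (by omega) h]
    have e : flipN (k + 1) x = !flipN k x := (not_flipN _ _).symm
    simp only [run_cons, run_nil, e, dact, dshift]
    rcases Q with _ | ⟨q, Q⟩
    · simp [mkState]
    · obtain rfl : x = c := by simpa using h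
      simp [mkState]
      rw [flipN_congr]; omega
  · rw [not_or] at h
    rcases Q with _ | ⟨q, Q⟩
    · simp at h
    have hx := ne_iff_eq_not.1 h.2
    subst hx
    have hq := hs.1 q List.mem_cons_self
    obtain ⟨n, hn⟩ : ∃ n, k + 1 + 1 = (q + n) + 1 := ⟨k + 1 - q, by omega⟩
    have e : k + 1 + 1 = n + (1 + q) := by omega
    obtain ⟨p, rfl⟩ : ∃ p, q = p + 1 := ⟨q - 1, by omega⟩
    have e1 : alt true (!c) (k + 1 + 1) =
        alt true (!c) n ++ (flipN n (!c), true) :: alt true (flipN n c) (p + 1) := by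
      rw [e, Nat.add_comm 1 (p + 1), ← alt_append, alt_succ, flipN_not, not_flipN]
      congr 3
      rw [flipN_congr]; omega
    have e2 : dact (k + 1 + 1) (flipN n (!c), true) ((p + 1 + n) :: Q, flipN n c, j) =
        mkState Q (flipN n c) (j + 1) := by
      rw [flipN_not, ← not_flipN]
      simp [dact, hn]
    rw [e1, run_append, run_ext_pos (by omega), run_cons, e2]
    have e3 : mkState Q (flipN n c) (j + 1) = (Q, (mkState Q (flipN n c) (j + 1)).2.1, j + 1) := by
      cases Q <;> rfl
    rw [e3, run_new_pos (by omega), flipN_add]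
    · simp only [dshift, mkState]
      rw [flipN_congr]; omega
    · cases Q with
      | nil => exact Or.inl rfl
      | cons q Q => exact Or.inr rfl

/-- The state of a word. -/
def dstate (M : ℕ) (u : Word Bool) : DState := run (dact M) u ([], false, 0)

theorem base_valid (M : ℕ) (j : ℤ) : DValid M ([], false, j) := ⟨by simp, fun _ => rfl⟩

/-- Equal elements have equal states. -/
theorem dstate_eq_of_cls_eq {M : ℕ} {hM : 2 ≤ M} {u v : Word Bool}
    (h : cls (rels (dih M hM)) u = cls (rels (dih M hM)) v) : dstate M u = dstate M v := by
  let act : Bool × Bool → {s // DValid M s} → {s // DValid M s} :=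
    fun g s => ⟨dact M g s.1, dact_valid hM g s.2⟩
  have hact : ∀ (w : Word Bool) (s : {s // DValid M s}),
      (run act w s).1 = run (dact M) w s.1 := by
    intro w
    induction w with
    | nil => intro s; rfl
    | cons g w ih => intro s; exact ih _
  have key := run_eq_of_cls_eq act (fun s b x => Subtype.ext (dact_inv hM s b x.2)) (by
    rintro r ⟨u, v, huv, rfl⟩
    refine ⟨u, v, rfl, fun x => Subtype.ext ?_⟩
    obtain ⟨c, rfl, rfl⟩ := eq_alt_of_isRel_dih huv
    rw [hact, hact, run_garside hM _ x.2, run_garside hM _ x.2]) h ⟨_, base_valid M 0⟩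
  have := congrArg Subtype.val key
  rwa [hact, hact] at this

/-! ### Rewriting in context -/

/-- Rewriting by type 1 transformations. -/
def Steps1 (A : ArtinData S) : Word S → Word S → Prop := Relation.ReflTransGen (Step1 A)

/-- Rewriting by transformations of types 0 and 1. -/
def Steps01 (A : ArtinData S) : Word S → Word S → Prop :=
  Relation.ReflTransGen fun x y => Step0 x y ∨ Step1 A x y

/-- The word rewrites to a strictly shorter one by transformations of types 0 and 1. -/
def Shrinks (A : ArtinData S) (u : Word S) : Prop :=
  ∃ v, Steps01 A u v ∧ v.length < u.length

theorem IsRel.symm {A : ArtinData S} {u v : Word S} (h : IsRel A u v) : IsRel A v u := by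
  obtain ⟨s, t, k, hst, hk, rfl, rfl⟩ := h
  exact ⟨t, s, k, hst.symm, A.symm s t ▸ hk, rfl, rfl⟩

theorem altWord_length (s t : S) (k : ℕ) : (altWord s t k).length = k := by
  induction k generalizing s t with
  | zero => rfl
  | succ k ih => simp [altWord, ih]

theorem IsRel.length_eq {A : ArtinData S} {u v : Word S} (h : IsRel A u v) :
    u.length = v.length := by
  obtain ⟨s, t, k, hst, hk, rfl, rfl⟩ := h
  rw [altWord_length, altWord_length]

theorem Step1.symm {A : ArtinData S} {u v : Word S} (h : Step1 A u v) : Step1 A v u := by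
  obtain ⟨w₁, w₂, x, y, hr, ⟨rfl, rfl⟩ | ⟨rfl, rfl⟩⟩ := h
  · exact ⟨w₁, w₂, y, x, hr.symm, Or.inl ⟨rfl, rfl⟩⟩
  · exact ⟨w₁, w₂, y, x, hr.symm, Or.inr ⟨rfl, rfl⟩⟩

theorem Step1.length_eq {A : ArtinData S} {u v : Word S} (h : Step1 A u v) :
    u.length = v.length := by
  obtain ⟨w₁, w₂, x, y, hr, ⟨rfl, rfl⟩ | ⟨rfl, rfl⟩⟩ := h <;>
    simp [hr.length_eq, wordInv_length]

theorem Step1.context {A : ArtinData S} {u v : Word S} (h : Step1 A u v) (x y : Word S) :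
    Step1 A (x ++ u ++ y) (x ++ v ++ y) := by
  obtain ⟨w₁, w₂, p, q, hr, ⟨rfl, rfl⟩ | ⟨rfl, rfl⟩⟩ := h
  · exact ⟨x ++ w₁, w₂ ++ y, p, q, hr, Or.inl (by simp)⟩
  · exact ⟨x ++ w₁, w₂ ++ y, p, q, hr, Or.inr (by simp)⟩

theorem Step0.context {u v : Word S} (h : Step0 u v) (x y : Word S) :
    Step0 (x ++ u ++ y) (x ++ v ++ y) := by
  obtain ⟨w₁, w₂, s, b, rfl, rfl⟩ := h
  exact ⟨x ++ w₁, w₂ ++ y, s, b, by simp, by simp⟩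

theorem Steps1.symm {A : ArtinData S} {u v : Word S} (h : Steps1 A u v) : Steps1 A v u := by
  induction h with
  | refl => exact .refl
  | tail _ h ih => exact ih.head h.symm

theorem Steps1.trans {A : ArtinData S} {u v w : Word S} (h : Steps1 A u v)
    (h' : Steps1 A v w) : Steps1 A u w :=
  Relation.ReflTransGen.trans h h'

theorem Steps1.length_eq {A : ArtinData S} {u v : Word S} (h : Steps1 A u v) :
    u.length = v.length := by
  induction h with
  | refl => rfl
  | tail _ h ih => exact ih.trans h.length_eq

theorem Steps1.context {A : ArtinData S} {u v : Word S} (h : Steps1 A u v) (x y : Word S) :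
    Steps1 A (x ++ u ++ y) (x ++ v ++ y) :=
  h.lift (fun w => x ++ w ++ y) fun _ _ h => h.context x y

theorem Steps01.context {A : ArtinData S} {u v : Word S} (h : Steps01 A u v) (x y : Word S) :
    Steps01 A (x ++ u ++ y) (x ++ v ++ y) :=
  h.lift (fun w => x ++ w ++ y) fun _ _ h =>
    h.imp (fun h => h.context x y) (fun h => h.context x y)

theorem Steps1.steps01 {A : ArtinData S} {u v : Word S} (h : Steps1 A u v) : Steps01 A u v :=
  Relation.ReflTransGen.mono (fun _ _ h => Or.inr h) _ _ h

theorem Steps01.steps012Star {A : ArtinData S} {u v : Word S} (h : Steps01 A u v) :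
    Steps012Star A u v :=
  Relation.ReflTransGen.mono (fun _ _ h => h.imp id Or.inl) _ _ h

theorem Shrinks.context {A : ArtinData S} {u : Word S} (h : Shrinks A u) (x y : Word S) :
    Shrinks A (x ++ u ++ y) := by
  obtain ⟨v, h, hl⟩ := h
  exact ⟨x ++ v ++ y, h.context x y, by simpa using hl⟩

theorem Steps1.shrinks {A : ArtinData S} {u v : Word S} (h : Steps1 A u v) (hv : Shrinks A v) :
    Shrinks A u := by
  obtain ⟨w, hw, hl⟩ := hv
  exact ⟨w, h.steps01.trans hw, h.length_eq ▸ hl⟩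

theorem Step0.shrinks {A : ArtinData S} {u v : Word S} (h : Step0 u v) : Shrinks A u := by
  refine ⟨v, .single (Or.inl h), ?_⟩
  obtain ⟨w₁, w₂, s, b, rfl, rfl⟩ := h
  simp

theorem shrinks_cancel (A : ArtinData S) (w₁ w₂ : Word S) (s : S) (b : Bool) :
    Shrinks A (w₁ ++ (s, b) :: (s, !b) :: w₂) :=
  Step0.shrinks (v := w₁ ++ w₂) ⟨w₁, w₂, s, b, by simp, rfl⟩

theorem isLCPrefix_append {v u x : Word S} :
    IsLCPrefix v (v ++ u) (v ++ x) ↔ ∀ g t t', u = g :: t → x = g :: t' → False := by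
  constructor
  · rintro ⟨-, -, h⟩ g t t' rfl rfl
    have := h (v ++ [g]) (by simp) (by simp)
    simp at this
  · refine fun h => ⟨List.prefix_append _ _, List.prefix_append _ _, fun q h1 h2 => ?_⟩
    by_contra hlt
    push Not at hlt
    obtain ⟨r, rfl⟩ := List.prefix_of_prefix_length_le (List.prefix_append v u) h1 hlt.le
    rw [List.prefix_append_right_inj] at h1 h2
    rcases r with _ | ⟨g, r⟩
    · simp at hlt
    · obtain ⟨t, rfl⟩ := h1
      obtain ⟨t', rfl⟩ := h2
      exact h g (r ++ t) (r ++ t') rfl rfl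

theorem isLCSuffix_append {v u x : Word S} :
    IsLCSuffix v (u ++ v) (x ++ v) ↔ ∀ g t t', u = t ++ [g] → x = t' ++ [g] → False := by
  constructor
  · rintro ⟨-, -, h⟩ g t t' rfl rfl
    have := h ([g] ++ v) (by simp) (by simp)
    simp at this
  · refine fun h => ⟨List.suffix_append _ _, List.suffix_append _ _, fun q h1 h2 => ?_⟩
    by_contra hlt
    push Not at hlt
    obtain ⟨r, rfl⟩ := List.suffix_of_suffix_length_le (List.suffix_append u v) h1 hlt.le
    obtain ⟨t, ht⟩ := h1
    obtain ⟨t', ht'⟩ := h2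
    rw [← List.append_assoc, List.append_left_inj] at ht ht'
    rcases List.eq_nil_or_concat r with rfl | ⟨r, g, rfl⟩
    · simp at hlt
    · exact h g (t ++ r) (t' ++ r) (by simp [← ht]) (by simp [← ht'])

/-! ### Block words -/

/-- The name of a letter of sign `σ` that opens a new factor after the letter name `c`. -/
def startName (σ c : Bool) : Bool := if σ then c else !c

theorem startName_startName (σ c : Bool) : startName σ (startName σ c) = c := by
  cases σ <;> simp [startName]

theorem startName_not (σ c : Bool) : startName σ (!c) = !startName σ c := by
  cases σ <;> simp [startName]

theorem startName_not_left (σ c : Bool) : startName (!σ) c = !startName σ c := by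
  cases σ <;> simp [startName]

/-- The number of letters spelling a proper simple factor with a given sign. -/
def blen (M : ℕ) (p : ℕ × Bool) : ℕ := if p.2 then p.1 else M - p.1

/-- The word spelled by a list of proper simple factors, each with a sign. -/
def blockWord (M : ℕ) (c : Bool) : List (ℕ × Bool) → Word Bool
  | [] => []
  | p :: L => alt p.2 (startName p.2 c) (blen M p) ++ blockWord M (flipN (blen M p + 1) c) L

/-- The name of the last letter reached by a block word. -/
def blockEnd (M : ℕ) (c : Bool) : List (ℕ × Bool) → Bool
  | [] => c
  | p :: L => blockEnd M (flipN (blen M p + 1) c) L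

/-- All factors of the block list are proper. -/
def BlockValid (M : ℕ) (L : List (ℕ × Bool)) : Prop := ∀ p ∈ L, 1 ≤ p.1 ∧ p.1 < M

/-- The number of negative blocks. -/
def negCount (L : List (ℕ × Bool)) : ℕ := L.countP fun p => !p.2

theorem blen_pos {M : ℕ} {p : ℕ × Bool} (h : 1 ≤ p.1 ∧ p.1 < M) : 1 ≤ blen M p := by
  unfold blen; split_ifs <;> omega

theorem blen_lt {M : ℕ} {p : ℕ × Bool} (h : 1 ≤ p.1 ∧ p.1 < M) : blen M p < M := by
  unfold blen; split_ifs <;> omega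

theorem blockWord_append (M : ℕ) (c : Bool) (L L' : List (ℕ × Bool)) :
    blockWord M c (L ++ L') = blockWord M c L ++ blockWord M (blockEnd M c L) L' := by
  induction L generalizing c with
  | nil => rfl
  | cons p L ih => simp [blockWord, blockEnd, ih]

theorem blockEnd_append (M : ℕ) (c : Bool) (L L' : List (ℕ × Bool)) :
    blockEnd M c (L ++ L') = blockEnd M (blockEnd M c L) L' := by
  induction L generalizing c with
  | nil => rfl
  | cons p L ih => exact ih _

theorem blockWord_head {M : ℕ} {c : Bool} {L : List (ℕ × Bool)} (hL : BlockValid M L)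
    {g : Bool × Bool} {t : Word Bool} (h : blockWord M c L = g :: t) :
    g.1 = startName g.2 c := by
  rcases L with _ | ⟨p, L⟩
  · simp [blockWord] at h
  · obtain ⟨n, hn⟩ : ∃ n, blen M p = n + 1 :=
      ⟨blen M p - 1, by have := blen_pos (hL p List.mem_cons_self); omega⟩
    rw [blockWord, hn, alt_succ, List.cons_append, List.cons.injEq] at h
    rw [← h.1]

theorem blockWord_last {M : ℕ} {c : Bool} {L : List (ℕ × Bool)} (hL : BlockValid M L)
    {g : Bool × Bool} {t : Word Bool} (h : blockWord M c L = t ++ [g]) :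
    g.1 = startName g.2 (blockEnd M c L) := by
  rcases List.eq_nil_or_concat L with rfl | ⟨L, p, rfl⟩
  · simp [blockWord] at h
  · obtain ⟨n, hn⟩ : ∃ n, blen M p = n + 1 :=
      ⟨blen M p - 1, by have := blen_pos (hL p (by simp)); omega⟩
    rw [List.concat_eq_append, blockWord_append, blockWord, blockWord, hn, alt_succ_last,
      List.append_nil, ← List.append_assoc] at h
    have h' := congrArg List.getLast? h
    simp only [List.getLast?_append, List.getLast?_singleton, Option.some_or,
      Option.some.injEq] at h'
    rw [← h', List.concat_eq_append, blockEnd_append, blockEnd, blockEnd, hn]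
    generalize blockEnd M c L = d
    cases p.2
    · simp [startName, flipN_not, not_flipN,
        flipN_congr (show (n + 1 + 1 + 1) % 2 = (n + 1) % 2 by omega)]
    · simp [startName, flipN_congr (show (n + 1 + 1) % 2 = n % 2 by omega)]

theorem run_blockWord {M : ℕ} {L : List (ℕ × Bool)} (hL : BlockValid M L) (c : Bool)
    (Q : List ℕ) (j : ℤ) : run (dact M) (blockWord M c L) (Q, c, j) =
      ((L.map Prod.fst).reverse ++ Q, blockEnd M c L, j - negCount L) := by
  induction L generalizing c Q j with
  | nil => simp [blockWord, blockEnd, negCount]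
  | cons p L ih =>
    have hp := hL p List.mem_cons_self
    have ih' := fun c => ih (fun x hx => hL x (List.mem_cons_of_mem _ hx)) c
    obtain ⟨n, hn⟩ : ∃ n, blen M p = n + 1 := ⟨blen M p - 1, by have := blen_pos hp; omega⟩
    have hlt := blen_lt hp
    obtain ⟨q, σ⟩ := p
    rw [blockWord, blockEnd, run_append, hn]
    cases σ
    · have hq : M - (n + 1) = q := by simp [blen] at hn hp; omega
      rw [run_new_neg (by omega) (Or.inr (by simp [startName])), hq]
      simp only [startName, Bool.false_eq_true, if_false, flipN_not]
      rw [ih']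
      simp [negCount]
      ring
    · have hq : n + 1 = q := by simpa [blen] using hn.symm
      rw [run_new_pos (by omega) (Or.inr (by simp [startName]))]
      simp only [startName, if_true]
      rw [show flipN n c = flipN (n + 1 + 1) c from flipN_congr (by omega) c, ih', hq]
      simp [negCount]

theorem dact_nil (M : ℕ) (g : Bool × Bool) (c d : Bool) (j : ℤ) :
    dact M g ([], c, j) = dact M g ([], d, j) := by
  obtain ⟨x, b⟩ := g
  cases b <;> rfl

theorem run_blockWord_base {M : ℕ} {L : List (ℕ × Bool)} (hL : BlockValid M L) (c : Bool)
    (j : ℤ) : run (dact M) (blockWord M c L) ([], false, j) =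
      mkState (L.map Prod.fst).reverse (blockEnd M c L) (j - negCount L) := by
  rcases L with _ | ⟨p, L⟩
  · simp [blockWord, negCount, mkState]
  · have e : run (dact M) (blockWord M c (p :: L)) ([], false, j) =
        run (dact M) (blockWord M c (p :: L)) ([], c, j) := by
      rcases hw : blockWord M c (p :: L) with _ | ⟨g, w⟩
      · have := congrArg List.length hw
        have hp := blen_pos (hL p List.mem_cons_self)
        simp [blockWord, alt_length] at this
        omega
      · rw [run_cons, run_cons, dact_nil]
    rw [e, run_blockWord hL, List.append_nil]
    rcases hr : ((p :: L).map Prod.fst).reverse with _ | ⟨q, Q⟩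
    · simp at hr
    · rfl

theorem mkState_inj {Q Q' : List ℕ} {c c' : Bool} {j j' : ℤ}
    (h : mkState Q c j = mkState Q' c' j') : Q = Q' ∧ j = j' ∧ (Q ≠ [] → c = c') := by
  rcases Q with _ | ⟨q, Q⟩ <;> rcases Q' with _ | ⟨q', Q'⟩ <;> simp_all [mkState]

theorem blockEnd_eq {M : ℕ} {L : List (ℕ × Bool)} (hL : BlockValid M L) (c : Bool) :
    blockEnd M c L = flipN ((L.map Prod.fst).sum + L.length + M * negCount L) c := by
  induction L generalizing c with
  | nil => simp [blockEnd, negCount]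
  | cons p L ih =>
    have hp := hL p List.mem_cons_self
    rw [blockEnd, ih fun x hx => hL x (List.mem_cons_of_mem _ hx), flipN_add]
    obtain ⟨q, σ⟩ := p
    apply flipN_congr
    simp only at hp
    cases σ
    · simp only [blen, negCount, List.map_cons, List.sum_cons, List.length_cons,
        List.countP_cons, Bool.not_false, if_true, Bool.false_eq_true, if_false, mul_add]
      omega
    · simp [blen, negCount]
      omega

/-! ### Reduction of dihedral words -/

theorem steps1_alt {M : ℕ} (hM : 2 ≤ M) (σ c d : Bool) (w₁ w₂ : Word Bool) :
    Steps1 (dih M hM) (w₁ ++ alt σ c M ++ w₂) (w₁ ++ alt σ d M ++ w₂) := by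
  by_cases h : d = c
  · subst h; exact .refl
  · rw [ne_iff_eq_not.1 h]; exact .single (step1_alt hM σ c w₁ w₂)

theorem cons_alt (σ x : Bool) (n : ℕ) :
    (x, σ) :: alt σ (!x) n = alt σ x n ++ [(flipN n x, σ)] := by
  rw [← alt_succ, alt_succ_last]

theorem shrinks_of_not_uniform {M : ℕ} (hM : 2 ≤ M) {σ : Bool} (y : Bool) {V : Word Bool}
    (hV : ¬ Uniform σ V) : Shrinks (dih M hM) (alt σ y M ++ V) := by
  induction V generalizing y with
  | nil => exact absurd (fun g hg => by simp at hg) hV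
  | cons g V ih =>
    obtain ⟨x, τ⟩ := g
    obtain ⟨n, rfl⟩ : ∃ n, M = n + 1 := ⟨M - 1, by omega⟩
    by_cases hτ : τ = σ
    · subst hτ
      have hV' : ¬ Uniform τ V := fun h => hV fun g hg => by
        rcases List.mem_cons.1 hg with rfl | hg
        · rfl
        · exact h g hg
      have h1 := steps1_alt hM τ y (flipN (n + 1) x) [] ((x, τ) :: V)
      have e := cons_alt τ (flipN (n + 1) x) (n + 1)
      rw [flipN_flipN] at e
      have h2 : alt τ (flipN (n + 1) x) (n + 1) ++ (x, τ) :: V =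
          [(flipN (n + 1) x, τ)] ++ (alt τ (!flipN (n + 1) x) (n + 1) ++ V) ++ [] := by
        rw [List.append_cons, ← e]; simp
      simp only [List.nil_append] at h1
      exact h1.shrinks (h2 ▸ (ih _ hV').context _ _)
    · obtain rfl : τ = !σ := ne_iff_eq_not.1 hτ
      have h1 := steps1_alt hM σ y (flipN n x) [] ((x, !σ) :: V)
      simp only [List.nil_append] at h1
      refine h1.shrinks ?_
      rw [alt_succ_last, flipN_flipN, List.append_assoc]
      exact shrinks_cancel _ _ _ _ _

/-- A power of the Garside element or of its inverse. -/
def garsidePow (M : ℕ) (σ : Bool) : ℕ → Word Bool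
  | 0 => []
  | i + 1 => alt σ true M ++ garsidePow M σ i

theorem garsidePow_succ (M : ℕ) (σ : Bool) (i : ℕ) :
    garsidePow M σ (i + 1) = garsidePow M σ i ++ alt σ true M := by
  induction i with
  | zero => simp [garsidePow]
  | succ i ih => rw [garsidePow, ih, ← List.append_assoc, ← garsidePow, ← ih]

theorem cons_garsidePow {M : ℕ} (hM : 2 ≤ M) (σ x : Bool) (i : ℕ) :
    ∃ y, ∀ W, Steps1 (dih M hM) ((x, σ) :: (garsidePow M σ i ++ W))
      (garsidePow M σ i ++ (y, σ) :: W) := by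
  induction i generalizing x with
  | zero => exact ⟨x, fun W => .refl⟩
  | succ i ih =>
    obtain ⟨y, hy⟩ := ih (flipN M x)
    refine ⟨y, fun W => ?_⟩
    have h1 := steps1_alt hM σ true (!x) [(x, σ)] (garsidePow M σ i ++ W)
    have h2 := steps1_alt hM σ x true [] ((flipN M x, σ) :: (garsidePow M σ i ++ W))
    have h3 := (hy W).context (alt σ true M) []
    have e : [(x, σ)] ++ alt σ (!x) M ++ (garsidePow M σ i ++ W) =
        [] ++ alt σ x M ++ (flipN M x, σ) :: (garsidePow M σ i ++ W) := by
      rw [List.singleton_append, cons_alt]; simp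
    rw [e] at h1
    simp only [List.append_nil] at h3
    simpa [garsidePow] using (h1.trans h2).trans h3

/-- The block spelled by a single letter of sign `σ`. -/
def oneBlock (M : ℕ) (σ : Bool) : ℕ × Bool := (if σ then 1 else M - 1, σ)

theorem oneBlock_valid {M : ℕ} (hM : 2 ≤ M) (σ : Bool) :
    1 ≤ (oneBlock M σ).1 ∧ (oneBlock M σ).1 < M := by
  cases σ <;> simp [oneBlock] <;> omega

theorem blen_oneBlock {M : ℕ} (hM : 2 ≤ M) (σ : Bool) : blen M (oneBlock M σ) = 1 := by
  cases σ <;> simp [oneBlock, blen]; omega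

theorem cons_blockWord_new {M : ℕ} (hM : 2 ≤ M) {ρ x c : Bool} (h : x = startName ρ c)
    (L : List (ℕ × Bool)) :
    (x, ρ) :: blockWord M c L = blockWord M c (oneBlock M ρ :: L) := by
  rw [blockWord, blen_oneBlock hM, flipN_congr (show (1 + 1) % 2 = 0 % 2 from rfl), flipN_zero]
  simp [oneBlock, alt, h]

/-- Prepending a letter to a block word. -/
theorem cons_blockWord {M : ℕ} (hM : 2 ≤ M) (x ρ c : Bool) {L : List (ℕ × Bool)}
    (hL : BlockValid M L) :
    (∃ c' L', BlockValid M L' ∧ (x, ρ) :: blockWord M c L = blockWord M c' L' ∧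
      ((∀ p ∈ L, p.2 = ρ) → ∀ p ∈ L', p.2 = ρ)) ∨
    (∃ y c' L', BlockValid M L' ∧ (x, ρ) :: blockWord M c L = alt ρ y M ++ blockWord M c' L' ∧
      ((∀ p ∈ L, p.2 = ρ) → ∀ p ∈ L', p.2 = ρ)) ∨
    (Shrinks (dih M hM) ((x, ρ) :: blockWord M c L) ∧ ¬ ∀ p ∈ L, p.2 = ρ) := by
  have hnew : ∀ c', x = startName ρ c' → BlockValid M (oneBlock M ρ :: L) ∧
      ((∀ p ∈ L, p.2 = ρ) → ∀ p ∈ oneBlock M ρ :: L, p.2 = ρ) := by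
    intro c' h
    refine ⟨fun p hp => ?_, fun h p hp => ?_⟩
    · rcases List.mem_cons.1 hp with rfl | hp
      · exact oneBlock_valid hM ρ
      · exact hL p hp
    · rcases List.mem_cons.1 hp with rfl | hp
      · rfl
      · exact h p hp
  by_cases hx : x = startName ρ c
  · exact Or.inl ⟨c, _, (hnew c hx).1, cons_blockWord_new hM hx L, (hnew c hx).2⟩
  rcases L with _ | ⟨⟨q, σ⟩, L⟩
  · have hx' : x = startName ρ (startName ρ x) := (startName_startName _ _).symm
    exact Or.inl ⟨_, _, (hnew _ hx').1, cons_blockWord_new hM hx' [], (hnew _ hx').2⟩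
  have hq : 1 ≤ q ∧ q < M := hL (q, σ) List.mem_cons_self
  have hL' : BlockValid M L := fun p hp => hL p (List.mem_cons_of_mem _ hp)
  obtain rfl := ne_iff_eq_not.1 hx
  by_cases hσ : σ = ρ
  · subst hσ
    have e : (!startName σ c, σ) :: blockWord M c ((q, σ) :: L) =
        alt σ (startName σ (!c)) (blen M (q, σ) + 1) ++
          blockWord M (flipN (blen M (q, σ) + 1) c) L := by
      rw [blockWord, alt_succ, startName_not, Bool.not_not]; rfl
    by_cases hlen : blen M (q, σ) + 1 = M
    · exact Or.inr <| Or.inl ⟨_, _, L, hL', by rw [e, hlen],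
        fun h p hp => h p (List.mem_cons_of_mem _ hp)⟩
    · have hb := blen_lt (M := M) (p := (q, σ)) hq
      obtain ⟨q', hq', hb'⟩ : ∃ q', (1 ≤ q' ∧ q' < M) ∧ blen M (q', σ) = blen M (q, σ) + 1 := by
        cases σ
        · refine ⟨q - 1, ?_⟩
          simp only [blen, Bool.false_eq_true, if_false] at hb hlen ⊢
          omega
        · refine ⟨q + 1, ?_⟩
          simp only [blen, if_true] at hb hlen ⊢
          exact ⟨⟨by omega, by omega⟩, trivial⟩
      refine Or.inl ⟨!c, (q', σ) :: L, ?_, ?_, fun h p hp => ?_⟩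
      · intro p hp
        rcases List.mem_cons.1 hp with rfl | hp
        · exact hq'
        · exact hL' p hp
      · rw [e, blockWord, hb', flipN_not,
          flipN_congr (show (blen M (q, σ) + 1 + 1 + 1) % 2 = (blen M (q, σ) + 1) % 2 by omega)]
      · rcases List.mem_cons.1 hp with rfl | hp
        · rfl
        · exact h p (List.mem_cons_of_mem _ hp)
  · obtain rfl : ρ = !σ := by rw [ne_iff_eq_not.1 hσ, Bool.not_not]
    right; right
    refine ⟨?_, fun h => by have := h (q, σ) List.mem_cons_self; simp at this⟩
    obtain ⟨n, hn⟩ : ∃ n, blen M (q, σ) = n + 1 := ⟨blen M (q, σ) - 1, by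
      have := blen_pos (M := M) (p := (q, σ)) hq; omega⟩
    rw [blockWord, hn, alt_succ, startName_not_left, Bool.not_not]
    simpa using shrinks_cancel (dih M hM) [] _ (startName σ c) (!σ)

theorem sign_eq_of_uniform_blockWord {M : ℕ} {σ : Bool} {L : List (ℕ × Bool)}
    (hL : BlockValid M L) {c : Bool} (h : Uniform σ (blockWord M c L)) : ∀ p ∈ L, p.2 = σ := by
  induction L generalizing c with
  | nil => simp
  | cons p L ih =>
    intro r hr
    rcases List.mem_cons.1 hr with rfl | hr
    · obtain ⟨n, hn⟩ : ∃ n, blen M r = n + 1 := ⟨blen M r - 1, by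
        have := blen_pos (hL r List.mem_cons_self); omega⟩
      exact h (startName r.2 c, r.2) (by rw [blockWord, hn, alt_succ]; simp)
    · exact ih (fun x hx => hL x (List.mem_cons_of_mem _ hx))
        (fun g hg => h g (List.mem_append_right _ hg)) r hr

/-- A dihedral word shrinks, or is a block word, or is uniform and divisible by the Garside
element. -/
theorem dihedral_trichotomy {M : ℕ} (hM : 2 ≤ M) (U : Word Bool) :
    Shrinks (dih M hM) U ∨ (∃ c L, BlockValid M L ∧ U = blockWord M c L) ∨
    ∃ σ i c L, BlockValid M L ∧ Uniform σ U ∧ (∀ p ∈ L, p.2 = σ) ∧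
      Steps1 (dih M hM) U (garsidePow M σ (i + 1) ++ blockWord M c L) := by
  induction U with
  | nil => exact Or.inr (Or.inl ⟨true, [], by simp [BlockValid], rfl⟩)
  | cons g U ih =>
    obtain ⟨x, ρ⟩ := g
    have hcons : ∀ {σ : Bool} {V : Word Bool} {z : Bool}, Uniform σ V → Uniform σ ((z, σ) :: V) :=
      fun h g hg => by
        rcases List.mem_cons.1 hg with rfl | hg
        · rfl
        · exact h g hg
    rcases ih with h | ⟨c, L, hL, rfl⟩ | ⟨σ, i, c, L, hL, hU, hs, h⟩
    · exact Or.inl (by simpa using h.context [(x, ρ)] [])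
    · rcases cons_blockWord hM x ρ c hL with ⟨c', L', hL', e, -⟩ | ⟨y, c', L', hL', e, hs⟩ | h
      · exact Or.inr (Or.inl ⟨c', L', hL', e⟩)
      · by_cases hu : Uniform ρ (blockWord M c' L')
        · refine Or.inr (Or.inr ⟨ρ, 0, c', L', hL', ?_, sign_eq_of_uniform_blockWord hL' hu, ?_⟩)
          · rw [e]
            intro g hg
            rcases List.mem_append.1 hg with hg | hg
            · exact alt_uniform _ _ _ g hg
            · exact hu g hg
          · rw [e]
            simpa [garsidePow] using steps1_alt hM ρ y true [] (blockWord M c' L')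
        · rw [e]
          exact Or.inl (shrinks_of_not_uniform hM y hu)
      · exact Or.inl h.1
    · have h' := h.context [(x, ρ)] []
      simp only [List.singleton_append, List.append_nil] at h'
      by_cases hρ : ρ = σ
      · subst hρ
        obtain ⟨y, hy⟩ := cons_garsidePow hM ρ x (i + 1)
        have h2 := h'.trans (hy (blockWord M c L))
        refine Or.inr (Or.inr ?_)
        rcases cons_blockWord hM y ρ c hL with ⟨c', L', hL', e, hs'⟩ | ⟨z, c', L', hL', e, hs'⟩ | h3
        · exact ⟨ρ, i, c', L', hL', hcons hU, hs' hs, e ▸ h2⟩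
        · refine ⟨ρ, i + 1, c', L', hL', hcons hU, hs' hs, h2.trans ?_⟩
          rw [e, garsidePow_succ M ρ (i + 1), ← List.append_assoc]
          exact steps1_alt hM ρ z true (garsidePow M ρ (i + 1)) (blockWord M c' L')
        · exact absurd hs h3.2
      · obtain rfl : ρ = !σ := ne_iff_eq_not.1 hρ
        refine Or.inl (h'.shrinks ?_)
        obtain ⟨n, hn⟩ : ∃ n, M = n + 1 := ⟨M - 1, by omega⟩
        have h5 := steps1_alt hM σ true x [(x, !σ)] (garsidePow M σ i ++ blockWord M c L)
        rw [garsidePow]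
        refine Steps1.shrinks (by simpa using h5) ?_
        have e : alt σ x M = (x, σ) :: alt σ (!x) n := by rw [hn]; rfl
        rw [e]
        simpa using shrinks_cancel (dih M hM) [] _ x (!σ)

/-! ### Connecting dihedral words of equal value -/

/-- Exchanging the signs of two adjacent blocks of opposite signs. -/
def BlockSwap (L L' : List (ℕ × Bool)) : Prop :=
  ∃ L₁ q₁ q₂ L₂ σ, L = L₁ ++ (q₁, σ) :: (q₂, !σ) :: L₂ ∧ L' = L₁ ++ (q₁, !σ) :: (q₂, σ) :: L₂

theorem BlockSwap.cons {L L' : List (ℕ × Bool)} (h : BlockSwap L L') (p : ℕ × Bool) :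
    BlockSwap (p :: L) (p :: L') := by
  obtain ⟨L₁, q₁, q₂, L₂, σ, rfl, rfl⟩ := h
  exact ⟨p :: L₁, q₁, q₂, L₂, σ, rfl, rfl⟩

theorem BlockSwap.valid {M : ℕ} {L L' : List (ℕ × Bool)} (h : BlockSwap L L')
    (hL : BlockValid M L) : BlockValid M L' := by
  obtain ⟨L₁, q₁, q₂, L₂, σ, rfl, rfl⟩ := h
  intro p hp
  simp only [List.mem_append, List.mem_cons] at hp
  rcases hp with hp | rfl | rfl | hp
  · exact hL p (by simp [hp])
  · exact hL (q₁, σ) (by simp)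
  · exact hL (q₂, !σ) (by simp)
  · exact hL p (by simp [hp])

theorem exists_swap_head_neg {q : ℕ} {L : List (ℕ × Bool)} (h : 0 < negCount L)
    (hq : (L.map Prod.fst).head? = some q) :
    ∃ L', Relation.ReflTransGen BlockSwap L ((q, false) :: L') ∧
      L'.map Prod.fst = (L.map Prod.fst).tail ∧ negCount L = negCount L' + 1 := by
  induction L generalizing q with
  | nil => simp at hq
  | cons p L ih =>
    obtain ⟨q', σ⟩ := p
    obtain rfl : q' = q := by simpa using hq
    cases σ
    · exact ⟨L, .refl, by simp, by simp [negCount]⟩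
    · have h' : 0 < negCount L := by simpa [negCount] using h
      rcases L with _ | ⟨⟨r, τ⟩, L⟩
      · simp [negCount] at h'
      · obtain ⟨L', h1, h2, h3⟩ := ih (q := r) h' (by simp)
        refine ⟨(r, true) :: L', ?_, by simpa using h2, ?_⟩
        · exact (h1.lift (fun L => (q', true) :: L) fun _ _ h => h.cons _).tail
            ⟨[], q', r, L', true, rfl, rfl⟩
        · simp only [negCount, List.countP_cons] at h3 ⊢
          simpa using h3

theorem BlockSwap.symm {L L' : List (ℕ × Bool)} (h : BlockSwap L L') : BlockSwap L' L := by
  obtain ⟨L₁, q₁, q₂, L₂, σ, rfl, rfl⟩ := h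
  exact ⟨L₁, q₁, q₂, L₂, !σ, by simp, by simp⟩

theorem blockSwaps_of_negCount_eq {L L' : List (ℕ × Bool)}
    (hf : L.map Prod.fst = L'.map Prod.fst) (hn : negCount L = negCount L') :
    Relation.ReflTransGen BlockSwap L L' := by
  have hsymm : ∀ {K K'}, Relation.ReflTransGen BlockSwap K K' →
      Relation.ReflTransGen BlockSwap K' K := fun h => by
    induction h with
    | refl => exact .refl
    | tail _ h ih => exact ih.head h.symm
  have hcons : ∀ {K K'} p, Relation.ReflTransGen BlockSwap K K' →
      Relation.ReflTransGen BlockSwap (p :: K) (p :: K') :=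
    fun p h => h.lift (fun L => p :: L) fun _ _ h => h.cons _
  have key : ∀ (q : ℕ) (K K' : List (ℕ × Bool)), K.map Prod.fst = K'.map Prod.fst →
      negCount K = negCount K' + 1 →
      (∀ K₁ : List (ℕ × Bool), K₁.map Prod.fst = K'.map Prod.fst → negCount K₁ = negCount K' →
        Relation.ReflTransGen BlockSwap K₁ K') →
      Relation.ReflTransGen BlockSwap ((q, true) :: K) ((q, false) :: K') := by
    intro q K K' hf hn ih
    rcases K with _ | ⟨⟨r, τ⟩, K⟩
    · simp [negCount] at hn
    · obtain ⟨K₂, h1, h2, h3⟩ := exists_swap_head_neg (q := r)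
        (show 0 < negCount ((r, τ) :: K) by omega) rfl
      refine ((hcons (q, true) h1).tail ⟨[], q, r, K₂, true, rfl, rfl⟩).trans
        (hcons _ (ih _ ?_ ?_))
      · rw [← hf]; simpa using h2
      · have : negCount ((r, true) :: K₂) = negCount K₂ := by simp [negCount]
        omega
  induction hlen : L.length generalizing L L' with
  | zero =>
    obtain rfl : L = [] := List.length_eq_zero_iff.1 hlen
    obtain rfl : L' = [] := by simpa using hf.symm
    exact .refl
  | succ n ih =>
    rcases L with _ | ⟨⟨q, σ⟩, L⟩
    · simp at hlen
    rcases L' with _ | ⟨⟨q', σ'⟩, L'⟩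
    · simp at hf
    simp only [List.map_cons, List.cons.injEq] at hf
    obtain ⟨rfl, hf⟩ := hf
    have hlen' : L.length = n := by simpa using hlen
    have hneg : ∀ K : List (ℕ × Bool), negCount ((q, true) :: K) = negCount K ∧
        negCount ((q, false) :: K) = negCount K + 1 := fun K => by simp [negCount]
    have h1 := hneg L
    have h2 := hneg L'
    have hl : ∀ K : List (ℕ × Bool), K.map Prod.fst = L'.map Prod.fst → K.length = n :=
      fun K h => by
        have h3 := congrArg List.length (h.trans hf.symm)
        simpa [hlen'] using h3
    cases σ <;> cases σ'
    · exact hcons _ (ih hf (by omega) hlen')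
    · refine hsymm (key q L' L hf.symm (by omega) fun K₁ h3 h4 => ?_)
      exact ih h3 h4 (hl _ (h3.trans hf))
    · exact key q L L' hf (by omega) fun K₁ h3 h4 => ih h3 h4 (hl _ h3)
    · exact hcons _ (ih hf (by omega) hlen')

theorem flipN_ne {m n : ℕ} (h : (m + n) % 2 = 1) (c : Bool) : flipN m c ≠ flipN n c := by
  rcases Nat.mod_two_eq_zero_or_one m with hm | hm <;>
    rcases Nat.mod_two_eq_zero_or_one n with hn | hn <;>
    first | omega | simp [flipN, hm, hn]

theorem step2Star_blockSwap {M : ℕ} (hM : 2 ≤ M) (c : Bool) {L L' : List (ℕ × Bool)}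
    (hL : BlockValid M L) (h : BlockSwap L L') :
    Step2Star (dih M hM) (blockWord M c L) (blockWord M c L') := by
  obtain ⟨L₁, q₁, q₂, L₂, σ, rfl, rfl⟩ := h
  have hq₁ : 1 ≤ q₁ ∧ q₁ < M := hL (q₁, σ) (by simp)
  have hq₂ : 1 ≤ q₂ ∧ q₂ < M := hL (q₂, !σ) (by simp)
  have hL₁ : BlockValid M L₁ := fun p hp => hL p (by simp [hp])
  have hL₂ : BlockValid M L₂ := fun p hp => hL p (by simp [hp])
  rw [blockWord_append, blockWord_append]
  generalize hd : blockEnd M c L₁ = d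
  have hlast : ∀ g t, blockWord M c L₁ = t ++ [g] → g.1 = startName g.2 d := fun g t h => by
    rw [← hd]; exact blockWord_last hL₁ h
  generalize blockWord M c L₁ = w₁ at hlast
  obtain ⟨e, he⟩ : ∃ e, e = flipN (M + q₁ + q₂) d := ⟨_, rfl⟩
  have hhead : ∀ g t, blockWord M e L₂ = g :: t → g.1 = startName g.2 e :=
    fun g t h => blockWord_head hL₂ h
  have h1 : blockWord M d ((q₁, true) :: (q₂, false) :: L₂) =
      alt true d q₁ ++ alt false (flipN q₁ d) (M - q₂) ++ blockWord M e L₂ := by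
    simp only [blockWord, blen, startName, if_true, Bool.false_eq_true, if_false, flipN_add,
      not_flipN, he, List.append_assoc]
    rw [flipN_congr (show (q₁ + 1 + 1) % 2 = q₁ % 2 by omega),
      flipN_congr (show (M - q₂ + 1 + (q₁ + 1)) % 2 = (M + q₁ + q₂) % 2 by omega)]
  have h2 : blockWord M d ((q₁, false) :: (q₂, true) :: L₂) =
      alt false (!d) (M - q₁) ++ alt true (flipN (M - q₁ + 1) d) q₂ ++ blockWord M e L₂ := by
    simp only [blockWord, blen, startName, if_true, Bool.false_eq_true, if_false, flipN_add,
      he, List.append_assoc]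
    rw [flipN_congr (show (q₂ + 1 + (M - q₁ + 1)) % 2 = (M + q₁ + q₂) % 2 by omega)]
  have hw : ∀ g t, wordInv (blockWord M e L₂) = t ++ [g] → g.1 = startName (!g.2) e := by
    intro g t h
    have := congrArg wordInv h
    rw [wordInv_wordInv, wordInv_append] at this
    simpa using hhead _ _ this
  have hw₁ : ∀ g t, wordInv w₁ = g :: t → g.1 = startName (!g.2) d := by
    intro g t h
    have := congrArg wordInv h
    obtain ⟨x, b⟩ := g
    rw [wordInv_wordInv, wordInv_cons] at this
    exact hlast _ _ this
  generalize blockWord M e L₂ = w₂ at *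
  obtain ⟨y, hy⟩ : ∃ y, y = flipN (M - q₁) d := ⟨_, rfl⟩
  have hyd : flipN (M - q₁) y = d := by rw [hy, flipN_flipN]
  have hR : IsRel (dih M hM) (alt true y (M - q₁) ++ alt true d q₁)
      (alt true (!y) q₂ ++ alt true (flipN q₂ (!y)) (M - q₂)) := by
    rw [← hyd, alt_append, alt_append, show M - q₁ + q₁ = M by omega,
      show q₂ + (M - q₂) = M by omega]
    exact isRel_dih hM y
  have e1 : alt false (flipN q₁ d) (M - q₂) = wordInv (alt true (flipN q₂ (!y)) (M - q₂)) := by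
    rw [wordInv_alt, hy, not_flipN, flipN_add, flipN_add]
    congr 1
    apply flipN_congr; omega
  have e2 : alt false (!d) (M - q₁) = wordInv (alt true y (M - q₁)) := by
    rw [wordInv_alt, hy, flipN_add, not_eq_flipN]
    congr 1
    apply flipN_congr; omega
  have e3 : flipN (M - q₁ + 1) d = !y := by rw [hy, not_flipN]
  obtain ⟨m₁, hm₁⟩ : ∃ n, M - q₁ = n + 1 := ⟨M - q₁ - 1, by omega⟩
  obtain ⟨m₂, hm₂⟩ : ∃ n, M - q₂ = n + 1 := ⟨M - q₂ - 1, by omega⟩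
  obtain ⟨n₁, rfl⟩ : ∃ n, q₁ = n + 1 := ⟨q₁ - 1, by omega⟩
  obtain ⟨n₂, rfl⟩ : ∃ n, q₂ = n + 1 := ⟨q₂ - 1, by omega⟩
  cases σ
  · left
    refine ⟨w₁, w₂, alt true y (M - (n₁ + 1)), alt true d (n₁ + 1), alt true (!y) (n₂ + 1),
      alt true (flipN (n₂ + 1) (!y)) (M - (n₂ + 1)), hR, by simp [hm₁, alt], by simp [alt],
      ?_, ?_, isLCPrefix_append.2 ?_, isLCPrefix_append.2 ?_⟩
    · simp only [Bool.not_false, h2, e2, e3, List.append_assoc]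
    · simp only [Bool.not_false, h1, e1, List.append_assoc]
    · rintro g t t' h h'
      rw [alt_succ, List.cons.injEq] at h
      have := hw₁ g _ h'
      rw [← h.1] at this
      simp [startName] at this
    · rintro g t t' h h'
      rw [hm₂, alt_succ, List.cons.injEq] at h
      have := hhead g _ h'
      rw [← h.1, he, hy, not_flipN, flipN_add] at this
      simp only [startName, if_true] at this
      exact flipN_ne (by omega) d this
  · right
    refine ⟨w₁, w₂, alt true d (n₁ + 1), alt true y (M - (n₁ + 1)),
      alt true (flipN (n₂ + 1) (!y)) (M - (n₂ + 1)), alt true (!y) (n₂ + 1), hR, by simp [alt],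
      by simp [hm₂, alt], ?_, ?_, isLCSuffix_append.2 ?_, isLCSuffix_append.2 ?_⟩
    · simp only [Bool.not_true, h1, e1, List.append_assoc]
    · simp only [Bool.not_true, h2, e2, e3, List.append_assoc]
    · rintro g t t' h h'
      rw [hm₁, alt_succ_last] at h
      have h3 := (List.append_inj' h rfl).2
      have := hlast g _ h'
      simp only [List.cons.injEq, and_true] at h3
      rw [← h3] at this
      simp only [startName, if_true, hy, flipN_add] at this
      exact flipN_ne (by omega) d (this.trans (flipN_zero d).symm)
    · rintro g t t' h h'
      rw [alt_succ_last] at h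
      have h3 := (List.append_inj' h rfl).2
      have := hw g _ h'
      simp only [List.cons.injEq, and_true] at h3
      rw [← h3] at this
      simp only [startName, Bool.not_true, Bool.false_eq_true, if_false, hy, not_flipN, he,
        flipN_add] at this
      exact flipN_ne (by omega) d this

theorem run_wordInv_dact {M : ℕ} (hM : 2 ≤ M) (u : Word Bool) {s : DState} (hs : DValid M s) :
    run (dact M) (wordInv u) (run (dact M) u s) = s := by
  induction u generalizing s with
  | nil => rfl
  | cons g u ih =>
    obtain ⟨x, b⟩ := g
    rw [wordInv_cons, run_append, run_cons (x := s), ih (dact_valid hM _ hs)]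
    exact dact_inv hM x b hs

theorem run_alt_base {M : ℕ} (hM : 2 ≤ M) (σ x : Bool) (j : ℤ) :
    run (dact M) (alt σ x M) ([], false, j) = ([], false, if σ then j + 1 else j - 1) := by
  cases σ
  · have h := run_wordInv_dact hM (alt true (flipN (M + 1) x) M) (base_valid M (j - 1))
    rw [run_garside hM _ (base_valid M _), wordInv_alt, flipN_flipN] at h
    simpa [dshift, mkState] using h
  · rw [run_garside hM _ (base_valid M _)]
    simp [dshift, mkState]

theorem run_garsidePow {M : ℕ} (hM : 2 ≤ M) (σ : Bool) (i : ℕ) (j : ℤ) :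
    run (dact M) (garsidePow M σ i) ([], false, j) =
      ([], false, if σ then j + i else j - i) := by
  induction i generalizing j with
  | zero => simp [garsidePow]
  | succ i ih =>
    rw [garsidePow, run_append, run_alt_base hM, ih]
    cases σ <;> simp <;> ring

theorem IsRel.cls_eq {A : ArtinData S} {u v : Word S} (h : IsRel A u v) :
    cls (rels A) u = cls (rels A) v :=
  cls_rel ⟨u, v, h, rfl⟩

theorem Step1.cls_eq {A : ArtinData S} {u v : Word S} (h : Step1 A u v) :
    cls (rels A) u = cls (rels A) v := by
  obtain ⟨w₁, w₂, x, y, hr, ⟨rfl, rfl⟩ | ⟨rfl, rfl⟩⟩ := h <;>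
    simp only [cls_append, cls_wordInv, hr.cls_eq]

theorem Steps1.cls_eq {A : ArtinData S} {u v : Word S} (h : Steps1 A u v) :
    cls (rels A) u = cls (rels A) v := by
  induction h with
  | refl => rfl
  | tail _ h ih => exact ih.trans h.cls_eq

/-- A word that does not shrink is, up to type 1 moves, a power of the Garside element followed
by proper simple factors. -/
theorem exists_normalForm {M : ℕ} (hM : 2 ≤ M) {U : Word Bool} (hU : ¬ Shrinks (dih M hM) U) :
    ∃ σ i c L, BlockValid M L ∧ (0 < i → Uniform σ U ∧ ∀ p ∈ L, p.2 = σ) ∧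
      Steps1 (dih M hM) U (garsidePow M σ i ++ blockWord M c L) ∧
      (i = 0 → U = blockWord M c L) ∧
      dstate M U = mkState (L.map Prod.fst).reverse (blockEnd M c L)
        ((if σ then (i : ℤ) else -i) - negCount L) := by
  obtain h | ⟨c, L, hL, rfl⟩ | ⟨σ, i, c, L, hL, hu, hσ, hs⟩ := dihedral_trichotomy hM U
  · exact absurd h hU
  · refine ⟨true, 0, c, L, hL, by simp, .refl, fun _ => rfl, ?_⟩
    rw [dstate, run_blockWord_base hL]
    simp
  · refine ⟨σ, i + 1, c, L, hL, fun _ => ⟨hu, hσ⟩, hs, by simp, ?_⟩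
    rw [dstate_eq_of_cls_eq hs.cls_eq, dstate, run_append, run_garsidePow hM,
      run_blockWord_base hL]
    cases σ <;> simp

theorem steps2Star_blockSwaps {M : ℕ} (hM : 2 ≤ M) (c : Bool) {L L' : List (ℕ × Bool)}
    (hL : BlockValid M L) (h : Relation.ReflTransGen BlockSwap L L') :
    BlockValid M L' ∧ Steps12Star (dih M hM) (blockWord M c L) (blockWord M c L') := by
  induction h with
  | refl => exact ⟨hL, .refl⟩
  | tail _ h ih =>
    exact ⟨h.valid ih.1, ih.2.tail (Or.inr (step2Star_blockSwap hM c ih.1 h))⟩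

theorem Steps1.steps12Star {A : ArtinData S} {u v : Word S} (h : Steps1 A u v) :
    Steps12Star A u v :=
  Relation.ReflTransGen.mono (fun _ _ h => Or.inl h) _ _ h

theorem negCount_of_forall {L : List (ℕ × Bool)} {σ : Bool} (h : ∀ p ∈ L, p.2 = σ) :
    negCount L = if σ then 0 else L.length := by
  cases σ
  · simp only [negCount, Bool.false_eq_true, if_false, List.countP_eq_length]
    intro p hp; simp [h p hp]
  · simp only [negCount, if_true, List.countP_eq_zero]
    intro p hp; simp [h p hp]

/-- Words of equal value that do not shrink are connected by moves of types 1 and 2⋆. -/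
theorem dih_connect {M : ℕ} (hM : 2 ≤ M) {U U' : Word Bool} (hU : ¬ Shrinks (dih M hM) U)
    (hU' : ¬ Shrinks (dih M hM) U')
    (h : cls (rels (dih M hM)) U = cls (rels (dih M hM)) U') :
    Steps12Star (dih M hM) U U' := by
  obtain ⟨σ, i, c, L, hL, hi, hs, -, hd⟩ := exists_normalForm hM hU
  obtain ⟨σ', i', c', L', hL', hi', hs', -, hd'⟩ := exists_normalForm hM hU'
  have hst := dstate_eq_of_cls_eq h
  rw [hd, hd'] at hst
  obtain ⟨h1, h2, h3⟩ := mkState_inj hst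
  have hf : L.map Prod.fst = L'.map Prod.fst := by simpa using h1
  have hlen : L.length = L'.length := by simpa using congrArg List.length hf
  have hn : negCount L ≤ L.length := List.countP_le_length
  have hn' : negCount L' ≤ L'.length := List.countP_le_length
  have hin : i = i' ∧ negCount L = negCount L' ∧ (0 < i → σ = σ') := by
    rcases Nat.eq_zero_or_pos i with h0 | h0 <;> rcases Nat.eq_zero_or_pos i' with h0' | h0'
    · subst h0 h0'
      refine ⟨rfl, ?_, by simp⟩
      simpa using h2
    · have e' := negCount_of_forall (hi' h0').2
      subst h0
      cases σ' <;> simp at h2 e' <;> omega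
    · have e := negCount_of_forall (hi h0).2
      subst h0'
      cases σ <;> simp at h2 e <;> omega
    · have e := negCount_of_forall (hi h0).2
      have e' := negCount_of_forall (hi' h0').2
      cases σ <;> cases σ' <;> simp at h2 e e' ⊢ <;> omega
  obtain ⟨rfl, hneg, hσ⟩ := hin
  have hc : blockWord M c L' = blockWord M c' L' := by
    rcases L with _ | ⟨p, L⟩
    · obtain rfl : L' = [] := by simpa using hf.symm
      rfl
    · have h4 := h3 (by simp)
      rw [blockEnd_eq hL, blockEnd_eq hL', hf, hlen, hneg] at h4
      rw [flipN_inj h4]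
  refine hs.steps12Star.trans (.trans ?_ hs'.symm.steps12Star)
  rcases Nat.eq_zero_or_pos i with rfl | h0
  · rw [← hc]
    exact (steps2Star_blockSwaps hM c hL (blockSwaps_of_negCount_eq hf hneg)).2
  · obtain rfl := hσ h0
    have : L = L' := by
      have e : ∀ K : List (ℕ × Bool), (∀ p ∈ K, p.2 = σ) →
          K = (K.map Prod.fst).map fun q => (q, σ) := by
        intro K hK
        rw [List.map_map]
        conv_lhs => rw [← List.map_id K]
        exact List.map_congr_left fun p hp => by simp [← hK p hp]
      rw [e L (hi h0).2, e L' (hi' h0).2, hf]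
    rw [this, hc]

theorem dih_last_sign {M : ℕ} (hM : 2 ≤ M) {x y : Word Bool} {s b : Bool}
    (hU : ¬ Shrinks (dih M hM) (x ++ [(s, b)])) (hU' : ¬ Shrinks (dih M hM) (y ++ [(s, !b)]))
    (hl : x.length = y.length)
    (h : cls (rels (dih M hM)) (x ++ [(s, b)]) = cls (rels (dih M hM)) (y ++ [(s, !b)])) :
    False := by
  have hexp : expSum (x ++ [(s, b)]) = expSum (y ++ [(s, !b)]) := by
    refine expSum_eq_of_cls_eq ?_ h
    rintro r ⟨u, v, ⟨p, q, k, -, -, rfl, rfl⟩, rfl⟩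
    exact ⟨_, _, rfl, by rw [expSum_altWord, expSum_altWord]⟩
  have huni : ∀ σ, Uniform σ (x ++ [(s, b)]) ∨ Uniform σ (y ++ [(s, !b)]) → False := by
    intro σ hσ
    have hboth : Uniform σ (x ++ [(s, b)]) ∧ Uniform σ (y ++ [(s, !b)]) := by
      rcases hσ with hσ | hσ
      · refine ⟨hσ, uniform_of_expSum ?_⟩
        rw [← hexp, hσ.expSum]; simp [hl]
      · refine ⟨uniform_of_expSum ?_, hσ⟩
        rw [hexp, hσ.expSum]; simp [hl]
    have h1 := hboth.1 (s, b) (by simp)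
    have h2 := hboth.2 (s, !b) (by simp)
    simp only at h1 h2
    subst h1
    simp at h2
  obtain ⟨σ, i, c, L, hL, hi, -, he, hd⟩ := exists_normalForm hM hU
  obtain ⟨σ', i', c', L', hL', hi', -, he', hd'⟩ := exists_normalForm hM hU'
  have h0 : i = 0 := by
    by_contra h0
    exact huni σ (Or.inl (hi (Nat.pos_of_ne_zero h0)).1)
  have h0' : i' = 0 := by
    by_contra h0
    exact huni σ' (Or.inr (hi' (Nat.pos_of_ne_zero h0)).1)
  have hst := dstate_eq_of_cls_eq h
  rw [hd, hd'] at hst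
  obtain ⟨-, -, h3⟩ := mkState_inj hst
  have hne : L ≠ [] := by
    rintro rfl
    simpa [blockWord] using he h0
  have h4 := blockWord_last hL (he h0).symm
  have h5 := blockWord_last hL' (he' h0').symm
  rw [← h3 (by simpa using hne), startName_not_left, ← h4] at h5
  simp at h5

/-! ### Dihedral geodesics -/

/-- A function of the dihedral state that changes by at most one with each letter. -/
def weight (M p : ℕ) (s : DState) : ℤ :=
  (s.1.map fun q : ℕ => min (q : ℤ) (2 * p - q)).sum + (2 * p - M) * s.2.2

theorem weight_mkState (M p : ℕ) (Q : List ℕ) (c : Bool) (j : ℤ) :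
    weight M p (mkState Q c j) = weight M p (Q, c, j) := by
  cases Q <;> rfl

theorem weight_dact {M p : ℕ} (hp : 1 ≤ p) (hpM : p < M) (x b : Bool) {s : DState}
    (hs : DValid M s) : weight M p (dact M (x, b) s) ≤ weight M p s + 1 := by
  obtain ⟨Q, c, j⟩ := s
  have h1 : (1 : ℤ) ≤ p := by exact_mod_cast hp
  have h2 : (p : ℤ) + 1 ≤ M := by exact_mod_cast hpM
  have hM : ((M - 1 : ℕ) : ℤ) = M - 1 := by push_cast [show 1 ≤ M by omega]; ring
  have hmul : ∀ k : ℤ, (2 * (p : ℤ) - M) * (j + k) = (2 * p - M) * j + k * (2 * p - M) :=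
    fun k => by ring
  have hmul' := hmul (-1)
  have hmul'' := hmul 1
  rw [← sub_eq_add_neg] at hmul'
  rcases Q with _ | ⟨q, Q⟩
  · cases b <;> simp only [dact, weight, List.map_cons, List.map_nil, List.sum_cons,
      List.sum_nil, hM, hmul', Nat.cast_one] <;> omega
  · have hq : 1 ≤ q ∧ q < M := hs.1 q (by simp)
    cases b
    · simp only [dact]
      split_ifs <;> (try rw [weight_mkState]) <;>
        simp only [weight, List.map_cons, List.sum_cons, hM, hmul',
        Nat.cast_sub hq.1, Nat.cast_one] <;> omega
    · simp only [dact]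
      split_ifs <;> (try rw [weight_mkState]) <;>
        simp only [weight, List.map_cons, List.sum_cons, hmul'',
        Nat.cast_add, Nat.cast_one] <;> omega

theorem weight_run {M p : ℕ} (hM : 2 ≤ M) (hp : 1 ≤ p) (hpM : p < M) (u : Word Bool)
    {s : DState} (hs : DValid M s) : weight M p (run (dact M) u s) ≤ weight M p s + u.length := by
  induction u generalizing s with
  | nil => simp
  | cons g u ih =>
    have h1 := ih (dact_valid hM g hs)
    have h2 := weight_dact hp hpM g.1 g.2 hs
    simp only [run_cons, List.length_cons, Nat.cast_add, Nat.cast_one, Prod.mk.eta] at *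
    omega

/-- A proper simple factor that is a single letter, or two letters of sign `τ`. -/
def Tight (M : ℕ) (τ : Bool) (W : Word Bool) (c : Bool) : Prop :=
  ∃ L, BlockValid M L ∧ (∀ p ∈ L, blen M p = 1 ∨ (blen M p = 2 ∧ p.2 = τ)) ∧
    W = blockWord M c L

theorem Tight.nil (M : ℕ) (τ c : Bool) : Tight M τ [] c :=
  ⟨[], by simp [BlockValid], by simp, rfl⟩

theorem Tight.cons {M : ℕ} (hM : 2 ≤ M) {τ ρ x c : Bool} {W : Word Bool} (h : Tight M τ W c)
    (hx : x = startName ρ c) : Tight M τ ((x, ρ) :: W) c := by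
  obtain ⟨L, hL, ht, rfl⟩ := h
  refine ⟨oneBlock M ρ :: L, ?_, ?_, cons_blockWord_new hM hx L⟩
  · intro p hp
    rcases List.mem_cons.1 hp with rfl | hp
    exacts [oneBlock_valid hM ρ, hL p hp]
  · intro p hp
    rcases List.mem_cons.1 hp with rfl | hp
    exacts [Or.inl (blen_oneBlock hM ρ), ht p hp]

theorem Tight.cons_cons {M : ℕ} (hM : 3 ≤ M) {τ x c : Bool} {W : Word Bool}
    (h : Tight M τ W (!c)) (hx : x = startName τ c) :
    Tight M τ ((x, τ) :: (!x, τ) :: W) c := by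
  obtain ⟨L, hL, ht, rfl⟩ := h
  have hb : blen M (if τ then 2 else M - 2, τ) = 2 := by cases τ <;> simp [blen]; omega
  refine ⟨(if τ then 2 else M - 2, τ) :: L, ?_, ?_, ?_⟩
  · intro p hp
    rcases List.mem_cons.1 hp with rfl | hp
    · cases τ <;> simp <;> omega
    · exact hL p hp
  · intro p hp
    rcases List.mem_cons.1 hp with rfl | hp
    exacts [Or.inr ⟨hb, rfl⟩, ht p hp]
  · rw [blockWord, hb, ← hx, show flipN (2 + 1) c = !c by cases c <;> rfl]
    rfl

theorem Tight.replicate {M : ℕ} (hM : 2 ≤ M) {τ ρ x c : Bool} {W : Word Bool} (h : Tight M τ W c)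
    (hx : x = startName ρ c) (k : ℕ) : Tight M τ (List.replicate k (x, ρ) ++ W) c := by
  induction k with
  | zero => exact h
  | succ k ih => exact ih.cons hM hx

theorem Tight.length_le {M : ℕ} (hM : 3 ≤ M) {τ c : Bool} {W : Word Bool} (h : Tight M τ W c)
    {V : Word Bool} (hV : dstate M V = dstate M W) : W.length ≤ V.length := by
  obtain ⟨L, hL, ht, rfl⟩ := h
  obtain ⟨p, hp⟩ : ∃ p, p = if τ then 2 else 1 := ⟨_, rfl⟩
  have hp1 : 1 ≤ p ∧ p < M := by cases τ <;> simp at hp <;> omega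
  have key : ∀ (L : List (ℕ × Bool)) (c : Bool), BlockValid M L →
      (∀ p ∈ L, blen M p = 1 ∨ (blen M p = 2 ∧ p.2 = τ)) →
      ((L.map Prod.fst).map fun q : ℕ => min (q : ℤ) (2 * p - q)).sum - (2 * p - M) * negCount L =
        (blockWord M c L).length := by
    intro L
    induction L with
    | nil => simp [negCount, blockWord]
    | cons r L ih =>
      intro c hL ht
      have h1 := ih (flipN (blen M r + 1) c) (fun p hp => hL p (by simp [hp]))
        (fun p hp => ht p (List.mem_cons_of_mem _ hp))
      obtain ⟨q, σ⟩ := r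
      have hq : 1 ≤ q ∧ q < M := hL (q, σ) (by simp)
      have hb := ht (q, σ) List.mem_cons_self
      rw [blockWord, List.length_append, alt_length]
      have hn : negCount ((q, σ) :: L) = negCount L + if σ then 0 else 1 := by
        cases σ <;> simp [negCount]
      rw [hn]
      push_cast
      have hmul : ∀ k : ℤ, (2 * (p : ℤ) - M) * (negCount L + k) =
          (2 * p - M) * negCount L + k * (2 * p - M) := fun k => by ring
      rw [hmul, ← h1]
      simp only [List.map_cons, List.sum_cons]
      cases σ <;> cases τ <;> simp [blen] at hb hp ⊢ <;> omega
  have h1 := weight_run (by omega) hp1.1 hp1.2 V (base_valid M 0)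
  rw [← dstate, hV, dstate, run_blockWord_base hL, weight_mkState] at h1
  have h2 := key L c hL ht
  simp only [weight, List.map_reverse, List.sum_reverse, List.map_nil, List.sum_nil, mul_zero,
    add_zero, zero_add, zero_sub, mul_neg] at h1
  omega

theorem length_le_of_uniform {M : ℕ} {hM : 2 ≤ M} {σ : Bool} {W V : Word Bool} (h : Uniform σ W)
    (hV : cls (rels (dih M hM)) V = cls (rels (dih M hM)) W) : W.length ≤ V.length := by
  have hexp : expSum V = expSum W := by
    refine expSum_eq_of_cls_eq ?_ hV
    rintro r ⟨u, v, ⟨p, q, k, -, -, rfl, rfl⟩, rfl⟩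
    exact ⟨_, _, rfl, by rw [expSum_altWord, expSum_altWord]⟩
  have h1 := expSum_le_length V
  rw [hexp, h.expSum] at h1
  cases σ <;> simp at h1 <;> omega

/-- A product of three powers of letters, alternating in name, the last one a single letter,
is geodesic when the label is at least three. -/
theorem dih_geodesic {M : ℕ} (hM : 3 ≤ M) (b ρ σ e : Bool) (l : ℕ) {k : ℕ} (hk : 1 ≤ k)
    {V : Word Bool} (hV : cls (rels (dih M (by omega))) V = cls (rels (dih M (by omega)))
      (List.replicate l (b, ρ) ++ List.replicate k (!b, σ) ++ [(b, e)])) :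
    (List.replicate l (b, ρ) ++ List.replicate k (!b, σ) ++ [(b, e)]).length ≤ V.length := by
  have hM' : 2 ≤ M := by omega
  obtain ⟨k, rfl⟩ : ∃ n, k = n + 1 := ⟨k - 1, by omega⟩
  have tight : ∀ τ c, Tight M τ
      (List.replicate l (b, ρ) ++ List.replicate (k + 1) (!b, σ) ++ [(b, e)]) c →
      (List.replicate l (b, ρ) ++ List.replicate (k + 1) (!b, σ) ++ [(b, e)]).length ≤ V.length :=
    fun τ c h => h.length_le hM (dstate_eq_of_cls_eq hV)
  have hs : ∀ σ x : Bool, x = startName σ (startName σ x) :=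
    fun σ x => (startName_startName σ x).symm
  have hsn : ∀ σ x : Bool, x = startName (!σ) (startName σ (!x)) := fun σ x => by
    rw [startName_not_left, startName_startName, Bool.not_not]
  have hlast : ∀ τ, Tight M τ [(b, e)] (startName e b) :=
    fun τ => (Tight.nil M τ _).cons hM' (hs _ _)
  by_cases hσe : σ = e
  · subst hσe
    have h1 : Tight M σ (List.replicate (k + 1) (!b, σ) ++ [(b, σ)]) (startName σ (!b)) := by
      have h2 : Tight M σ ((!b, σ) :: (b, σ) :: []) (startName σ (!b)) := by
        simpa using Tight.cons_cons hM (x := !b) (Tight.nil M σ _) (hs σ _)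
      simpa [List.replicate_succ'] using h2.replicate hM' (hs σ _) k
    by_cases hρ : ρ = σ
    · subst hρ
      refine length_le_of_uniform (σ := ρ) (fun g hg => ?_) hV
      simp only [List.mem_append, List.mem_replicate, List.mem_singleton] at hg
      rcases hg with (⟨-, rfl⟩ | ⟨-, rfl⟩) | rfl <;> rfl
    · obtain rfl := ne_iff_eq_not.1 hρ
      refine tight σ (startName σ (!b)) ?_
      rw [List.append_assoc]
      exact h1.replicate hM' (hsn σ b) l
  · obtain rfl : e = !σ := ne_iff_eq_not.1 (Ne.symm hσe)
    have hc : startName (!σ) b = startName σ (!b) := by rw [startName_not_left, startName_not]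
    have h1 : ∀ τ n, Tight M τ (List.replicate n (!b, σ) ++ [(b, !σ)]) (startName σ (!b)) :=
      fun τ n => Tight.replicate hM' (by rw [← hc]; exact hlast τ) (hs σ _) n
    by_cases hρ : ρ = σ
    · subst hρ
      rcases l with _ | l
      · simpa using tight ρ _ (h1 ρ (k + 1))
      · refine tight ρ (startName ρ b) ?_
        have h2 : Tight M ρ ((b, ρ) :: (!b, ρ) :: (List.replicate k (!b, ρ) ++ [(b, !ρ)]))
            (startName ρ b) := by
          refine Tight.cons_cons hM ?_ (hs ρ _)
          rw [← startName_not]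
          exact h1 ρ k
        have h3 := h2.replicate hM' (hs ρ _) l
        simpa [List.replicate_succ' (n := l), List.replicate_succ (n := k)] using h3
    · obtain rfl := ne_iff_eq_not.1 hρ
      refine tight σ (startName σ (!b)) ?_
      rw [List.append_assoc]
      exact (h1 σ (k + 1)).replicate hM' (hsn σ b) l

/-! ### Words over a pair of generators -/

/-- Rename the letters of a word. -/
def mapW {α β : Type*} (f : α → β) (u : Word α) : Word β := u.map fun g => (f g.1, g.2)

@[simp] theorem mapW_append {α β : Type*} (f : α → β) (u v : Word α) :
    mapW f (u ++ v) = mapW f u ++ mapW f v := List.map_append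

@[simp] theorem mapW_length {α β : Type*} (f : α → β) (u : Word α) :
    (mapW f u).length = u.length := List.length_map _

theorem mapW_wordInv {α β : Type*} (f : α → β) (u : Word α) :
    mapW f (wordInv u) = wordInv (mapW f u) := by
  simp [mapW, wordInv, List.map_reverse]

theorem mapW_altWord {α β : Type*} (f : α → β) (s t : α) (k : ℕ) :
    mapW f (altWord s t k) = altWord (f s) (f t) k := by
  induction k generalizing s t with
  | zero => rfl
  | succ k ih => rw [altWord, altWord, ← ih]; rfl

theorem cls_mapW {α β : Type*} {R : Set (FreeGroup α)} {R' : Set (FreeGroup β)} (f : α → β)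
    (h : ∀ r ∈ R, PresentedGroup.mk R' (FreeGroup.map f r) = 1) {U V : Word α}
    (hUV : cls R U = cls R V) : cls R' (mapW f U) = cls R' (mapW f V) := by
  let φ : FreeGroup α →* PresentedGroup R' := (PresentedGroup.mk R').comp (FreeGroup.map f)
  have hle : Subgroup.normalClosure R ≤ φ.ker :=
    Subgroup.normalClosure_le_normal fun r hr => h r hr
  have h1 : (FreeGroup.mk U)⁻¹ * FreeGroup.mk V ∈ Subgroup.normalClosure R :=
    QuotientGroup.eq.1 hUV
  have h2 := MonoidHom.mem_ker.1 (hle h1)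
  rw [map_mul, map_inv, inv_mul_eq_one] at h2
  exact h2

theorem mk_rel {R : Set (FreeGroup S)} {r : FreeGroup S} (h : r ∈ R) :
    PresentedGroup.mk R r = 1 := PresentedGroup.one_of_mem h

/-- The relators that involve generators of `T` only. -/
def relsOn (A : ArtinData S) (T : Set S) : Set (FreeGroup S) :=
  {x | ∃ (s t : S) (k : ℕ), s ∈ T ∧ t ∈ T ∧ s ≠ t ∧ A.m s t = (k : ℕ∞) ∧
    x = FreeGroup.mk (altWord s t k) * (FreeGroup.mk (altWord t s k))⁻¹}

/-- Equality in the group presented by the relators over `T`. -/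
def EqOver (A : ArtinData S) (T : Set S) (u v : Word S) : Prop :=
  cls (relsOn A T) u = cls (relsOn A T) v

/-- A word over `T` that is geodesic in the group presented by the relators over `T`. -/
def GeodOver (A : ArtinData S) (T : Set S) (u : Word S) : Prop :=
  WordOver T u ∧ ∀ v, WordOver T v → EqOver A T u v → u.length ≤ v.length

section EqOver

variable {A : ArtinData S} {T : Set S} {u v w : Word S}

theorem EqOver.refl (u : Word S) : EqOver A T u u := rfl

theorem EqOver.symm (h : EqOver A T u v) : EqOver A T v u := Eq.symm h

theorem EqOver.trans (h : EqOver A T u v) (h' : EqOver A T v w) : EqOver A T u w := Eq.trans h h'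

theorem EqOver.context (h : EqOver A T u v) (x y : Word S) :
    EqOver A T (x ++ u ++ y) (x ++ v ++ y) := by
  unfold EqOver at *
  rw [cls_append, cls_append, cls_append, cls_append, h]

theorem EqOver.append_left (h : EqOver A T u v) (x : Word S) : EqOver A T (x ++ u) (x ++ v) := by
  simpa using h.context x []

theorem EqOver.append_right (h : EqOver A T u v) (y : Word S) : EqOver A T (u ++ y) (v ++ y) := by
  simpa using h.context [] y

theorem EqOver.of_append_right {y : Word S} (h : EqOver A T (u ++ y) (v ++ y)) :
    EqOver A T u v := by
  unfold EqOver at *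
  rwa [cls_append, cls_append, mul_left_inj] at h

theorem eqOver_pair_nil (s : S) (b : Bool) : EqOver A T [(s, b), (s, !b)] [] := by
  rw [EqOver, cls_pair, cls_nil]

theorem eqOver_nil_pair (s : S) (b : Bool) : EqOver A T [(s, !b), (s, b)] [] := by
  simpa using eqOver_pair_nil (A := A) (T := T) s (!b)

theorem EqOver.length_parity (h : EqOver A T u v) : (u.length : ℤ) % 2 = v.length % 2 := by
  have := expSum_eq_of_cls_eq (by
    rintro r ⟨s, t, k, -, -, -, -, rfl⟩
    exact ⟨_, _, rfl, by rw [expSum_altWord, expSum_altWord]⟩) h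
  have h1 := expSum_parity u
  have h2 := expSum_parity v
  omega

theorem wordOver_append : WordOver T (u ++ v) ↔ WordOver T u ∧ WordOver T v :=
  List.forall_mem_append

theorem WordOver.nil : WordOver T ([] : Word S) := by simp [WordOver]

theorem wordOver_cons {g : S × Bool} : WordOver T (g :: u) ↔ g.1 ∈ T ∧ WordOver T u :=
  List.forall_mem_cons

theorem wordOver_singleton {g : S × Bool} : WordOver T [g] ↔ g.1 ∈ T := by simp [WordOver]

theorem wordOver_replicate {g : S × Bool} (h : g.1 ∈ T) (n : ℕ) :
    WordOver T (List.replicate n g) :=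
  fun l hl => by rwa [List.eq_of_mem_replicate hl]

theorem GeodOver.of_eq_length (h : GeodOver A T u) (hv : WordOver T v) (he : EqOver A T u v)
    (hl : v.length ≤ u.length) : GeodOver A T v :=
  ⟨hv, fun x hx hx' => hl.trans (h.2 x hx (he.trans hx'))⟩

theorem GeodOver.length_eq (h : GeodOver A T u) (h' : GeodOver A T v) (he : EqOver A T u v) :
    u.length = v.length :=
  le_antisymm (h.2 v h'.1 he) (h'.2 u h.1 he.symm)

theorem GeodOver.of_append_left (h : GeodOver A T (u ++ v)) : GeodOver A T u := by
  obtain ⟨h1, h2⟩ := h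
  rw [wordOver_append] at h1
  refine ⟨h1.1, fun x hx hx' => ?_⟩
  have := h2 (x ++ v) (wordOver_append.2 ⟨hx, h1.2⟩) (hx'.append_right v)
  simpa using this

theorem GeodOver.of_append_right (h : GeodOver A T (u ++ v)) : GeodOver A T v := by
  obtain ⟨h1, h2⟩ := h
  rw [wordOver_append] at h1
  refine ⟨h1.2, fun x hx hx' => ?_⟩
  have := h2 (u ++ x) (wordOver_append.2 ⟨h1.1, hx⟩) (hx'.append_left u)
  simpa using this

theorem exists_geodOver (hu : WordOver T u) : ∃ v, GeodOver A T v ∧ EqOver A T u v := by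
  have hex : ∃ n, ∃ v, WordOver T v ∧ EqOver A T u v ∧ v.length = n :=
    ⟨_, u, hu, .refl u, rfl⟩
  obtain ⟨v, hv, he, hl⟩ := Nat.find_spec hex
  exact ⟨v, ⟨hv, fun x hx hx' => hl ▸ Nat.find_min' hex ⟨x, hx, he.trans hx', rfl⟩⟩, he⟩

theorem GeodOver.freelyReduced (h : GeodOver A T u) : FreelyReduced u := by
  rintro w₁ w₂ s b rfl
  have hw := h.1
  rw [wordOver_append, wordOver_append] at hw
  have := h.2 (w₁ ++ w₂) (wordOver_append.2 ⟨hw.1.1, hw.2⟩) (by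
    simpa using (eqOver_pair_nil s b).context w₁ w₂)
  simp at this

end EqOver

/-! ### The free case -/

theorem FreelyReduced.reduce_eq {u : Word S} (h : FreelyReduced u) : FreeGroup.reduce u = u := by
  rcases Relation.ReflTransGen.cases_head (FreeGroup.reduce.red (L := u)) with h' | ⟨c, h', -⟩
  · exact h'.symm
  · cases h' with
    | @not L₁ L₂ x b => exact absurd (by simp) (h L₁ L₂ x b)

theorem mk_eq_of_cls_empty {u v : Word S} (h : cls ∅ u = cls ∅ v) :
    FreeGroup.mk u = FreeGroup.mk v := by
  have h1 : (FreeGroup.mk u)⁻¹ * FreeGroup.mk v ∈ Subgroup.normalClosure (∅ : Set (FreeGroup S)) :=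
    QuotientGroup.eq.1 h
  rwa [Subgroup.normalClosure_empty, Subgroup.mem_bot, inv_mul_eq_one] at h1

theorem relsOn_pair (A : ArtinData S) (a b : S) :
    relsOn A {a, b} = ∅ ∨ a ≠ b ∧ ∃ M : ℕ, A.m a b = M := by
  by_cases hab : a = b
  · subst hab
    left
    ext x
    simp only [relsOn, Set.mem_ofPred_eq, Set.mem_empty_iff_false, iff_false]
    rintro ⟨s, t, k, hs, ht, hst, -⟩
    simp at hs ht
    exact hst (hs.trans ht.symm)
  · rcases h : A.m a b with _ | M
    · left
      ext x
      simp only [relsOn, Set.mem_ofPred_eq, Set.mem_empty_iff_false, iff_false]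
      rintro ⟨s, t, k, hs, ht, hst, hk, -⟩
      simp only [Set.mem_insert_iff, Set.mem_singleton_iff] at hs ht
      have : A.m a b = k := by
        rcases hs with rfl | rfl <;> rcases ht with rfl | rfl
        · exact absurd rfl hst
        · exact hk
        · rw [A.symm]; exact hk
        · exact absurd rfl hst
      rw [h] at this
      exact ENat.top_ne_natCast k this
    · exact Or.inr ⟨hab, M, rfl⟩

theorem EqOver.eq_of_relsOn_empty {A : ArtinData S} {T : Set S} (hT : relsOn A T = ∅)
    {u v : Word S} (h : EqOver A T u v) (hu : FreelyReduced u) (hv : FreelyReduced v) : u = v := by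
  rw [EqOver, hT] at h
  have := FreeGroup.reduce.sound (mk_eq_of_cls_empty h)
  rwa [hu.reduce_eq, hv.reduce_eq] at this

theorem FreelyReduced.geodOver {A : ArtinData S} {T : Set S} (hT : relsOn A T = ∅)
    {u : Word S} (hu : FreelyReduced u) (hw : WordOver T u) : GeodOver A T u := by
  refine ⟨hw, fun v hv h => ?_⟩
  rw [EqOver, hT] at h
  have h1 := mk_eq_of_cls_empty h
  have h2 : (FreeGroup.mk u).norm ≤ v.length := h1 ▸ FreeGroup.norm_mk_le
  rwa [FreeGroup.norm, FreeGroup.toWord_mk, hu.reduce_eq] at h2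

/-! ### Transport from the dihedral presentation -/

/-- The embedding of the two generators of a dihedral presentation. -/
def pairMap (a b : S) (c : Bool) : S := if c then a else b

/-- A left inverse of the embedding of two generators. -/
noncomputable def pairSide (a s : S) : Bool := decide (s = a)

section Pair

variable {A : ArtinData S} {a b : S} {M : ℕ}

theorem pairMap_mem (a b : S) (c : Bool) : pairMap a b c ∈ ({a, b} : Set S) := by
  cases c <;> simp [pairMap]

theorem pairSide_pairMap (hab : a ≠ b) (c : Bool) : pairSide a (pairMap a b c) = c := by
  cases c <;> simp [pairMap, pairSide, hab.symm]

theorem pairMap_pairSide {s : S} (hs : s ∈ ({a, b} : Set S)) :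
    pairMap a b (pairSide a s) = s := by
  simp only [Set.mem_insert_iff, Set.mem_singleton_iff] at hs
  by_cases h : s = a
  · simp [pairMap, pairSide, h]
  · rw [pairSide, decide_eq_false h]
    exact (hs.resolve_left h).symm

theorem mapW_pairSide (hab : a ≠ b) (U : Word Bool) :
    mapW (pairSide a) (mapW (pairMap a b) U) = U := by
  simp [mapW, pairSide_pairMap hab, Function.comp_def]

theorem exists_mapW_pairMap {u : Word S} (hu : WordOver {a, b} u) :
    ∃ U, u = mapW (pairMap a b) U := by
  refine ⟨mapW (pairSide a) u, ?_⟩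
  rw [mapW, mapW, List.map_map]
  conv_lhs => rw [← List.map_id u]
  exact List.map_congr_left fun g hg => Prod.ext (pairMap_pairSide (hu g hg)).symm rfl

theorem wordOver_mapW (a b : S) (U : Word Bool) : WordOver {a, b} (mapW (pairMap a b) U) := by
  intro l hl
  obtain ⟨g, -, rfl⟩ := List.mem_map.1 hl
  exact pairMap_mem a b g.1

theorem pairMap_ne (hab : a ≠ b) {s t : Bool} (h : s ≠ t) : pairMap a b s ≠ pairMap a b t := by
  intro h'
  apply h
  rw [← pairSide_pairMap hab s, h', pairSide_pairMap hab]

theorem m_pairMap (hm : A.m a b = M) {s t : Bool} (h : s ≠ t) :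
    A.m (pairMap a b s) (pairMap a b t) = M := by
  cases s <;> cases t <;> simp_all [pairMap, A.symm b a]

theorem m_of_mem_pair (hm : A.m a b = M) {s t : S} (hs : s ∈ ({a, b} : Set S))
    (ht : t ∈ ({a, b} : Set S)) (hst : s ≠ t) : A.m s t = M := by
  simp only [Set.mem_insert_iff, Set.mem_singleton_iff] at hs ht
  rcases hs with rfl | rfl <;> rcases ht with rfl | rfl <;> simp_all [A.symm]

theorem isRel_mapW {hM : 2 ≤ M} (hab : a ≠ b) (hm : A.m a b = M) {U V : Word Bool}
    (h : IsRel (dih M hM) U V) : IsRel A (mapW (pairMap a b) U) (mapW (pairMap a b) V) := by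
  obtain ⟨s, t, k, hst, hk, rfl, rfl⟩ := h
  have hk' : (M : ℕ∞) = k := hk
  exact ⟨_, _, k, pairMap_ne hab hst, hk' ▸ m_pairMap hm hst, mapW_altWord .., mapW_altWord ..⟩

theorem eqOver_mapW_iff (hM : 2 ≤ M) (hab : a ≠ b) (hm : A.m a b = M) {U V : Word Bool} :
    EqOver A {a, b} (mapW (pairMap a b) U) (mapW (pairMap a b) V) ↔
      cls (rels (dih M hM)) U = cls (rels (dih M hM)) V := by
  constructor
  · intro h
    have := cls_mapW (R' := rels (dih M hM)) (pairSide a) (by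
      rintro r ⟨s, t, k, hs, ht, hst, hk, rfl⟩
      rw [m_of_mem_pair hm hs ht hst] at hk
      refine mk_rel ⟨mapW (pairSide a) (altWord s t k), mapW (pairSide a) (altWord t s k),
        ⟨pairSide a s, pairSide a t, k, ?_, hk, mapW_altWord .., mapW_altWord ..⟩, ?_⟩
      · intro h'
        apply hst
        rw [← pairMap_pairSide hs, h', pairMap_pairSide ht]
      · rw [map_mul, map_inv]; rfl) h
    rwa [mapW_pairSide hab, mapW_pairSide hab] at this
  · intro h
    refine cls_mapW (pairMap a b) ?_ h
    rintro r ⟨u, v, ⟨s, t, k, hst, hk, rfl, rfl⟩, rfl⟩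
    have hk' : (M : ℕ∞) = k := hk
    refine mk_rel ⟨pairMap a b s, pairMap a b t, k, pairMap_mem .., pairMap_mem ..,
      pairMap_ne hab hst, hk' ▸ m_pairMap hm hst, ?_⟩
    rw [map_mul, map_inv, ← mapW_altWord, ← mapW_altWord]; rfl

end Pair

/-! ### Soundness -/

theorem Step0.cls_eq {R : Set (FreeGroup S)} {u v : Word S} (h : Step0 u v) :
    cls R u = cls R v := by
  obtain ⟨w₁, w₂, s, b, rfl, rfl⟩ := h
  rw [cls_append, cls_append, cls_pair, mul_one, cls_append]

theorem Steps01.cls_eq {A : ArtinData S} {u v : Word S} (h : Steps01 A u v) :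
    cls (rels A) u = cls (rels A) v := by
  induction h with
  | refl => rfl
  | tail _ h ih => exact ih.trans (h.elim (fun h => h.cls_eq) (fun h => h.cls_eq))

theorem Step2Star.cls_eq {A : ArtinData S} {u v : Word S} (h : Step2Star A u v) :
    cls (rels A) u = cls (rels A) v := by
  rcases h with h | h
  · obtain ⟨w₁, w₂, v, u, v', u', hr, -, -, rfl, rfl, -⟩ := h
    have := hr.cls_eq
    simp only [cls_append, cls_wordInv] at this ⊢
    congr 1
    rw [mul_assoc, mul_assoc, mul_right_inj, inv_mul_eq_iff_eq_mul, ← mul_assoc,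
      eq_mul_inv_iff_mul_eq]
    exact this.symm
  · obtain ⟨w₁, w₂, v, u, v', u', hr, -, -, rfl, rfl, -⟩ := h
    have := hr.cls_eq
    simp only [cls_append, cls_wordInv] at this ⊢
    congr 1
    rw [mul_assoc, mul_assoc, mul_right_inj, mul_inv_eq_iff_eq_mul, mul_assoc,
      eq_inv_mul_iff_mul_eq]
    exact this

theorem Steps012Star.cls_eq {A : ArtinData S} {u v : Word S} (h : Steps012Star A u v) :
    cls (rels A) u = cls (rels A) v := by
  induction h with
  | refl => rfl
  | tail _ h ih =>
    exact ih.trans (h.elim (fun h => h.cls_eq) (fun h => h.elim (fun h => h.cls_eq)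
      (fun h => h.cls_eq)))

section Transport

variable {A : ArtinData S} {a b : S} {M : ℕ} {hM : 2 ≤ M}

theorem Step0.mapW {α β : Type*} (f : α → β) {U V : Word α} (h : Step0 U V) :
    Step0 (mapW f U) (mapW f V) := by
  obtain ⟨w₁, w₂, s, b, rfl, rfl⟩ := h
  exact ⟨ArtinTits.mapW f w₁, ArtinTits.mapW f w₂, f s, b, by simp [ArtinTits.mapW], by simp⟩

theorem Step1.mapW (hab : a ≠ b) (hm : A.m a b = M) {U V : Word Bool} (h : Step1 (dih M hM) U V) :
    Step1 A (mapW (pairMap a b) U) (mapW (pairMap a b) V) := by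
  obtain ⟨w₁, w₂, x, y, hr, h⟩ := h
  refine ⟨ArtinTits.mapW (pairMap a b) w₁, ArtinTits.mapW (pairMap a b) w₂, _, _,
    isRel_mapW hab hm hr, ?_⟩
  rcases h with ⟨rfl, rfl⟩ | ⟨rfl, rfl⟩
  · left; simp
  · right; simp [mapW_wordInv]

theorem Steps01.mapW (hab : a ≠ b) (hm : A.m a b = M) {U V : Word Bool}
    (h : Steps01 (dih M hM) U V) : Steps01 A (mapW (pairMap a b) U) (mapW (pairMap a b) V) :=
  h.lift _ fun _ _ h => h.imp (fun h => h.mapW _) (fun h => h.mapW hab hm)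

/-- The word does not end with a letter of `T`. -/
def EndsOff (T : Set S) (α : Word S) : Prop := ∀ g t, α = t ++ [g] → g.1 ∉ T

/-- The word does not begin with a letter of `T`. -/
def StartsOff (T : Set S) (β : Word S) : Prop := ∀ g t, β = g :: t → g.1 ∉ T

theorem EndsOff.wordInv {T : Set S} {α : Word S} (h : EndsOff T α) :
    StartsOff T (wordInv α) := by
  intro g t he
  obtain ⟨s, e⟩ := g
  have := congrArg ArtinTits.wordInv he
  rw [wordInv_wordInv, wordInv_cons] at this
  exact h (s, !e) _ this

theorem StartsOff.wordInv {T : Set S} {β : Word S} (h : StartsOff T β) :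
    EndsOff T (wordInv β) := by
  intro g t he
  obtain ⟨s, e⟩ := g
  have := congrArg ArtinTits.wordInv he
  rw [wordInv_wordInv, wordInv_append] at this
  exact h (s, !e) _ this

theorem StartsOff.heads_ne (hab : a ≠ b) {y : Word S} (hy : StartsOff {a, b} y) {u x : Word Bool}
    (h : ∀ g t t', u = g :: t → x = g :: t' → False) (g : S × Bool) (t t' : Word S)
    (hu : mapW (pairMap a b) u = g :: t) (hx : mapW (pairMap a b) x ++ y = g :: t') : False := by
  rcases u with _ | ⟨p, u⟩
  · simp [mapW] at hu
  · simp only [mapW, List.map_cons, List.cons.injEq] at hu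
    obtain ⟨rfl, -⟩ := hu
    rcases x with _ | ⟨q, x⟩
    · exact hy _ _ hx (pairMap_mem a b p.1)
    · simp only [mapW, List.map_cons, List.cons_append, List.cons.injEq, Prod.mk.injEq] at hx
      have h1 := congrArg (pairSide a) hx.1.1
      rw [pairSide_pairMap hab, pairSide_pairMap hab] at h1
      exact h p u x rfl (by rw [show p = q from Prod.ext h1.symm hx.1.2.symm])

theorem EndsOff.lasts_ne (hab : a ≠ b) {y : Word S} (hy : EndsOff {a, b} y) {u x : Word Bool}
    (h : ∀ g t t', u = t ++ [g] → x = t' ++ [g] → False) (g : S × Bool) (t t' : Word S)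
    (hu : mapW (pairMap a b) u = t ++ [g]) (hx : y ++ mapW (pairMap a b) x = t' ++ [g]) :
    False := by
  refine StartsOff.heads_ne (u := u.reverse) (x := x.reverse) (y := y.reverse) hab ?_ ?_ g
    t.reverse t'.reverse ?_ ?_
  · intro p q he
    rw [List.reverse_eq_iff] at he
    exact hy p q.reverse (by simpa using he)
  · intro p q q' h1 h2
    rw [List.reverse_eq_iff] at h1 h2
    exact h p q.reverse q'.reverse (by simpa using h1) (by simpa using h2)
  · have := congrArg List.reverse hu
    simpa [mapW] using this
  · have := congrArg List.reverse hx
    simpa [mapW] using this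

theorem Step2Star.mapW (hab : a ≠ b) (hm : A.m a b = M) {U V : Word Bool}
    (h : Step2Star (dih M hM) U V) {α β : Word S} (hα : EndsOff {a, b} α)
    (hβ : StartsOff {a, b} β) :
    Step2Star A (α ++ mapW (pairMap a b) U ++ β) (α ++ mapW (pairMap a b) V ++ β) := by
  rcases h with h | h
  · obtain ⟨w₁, w₂, v, u, v', u', hr, hv, hv', rfl, rfl, h1, h2⟩ := h
    have hr' := isRel_mapW hab hm hr
    rw [isLCPrefix_append] at h1 h2
    rw [mapW_append, mapW_append] at hr'
    refine Or.inl ⟨α ++ ArtinTits.mapW (pairMap a b) w₁, ArtinTits.mapW (pairMap a b) w₂ ++ β,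
      _, _, _, _, hr', by simpa [ArtinTits.mapW] using hv, by simpa [ArtinTits.mapW] using hv',
      by simp [mapW_wordInv], by simp [mapW_wordInv], ?_, ?_⟩
    · rw [isLCPrefix_append, wordInv_append, ← mapW_wordInv]
      exact hα.wordInv.heads_ne hab h1
    · rw [isLCPrefix_append]
      exact hβ.heads_ne hab h2
  · obtain ⟨w₁, w₂, v, u, v', u', hr, hv, hv', rfl, rfl, h1, h2⟩ := h
    have hr' := isRel_mapW hab hm hr
    rw [isLCSuffix_append] at h1 h2
    rw [mapW_append, mapW_append] at hr'
    refine Or.inr ⟨α ++ ArtinTits.mapW (pairMap a b) w₁, ArtinTits.mapW (pairMap a b) w₂ ++ β,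
      _, _, _, _, hr', by simpa [ArtinTits.mapW] using hv, by simpa [ArtinTits.mapW] using hv',
      by simp [mapW_wordInv], by simp [mapW_wordInv], ?_, ?_⟩
    · rw [isLCSuffix_append]
      exact hα.lasts_ne hab h1
    · rw [isLCSuffix_append, wordInv_append, ← mapW_wordInv]
      exact hβ.wordInv.lasts_ne hab h2

theorem Steps12Star.mapW (hab : a ≠ b) (hm : A.m a b = M) {U V : Word Bool}
    (h : Steps12Star (dih M hM) U V) {α β : Word S} (hα : EndsOff {a, b} α)
    (hβ : StartsOff {a, b} β) :
    Steps012Star A (α ++ mapW (pairMap a b) U ++ β) (α ++ mapW (pairMap a b) V ++ β) :=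
  h.lift (fun w => α ++ ArtinTits.mapW (pairMap a b) w ++ β) fun _ _ h =>
    Or.inr (h.imp (fun h => (h.mapW hab hm).context α β) (fun h => h.mapW hab hm hα hβ))

theorem GeodOver.not_shrinks (hab : a ≠ b) (hm : A.m a b = M) {U : Word Bool}
    (h : GeodOver A {a, b} (mapW (pairMap a b) U)) : ¬ Shrinks (dih M hM) U := by
  rintro ⟨V, hV, hl⟩
  have := h.2 _ (wordOver_mapW a b V) ((eqOver_mapW_iff hM hab hm).2 hV.cls_eq)
  simp at this
  omega

end Transport

section Interface

variable {A : ArtinData S} {a b : S}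

theorem GeodOver.last_sign {x y : Word S} {s : S} {e : Bool}
    (hx : GeodOver A {a, b} (x ++ [(s, e)])) (hy : GeodOver A {a, b} (y ++ [(s, !e)]))
    (h : EqOver A {a, b} (x ++ [(s, e)]) (y ++ [(s, !e)])) : False := by
  have hl := hx.length_eq hy h
  rcases relsOn_pair A a b with hT | ⟨hab, M, hm⟩
  · have := h.eq_of_relsOn_empty hT hx.freelyReduced hy.freelyReduced
    simpa using List.append_inj_right' this rfl
  · have hM : 2 ≤ M := by exact_mod_cast hm ▸ A.two_le a b hab
    have hs : s ∈ ({a, b} : Set S) := hx.1 (s, e) (by simp)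
    obtain ⟨X, rfl⟩ := exists_mapW_pairMap (wordOver_append.1 hx.1).1
    obtain ⟨Y, rfl⟩ := exists_mapW_pairMap (wordOver_append.1 hy.1).1
    have hsing : ∀ e, [(s, e)] = mapW (pairMap a b) [(pairSide a s, e)] := fun e => by
      simp [mapW, pairMap_pairSide hs]
    rw [hsing e, hsing (!e), ← mapW_append, ← mapW_append] at *
    refine dih_last_sign hM (hx.not_shrinks hab hm) (hy.not_shrinks hab hm) ?_
      ((eqOver_mapW_iff hM hab hm).1 h)
    simpa using hl

/-- A product of three powers of letters, alternating in name, the last one a single letter,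
is geodesic in large type. -/
theorem geodOver_three_blocks (hlarge : ∀ s t : S, s ≠ t → 3 ≤ A.m s t) (hab : a ≠ b)
    (ρ σ e : Bool) (l : ℕ) {k : ℕ} (hk : 1 ≤ k) :
    GeodOver A {a, b} (List.replicate l (b, ρ) ++ List.replicate k (a, σ) ++ [(b, e)]) := by
  have hw : WordOver {a, b} (List.replicate l (b, ρ) ++ List.replicate k (a, σ) ++ [(b, e)]) := by
    rw [wordOver_append, wordOver_append]
    exact ⟨⟨wordOver_replicate (by simp) _, wordOver_replicate (by simp) _⟩,
      wordOver_singleton.2 (by simp)⟩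
  rcases relsOn_pair A a b with hT | ⟨-, M, hm⟩
  · refine FreelyReduced.geodOver hT ?_ hw
    intro w₁ w₂ s c h
    have hch : List.IsChain (fun p q : S × Bool => p.1 = q.1 → p.2 = q.2)
        (List.replicate l (b, ρ) ++ List.replicate k (a, σ) ++ [(b, e)]) := by
      obtain ⟨k, rfl⟩ : ∃ n, k = n + 1 := ⟨k - 1, by omega⟩
      refine List.IsChain.append (List.IsChain.append ?_ ?_ ?_) (List.isChain_singleton _) ?_
      · exact List.isChain_replicate_of_rel _ fun _ => rfl
      · exact List.isChain_replicate_of_rel _ fun _ => rfl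
      · intro p hp q hq
        have hp := List.eq_of_mem_replicate (List.mem_of_mem_getLast? hp)
        have hq := List.eq_of_mem_replicate (List.mem_of_mem_head? hq)
        subst hp hq
        exact fun h => absurd h.symm hab
      · intro p hp q hq
        simp only [List.head?_cons, Option.mem_def, Option.some.injEq] at hq
        have hp : p = (a, σ) := by
          simpa [List.getLast?_append, List.getLast?_replicate] using hp.symm
        subst hp hq
        exact fun h => absurd h hab
    rw [h] at hch
    have := (List.isChain_append.1 (List.isChain_append.1 hch).1).2.1
    simp at this
  · have hM : 3 ≤ M := by exact_mod_cast hm ▸ hlarge a b hab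
    refine ⟨hw, fun v hv h => ?_⟩
    obtain ⟨V, rfl⟩ := exists_mapW_pairMap hv
    have he : List.replicate l (b, ρ) ++ List.replicate k (a, σ) ++ [(b, e)] =
        mapW (pairMap a b) (List.replicate l (false, ρ) ++ List.replicate k (!false, σ) ++
          [(false, e)]) := by simp [mapW, pairMap]
    rw [he] at h ⊢
    simpa using dih_geodesic hM false ρ σ e l hk
      ((eqOver_mapW_iff (by omega) hab hm).1 h).symm

/-- Rewriting a maximal factor over two letters to an equivalent geodesic one. -/
theorem EqOver.steps {u u' α β : Word S} (h : EqOver A {a, b} u u') (hu : WordOver {a, b} u)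
    (hu' : GeodOver A {a, b} u') (hα : EndsOff {a, b} α) (hβ : StartsOff {a, b} β) :
    Steps012Star A (α ++ u ++ β) (α ++ u' ++ β) ∨
      ∃ v, v.length < (α ++ u ++ β).length ∧ Steps012Star A (α ++ u ++ β) v := by
  rcases relsOn_pair A a b with hT | ⟨hab, M, hm⟩
  · by_cases hr : FreelyReduced u
    · rw [h.eq_of_relsOn_empty hT hr hu'.freelyReduced]
      exact Or.inl .refl
    · right
      simp only [FreelyReduced, not_forall, not_not] at hr
      obtain ⟨w₁, w₂, s, e, rfl⟩ := hr
      refine ⟨α ++ (w₁ ++ w₂) ++ β, by simp, .single (Or.inl ?_)⟩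
      exact Step0.context ⟨w₁, w₂, s, e, rfl, rfl⟩ α β
  · have hM : 2 ≤ M := by exact_mod_cast hm ▸ A.two_le a b hab
    obtain ⟨U, rfl⟩ := exists_mapW_pairMap hu
    obtain ⟨U', rfl⟩ := exists_mapW_pairMap hu'.1
    by_cases hs : Shrinks (dih M hM) U
    · right
      obtain ⟨V, hV, hl⟩ := hs
      exact ⟨α ++ mapW (pairMap a b) V ++ β, by simpa using hl,
        ((hV.mapW hab hm).context α β).steps012Star⟩
    · left
      exact (dih_connect hM hs (hu'.not_shrinks hab hm)
        ((eqOver_mapW_iff hM hab hm).1 h)).mapW hab hm hα hβ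

end Interface

/-! ### Moves between geodesic factors over two generators -/

/-- The inverse of a letter. -/
def linv (g : S × Bool) : S × Bool := (g.1, !g.2)

@[simp] theorem linv_linv (g : S × Bool) : linv (linv g) = g := by simp [linv]

/-- Replace a geodesic factor over two generators by an equivalent geodesic word. -/
def Move (A : ArtinData S) (w w' : Word S) : Prop :=
  ∃ (a b : S) (α β u v : Word S), w = α ++ u ++ β ∧ w' = α ++ v ++ β ∧
    GeodOver A {a, b} u ∧ GeodOver A {a, b} v ∧ EqOver A {a, b} u v

/-- Two words are linked by a sequence of moves. -/
def Linked (A : ArtinData S) : Word S → Word S → Prop := Relation.ReflTransGen (Move A)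

/-- Every word linked to the given one is freely reduced. -/
def Good (A : ArtinData S) (w : Word S) : Prop := ∀ v, Linked A w v → FreelyReduced v

/-- The word is linked to one that ends with the letter `g`. -/
def Desc (A : ArtinData S) (w : Word S) (g : S × Bool) : Prop := ∃ w', Linked A w (w' ++ [g])

/-- The word is not linked to any word that ends with a letter of `T`. -/
def NoDesc (A : ArtinData S) (T : Set S) (w : Word S) : Prop := ∀ g, g.1 ∈ T → ¬ Desc A w g

/-- The word over `T` is equivalent over `T` to one of the same length that ends with `g`. -/
def DescOver (A : ArtinData S) (T : Set S) (v : Word S) (g : S × Bool) : Prop :=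
  ∃ v', WordOver T v' ∧ v'.length + 1 = v.length ∧ EqOver A T v (v' ++ [g])

section Linked

variable {A : ArtinData S} {a b : S} {T : Set S} {u u' v w w' w'' z : Word S} {g h : S × Bool}

theorem Move.symm (h : Move A w w') : Move A w' w := by
  obtain ⟨a, b, α, β, u, u', rfl, rfl, h1, h2, h3⟩ := h
  exact ⟨a, b, α, β, u', u, rfl, rfl, h2, h1, h3.symm⟩

theorem Move.context (h : Move A w w') (x y : Word S) : Move A (x ++ w ++ y) (x ++ w' ++ y) := by
  obtain ⟨a, b, α, β, u, u', rfl, rfl, h⟩ := h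
  exact ⟨a, b, x ++ α, β ++ y, u, u', by simp, by simp, h⟩

theorem Move.length_eq (h : Move A w w') : w.length = w'.length := by
  obtain ⟨a, b, α, β, u, u', rfl, rfl, h1, h2, h3⟩ := h
  simp [h1.length_eq h2 h3]

theorem Linked.refl (w : Word S) : Linked A w w := Relation.ReflTransGen.refl

theorem Linked.trans (h : Linked A w w') (h' : Linked A w' w'') : Linked A w w'' :=
  Relation.ReflTransGen.trans h h'

theorem Linked.symm (h : Linked A w w') : Linked A w' w := by
  induction h with
  | refl => exact .refl _
  | tail _ h ih => exact Relation.ReflTransGen.head h.symm ih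

theorem Linked.context (h : Linked A w w') (x y : Word S) :
    Linked A (x ++ w ++ y) (x ++ w' ++ y) :=
  h.lift (fun w => x ++ w ++ y) fun _ _ h => h.context x y

theorem Linked.append_left (h : Linked A w w') (x : Word S) : Linked A (x ++ w) (x ++ w') := by
  simpa using h.context x []

theorem Linked.append_right (h : Linked A w w') (y : Word S) : Linked A (w ++ y) (w' ++ y) := by
  simpa using h.context [] y

theorem Linked.length_eq (h : Linked A w w') : w.length = w'.length := by
  induction h with
  | refl => rfl
  | tail _ h ih => exact ih.trans h.length_eq

theorem EqOver.linked (h : EqOver A {a, b} u u') (hu : GeodOver A {a, b} u)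
    (hu' : GeodOver A {a, b} u') : Linked A u u' :=
  .single ⟨a, b, [], [], u, u', by simp, by simp, hu, hu', h⟩

theorem FreelyReduced.of_append {x y : Word S} (h : FreelyReduced (x ++ w ++ y)) :
    FreelyReduced w := by
  rintro w₁ w₂ s e rfl
  exact h (x ++ w₁) (w₂ ++ y) s e (by simp)

theorem Good.linked (h : Good A w) (h' : Linked A w w') : Good A w' :=
  fun x hx => h x (h'.trans hx)

theorem Good.factor {x y : Word S} (h : Good A (x ++ w ++ y)) : Good A w :=
  fun _ hv => (h _ (hv.context x y)).of_append

theorem Good.left {y : Word S} (h : Good A (w ++ y)) : Good A w :=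
  Good.factor (x := []) (y := y) (by simpa using h)

theorem Good.right {x : Word S} (h : Good A (x ++ w)) : Good A w :=
  Good.factor (x := x) (y := []) (by simpa using h)

theorem not_good_cancel (w : Word S) (g : S × Bool) : ¬ Good A (w ++ [linv g] ++ [g]) := by
  intro h
  exact h _ (.refl _) w [] g.1 (!g.2) (by simp [linv])

theorem Good.not_desc (h : Good A (w ++ [g])) : ¬ Desc A w (linv g) := by
  rintro ⟨w', hw⟩
  exact not_good_cancel w' g (h.linked (hw.append_right [g]))

theorem Desc.linked (h : Desc A w g) (h' : Linked A w w') : Desc A w' g := by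
  obtain ⟨x, hx⟩ := h
  exact ⟨x, h'.symm.trans hx⟩

theorem desc_append_singleton (w : Word S) (g : S × Bool) : Desc A (w ++ [g]) g := ⟨w, .refl _⟩

theorem desc_append_replicate (w : Word S) (g : S × Bool) {k : ℕ} (hk : 1 ≤ k) :
    Desc A (w ++ List.replicate k g) g := by
  obtain ⟨k, rfl⟩ : ∃ n, k = n + 1 := ⟨k - 1, by omega⟩
  rw [List.replicate_succ', ← List.append_assoc]
  exact desc_append_singleton _ _

theorem eqOver_cancel (x : Word S) (g : S × Bool) : EqOver A T (x ++ [linv g] ++ [g]) x := by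
  simpa [linv] using (eqOver_nil_pair (A := A) (T := T) g.1 g.2).append_left x

theorem eqOver_cancel' (x : Word S) (g : S × Bool) : EqOver A T (x ++ [g] ++ [linv g]) x := by
  simpa using eqOver_cancel (A := A) (T := T) x (linv g)

/-- If a letter cannot be appended geodesically, then its inverse can be split off. -/
theorem GeodOver.exists_of_not (h : GeodOver A T u) (hg : g.1 ∈ T)
    (hn : ¬ GeodOver A T (u ++ [g])) :
    ∃ x, GeodOver A T (x ++ [linv g]) ∧ EqOver A T u (x ++ [linv g]) := by
  have hw : WordOver T (u ++ [g]) := wordOver_append.2 ⟨h.1, wordOver_singleton.2 hg⟩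
  obtain ⟨x, hx, he⟩ := exists_geodOver (A := A) hw
  have hlt : x.length < (u ++ [g]).length := by
    by_contra hlt
    exact hn (hx.of_eq_length hw he.symm (not_lt.1 hlt))
  have hp := he.length_parity
  have he' : EqOver A T u (x ++ [linv g]) :=
    (eqOver_cancel' u g).symm.trans (he.append_right [linv g])
  have hw' : WordOver T (x ++ [linv g]) := wordOver_append.2 ⟨hx.1, wordOver_singleton.2 hg⟩
  refine ⟨x, h.of_eq_length hw' he' ?_, he'⟩
  simp only [List.length_append, List.length_singleton] at *
  push_cast at hp
  omega

/-- Factors of good words over two generators are geodesic. -/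
theorem Good.geodOver (h : Good A v) (hv : WordOver {a, b} v) : GeodOver A {a, b} v := by
  induction v using List.reverseRecOn with
  | nil => exact ⟨hv, fun _ _ _ => by simp⟩
  | append_singleton v g ih =>
    rw [wordOver_append, wordOver_singleton] at hv
    have hg := ih h.left hv.1
    by_contra hn
    obtain ⟨x, hx, he⟩ := hg.exists_of_not hv.2 hn
    exact h.not_desc ⟨x, he.linked hg hx⟩

/-- Strip off a longest final part over `T`. -/
theorem exists_decomp (A : ArtinData S) (T : Set S) (w : Word S) :
    ∃ z v, Linked A w (z ++ v) ∧ WordOver T v ∧ NoDesc A T z := by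
  induction hn : w.length generalizing w with
  | zero =>
    refine ⟨w, [], by simpa using Linked.refl w, .nil, ?_⟩
    rintro g - ⟨w', hw⟩
    have := hw.length_eq
    simp [hn] at this
  | succ n ih =>
    by_cases hw : NoDesc A T w
    · exact ⟨w, [], by simpa using Linked.refl w, .nil, hw⟩
    · simp only [NoDesc, not_forall, not_not] at hw
      obtain ⟨g, hg, w', hw⟩ := hw
      have := hw.length_eq
      obtain ⟨z, v, h1, h2, h3⟩ := ih w' (by simp at this; omega)
      exact ⟨z, v ++ [g], by simpa using hw.trans (h1.append_right [g]),
        wordOver_append.2 ⟨h2, wordOver_singleton.2 hg⟩, h3⟩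

/-- A letter whose inverse does not end the word extends final geodesic parts. -/
theorem Good.geodOver_append (h : Good A w) (hd : ¬ Desc A w (linv g))
    (hw : Linked A w (z ++ v)) (hv : WordOver {a, b} v) (hg : g.1 ∈ ({a, b} : Set S)) :
    GeodOver A {a, b} (v ++ [g]) := by
  have hv' : GeodOver A {a, b} v := (h.linked hw).right.geodOver hv
  by_contra hn
  obtain ⟨x, hx, he⟩ := hv'.exists_of_not hg hn
  exact hd ⟨z ++ x, by simpa using hw.trans ((he.linked hv' hx).append_left z)⟩

end Linked

/-! ### Last letters of good words -/

/-- The last letters `g` and `h` of the words `wg` and `w'h` are related over two generators. -/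
def LastRel (A : ArtinData S) (w : Word S) (g : S × Bool) (w' : Word S) (h : S × Bool) : Prop :=
  (g = h ∧ Linked A w w') ∨ (g.1 ≠ h.1 ∧ ∃ z u u', Linked A w (z ++ u) ∧ Linked A w' (z ++ u') ∧
    GeodOver A {g.1, h.1} (u ++ [g]) ∧ GeodOver A {g.1, h.1} (u' ++ [h]) ∧
    EqOver A {g.1, h.1} (u ++ [g]) (u' ++ [h]))

/-- Linked good words of length at most `n` have related last letters. -/
def LastRelUpTo (A : ArtinData S) (n : ℕ) : Prop :=
  ∀ w g v h, w.length + 1 ≤ n → Good A (w ++ [g]) → Linked A (w ++ [g]) (v ++ [h]) →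
    LastRel A w g v h

/-- A letter can be appended to a good word of length less than `n` unless its inverse ends it. -/
def GoodAppendUpTo (A : ArtinData S) (n : ℕ) : Prop :=
  ∀ w g, w.length + 1 ≤ n → Good A w → ¬ Desc A w (linv g) → Good A (w ++ [g])

section Induction

variable {A : ArtinData S} {n : ℕ} {a b d : S} {w w' w'' x y z z' u u' v v' : Word S}
  {f g h : S × Bool}

theorem LastRel.symm (hl : LastRel A w g w' h) : LastRel A w' h w g := by
  rcases hl with ⟨rfl, hl⟩ | ⟨hne, z, u, u', h1, h2, h3, h4, h5⟩
  · exact Or.inl ⟨rfl, hl.symm⟩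
  · rw [Set.pair_comm] at h3 h4 h5
    exact Or.inr ⟨hne.symm, z, u', u, h2, h1, h4, h3, h5.symm⟩

theorem LastRel.linked_left (hl : LastRel A w g w' h) (hw : Linked A w'' w) :
    LastRel A w'' g w' h := by
  rcases hl with ⟨rfl, hl⟩ | ⟨hne, z, u, u', h1, h2⟩
  · exact Or.inl ⟨rfl, hw.trans hl⟩
  · exact Or.inr ⟨hne, z, u, u', hw.trans h1, h2⟩

theorem pair_eq_of_mem (hg : g.1 ∈ ({a, b} : Set S)) (hh : h.1 ∈ ({a, b} : Set S))
    (hne : g.1 ≠ h.1) : ({g.1, h.1} : Set S) = {a, b} := by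
  simp only [Set.mem_insert_iff, Set.mem_singleton_iff] at hg hh
  rcases hg with hg | hg <;> rcases hh with hh | hh <;> simp_all [Set.pair_comm]

/-- Uniqueness of the decomposition. -/
theorem LastRelUpTo.decomp_unique (hn : LastRelUpTo A n) (hG : Good A (z ++ v))
    (hle : (z ++ v).length ≤ n) (hl : Linked A (z ++ v) (z' ++ v')) (hv : WordOver {a, b} v)
    (hv' : WordOver {a, b} v') (hz : NoDesc A {a, b} z) (hz' : NoDesc A {a, b} z') :
    Linked A z z' ∧ EqOver A {a, b} v v' := by
  induction hN : (z ++ v).length using Nat.strong_induction_on generalizing z v z' v' with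
  | _ N ih =>
  rcases List.eq_nil_or_concat' v with rfl | ⟨p, g, rfl⟩
  · rcases List.eq_nil_or_concat' v' with rfl | ⟨p', h, rfl⟩
    · exact ⟨by simpa using hl, .refl _⟩
    · rw [wordOver_append, wordOver_singleton] at hv'
      exact absurd ⟨z' ++ p', by simpa using hl⟩ (hz h hv'.2)
  · rw [wordOver_append, wordOver_singleton] at hv
    rcases List.eq_nil_or_concat' v' with rfl | ⟨p', h, rfl⟩
    · exact absurd ⟨z ++ p, by simpa using hl.symm⟩ (hz' g hv.2)
    · rw [wordOver_append, wordOver_singleton] at hv'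
      have hG' := hG.linked hl
      have hlen := hl.length_eq
      simp only [← List.append_assoc] at hG hG' hl
      simp only [List.length_append, List.length_singleton] at hN hle hlen
      rcases hn _ _ _ _ (by simp; omega) hG hl with ⟨rfl, h1⟩ | ⟨hne, y, u, u', h1, h2, h3, h4, h5⟩
      · obtain ⟨h2, h3⟩ := ih _ (by simp; omega) hG.left (by simp; omega) h1 hv.1 hv'.1 hz hz' rfl
        exact ⟨h2, h3.append_right _⟩
      · rw [pair_eq_of_mem hv.2 hv'.2 hne] at h3 h4 h5
        have hu := (wordOver_append.1 h3.1).1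
        have hu' := (wordOver_append.1 h4.1).1
        obtain ⟨x, t, hx, ht, hxn⟩ := exists_decomp A {a, b} y
        obtain ⟨e1, e2⟩ := ih _ (by simp; omega) hG.left (by simp; omega)
          (v' := t ++ u) (by simpa using h1.trans (hx.append_right u)) hv.1
          (wordOver_append.2 ⟨ht, hu⟩) hz hxn rfl
        obtain ⟨e3, e4⟩ := ih _ (by simp; omega) hG'.left (by simp; omega)
          (v' := t ++ u') (by simpa using h2.trans (hx.append_right u')) hv'.1
          (wordOver_append.2 ⟨ht, hu'⟩) hz' hxn rfl
        refine ⟨e1.trans e3.symm, ?_⟩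
        refine (e2.append_right [g]).trans (EqOver.trans ?_ (e4.append_right [h]).symm)
        simpa using h5.append_left t

theorem LastRelUpTo.descOver (hn : LastRelUpTo A n) (hG : Good A (z ++ v))
    (hle : (z ++ v).length ≤ n) (hv : WordOver {a, b} v) (hz : NoDesc A {a, b} z)
    (hg : g.1 ∈ ({a, b} : Set S)) (hd : Desc A (z ++ v) g) : DescOver A {a, b} v g := by
  obtain ⟨w', hw⟩ := hd
  obtain ⟨z', v', h1, h2, h3⟩ := exists_decomp A {a, b} w'
  have hl : Linked A (z ++ v) (z' ++ (v' ++ [g])) := by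
    simpa using hw.trans (h1.append_right [g])
  obtain ⟨e1, e2⟩ := hn.decomp_unique hG hle hl hv
    (wordOver_append.2 ⟨h2, wordOver_singleton.2 hg⟩) hz h3
  refine ⟨v', h2, ?_, e2⟩
  have := hl.length_eq
  have := e1.length_eq
  simp at *
  omega

theorem LastRelUpTo.not_desc (hn : LastRelUpTo A n) (hG : Good A (z ++ v))
    (hle : (z ++ v).length ≤ n) (hz : NoDesc A {a, b} z) (hv : GeodOver A {a, b} (v ++ [f])) :
    ¬ Desc A (z ++ v) (linv f) := by
  intro hd
  have hw := wordOver_append.1 hv.1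
  have hf := wordOver_singleton.1 hw.2
  obtain ⟨v', h1, h2, h3⟩ := hn.descOver hG hle hw.1 hz (g := linv f) hf hd
  have := hv.2 v' h1 ((h3.append_right [f]).trans (eqOver_cancel v' f))
  simp at this
  omega

theorem LastRelUpTo.good_append (hn : LastRelUpTo A n) (hn' : GoodAppendUpTo A n)
    (hG : Good A z) (hz : NoDesc A {a, b} z) (hv : GeodOver A {a, b} v)
    (hle : (z ++ v).length ≤ n) : Good A (z ++ v) := by
  induction v using List.reverseRecOn with
  | nil => simpa using hG
  | append_singleton v f ih =>
    simp only [List.length_append, List.length_singleton] at hle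
    have h1 := ih hv.of_append_left (by simp; omega)
    rw [← List.append_assoc]
    exact hn' _ _ (by simp; omega) h1 (hn.not_desc h1 (by simp; omega) hz hv)

end Induction

/-! ### Final blocks of words over two generators -/

section Blocks

variable {A : ArtinData S} {T : Set S} {a b c : S} {u v w : Word S} {g h : S × Bool}

theorem FreelyReduced.eq_replicate (hu : FreelyReduced u) (h : WordOver {c} u) :
    ∃ k σ, u = List.replicate k (c, σ) := by
  induction u using List.reverseRecOn with
  | nil => exact ⟨0, true, rfl⟩
  | append_singleton u g ih =>
    rw [wordOver_append, wordOver_singleton] at h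
    obtain ⟨s, e⟩ := g
    obtain rfl : s = c := h.2
    obtain ⟨k, σ, rfl⟩ := ih (FreelyReduced.of_append (x := []) (y := [(s, e)]) hu) h.1
    rcases k with _ | k
    · exact ⟨1, e, rfl⟩
    · by_cases he : e = σ
      · exact ⟨k + 2, σ, by rw [he, ← List.replicate_succ']⟩
      · obtain rfl : e = !σ := by cases e <;> cases σ <;> simp_all
        refine absurd ?_ (hu (List.replicate k (s, σ)) [] s σ)
        simp [List.replicate_succ']

theorem GeodOver.descOver_last (hv : WordOver T (v ++ [g])) : DescOver A T (v ++ [g]) g :=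
  ⟨v, (wordOver_append.1 hv).1, by simp, .refl _⟩

theorem DescOver.of_eqOver (hd : DescOver A T u g) (he : EqOver A T u v)
    (hl : u.length = v.length) : DescOver A T v g := by
  obtain ⟨x, h1, h2, h3⟩ := hd
  exact ⟨x, h1, h2.trans hl, he.symm.trans h3⟩

/-- Strip off a longest final power of a generator. -/
theorem GeodOver.exists_strip (hv : GeodOver A {a, b} v) (hc : c ∈ ({a, b} : Set S)) :
    ∃ x k σ, GeodOver A {a, b} (x ++ List.replicate k (c, σ)) ∧
      EqOver A {a, b} v (x ++ List.replicate k (c, σ)) ∧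
      ∀ σ', ¬ DescOver A {a, b} x (c, σ') := by
  obtain ⟨x, y, h1, h2, h3⟩ : ∃ x y, GeodOver A {a, b} (x ++ y) ∧ EqOver A {a, b} v (x ++ y) ∧
      WordOver {c} y ∧ ∀ σ', ¬ DescOver A {a, b} x (c, σ') := by
    induction hn : v.length generalizing v with
    | zero =>
      refine ⟨v, [], by simpa using hv, by simpa using EqOver.refl v, .nil, ?_⟩
      rintro σ' ⟨y, -, hy, -⟩
      omega
    | succ n ih =>
      by_cases hd : ∀ σ', ¬ DescOver A {a, b} v (c, σ')
      · exact ⟨v, [], by simpa using hv, by simpa using EqOver.refl v, .nil, hd⟩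
      · push Not at hd
        obtain ⟨σ', v', h1, h2, h3⟩ := hd
        have hw : WordOver {a, b} (v' ++ [(c, σ')]) :=
          wordOver_append.2 ⟨h1, wordOver_singleton.2 hc⟩
        have hg := hv.of_eq_length hw h3 (by simp; omega)
        obtain ⟨x, y, e1, e2, e3, e4⟩ := ih hg.of_append_left (by omega)
        have hl := hg.of_append_left.length_eq e1 e2
        refine ⟨x, y ++ [(c, σ')], ?_, ?_, wordOver_append.2 ⟨e3, by simp [WordOver]⟩, e4⟩
        · refine hv.of_eq_length ?_ ?_ ?_
          · rw [← List.append_assoc]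
            exact wordOver_append.2 ⟨e1.1, wordOver_singleton.2 hc⟩
          · rw [← List.append_assoc]
            exact h3.trans (e2.append_right _)
          · simp at *; omega
        · rw [← List.append_assoc]
          exact h3.trans (e2.append_right _)
  obtain ⟨k, σ, rfl⟩ := h1.of_append_right.freelyReduced.eq_replicate h3.1
  exact ⟨x, k, σ, h1, h2, h3.2⟩

/-- A geodesic word of the form `bˡaᵏ` with `k ≥ 1` cannot also end with `b`. -/
theorem not_descOver_two_blocks (hlarge : ∀ s t : S, s ≠ t → 3 ≤ A.m s t) (hab : a ≠ b)
    (ρ σ e : Bool) (l : ℕ) {k : ℕ} (hk : 1 ≤ k) :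
    ¬ DescOver A {a, b} (List.replicate l (b, ρ) ++ List.replicate k (a, σ)) (b, e) := by
  rintro ⟨v, h1, h2, h3⟩
  have := (geodOver_three_blocks hlarge hab ρ σ (!e) l hk).2 v h1
    ((h3.append_right _).trans (eqOver_cancel' v (b, e)))
  simp at *
  omega

/-- A geodesic word that can end with either generator ends with a power of one, preceded by a
power of the other, preceded by the former generator. -/
theorem GeodOver.exists_blocks (hlarge : ∀ s t : S, s ≠ t → 3 ≤ A.m s t) (hab : a ≠ b)
    (hv : GeodOver A {a, b} v) {e e' : Bool} (ha : DescOver A {a, b} v (a, e))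
    (hb : DescOver A {a, b} v (b, e')) :
    ∃ x ε l ρ k σ, 1 ≤ l ∧ 1 ≤ k ∧
      GeodOver A {a, b} (x ++ [(a, ε)] ++ List.replicate l (b, ρ) ++ List.replicate k (a, σ)) ∧
      EqOver A {a, b} v (x ++ [(a, ε)] ++ List.replicate l (b, ρ) ++ List.replicate k (a, σ)) ∧
      (∀ σ', ¬ DescOver A {a, b} (x ++ [(a, ε)]) (b, σ')) ∧
      ∀ σ', ¬ DescOver A {a, b} (x ++ [(a, ε)] ++ List.replicate l (b, ρ)) (a, σ') := by
  obtain ⟨v1, k, σ, h1, h2, h3⟩ := hv.exists_strip (c := a) (by simp)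
  have hk : 1 ≤ k := by
    by_contra hk
    obtain rfl : k = 0 := by omega
    rw [List.replicate_zero, List.append_nil] at h1 h2
    exact h3 e (ha.of_eqOver h2 (hv.length_eq h1 h2))
  obtain ⟨v2, l, ρ, h4, h5, h6⟩ := h1.of_append_left.exists_strip (c := b) (by simp)
  have hl1 := h1.of_append_left.length_eq h4 h5
  have h7 : EqOver A {a, b} v (v2 ++ List.replicate l (b, ρ) ++ List.replicate k (a, σ)) :=
    h2.trans (h5.append_right _)
  have h8 : GeodOver A {a, b} (v2 ++ List.replicate l (b, ρ) ++ List.replicate k (a, σ)) := by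
    refine hv.of_eq_length (wordOver_append.2 ⟨h4.1, (wordOver_append.1 h1.1).2⟩) h7 ?_
    have := hv.length_eq h1 h2
    simp at *
    omega
  rcases List.eq_nil_or_concat' v2 with rfl | ⟨x, ⟨s, ε⟩, rfl⟩
  · rw [List.nil_append] at h7 h8
    exact absurd (hb.of_eqOver h7 (hv.length_eq h8 h7))
      (not_descOver_two_blocks hlarge hab _ _ _ _ hk)
  · have hs : s = a := by
      have := wordOver_singleton.1 (wordOver_append.1 h4.of_append_left.1).2
      rcases this with h | h
      · exact h
      · obtain rfl : s = b := h
        exact absurd (GeodOver.descOver_last h4.of_append_left.1) (h6 ε)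
    subst hs
    have h9 : ∀ σ', ¬ DescOver A {s, b} (x ++ [(s, ε)] ++ List.replicate l (b, ρ)) (s, σ') :=
      fun σ' hd => h3 σ' (hd.of_eqOver h5.symm hl1.symm)
    refine ⟨x, ε, l, ρ, k, σ, ?_, hk, h8, h7, h6, h9⟩
    by_contra hl
    obtain rfl : l = 0 := by omega
    rw [List.replicate_zero, List.append_nil] at h9 h4
    exact h9 ε (GeodOver.descOver_last h4.1)

end Blocks

/-! ### Three distinct last names are impossible -/

section Three

variable {A : ArtinData S} {n : ℕ} {a b d : S} {w w' w'' x y z z' u u' v v' : Word S}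
  {f g h : S × Bool}

theorem LastRelUpTo.noDesc_append {c : S} (hn : LastRelUpTo A n) (hG : Good A (z ++ v))
    (hle : (z ++ v).length ≤ n) (hv : WordOver {a, b} v) (hz : NoDesc A {a, b} z)
    (hc : c ∈ ({a, b} : Set S)) (hd : ∀ σ, ¬ DescOver A {a, b} v (c, σ)) :
    NoDesc A {c} (z ++ v) := by
  rintro ⟨s, σ⟩ hs hds
  obtain rfl : s = c := hs
  exact hd σ (hn.descOver hG hle hv hz (g := (s, σ)) hc hds)

/-- A good word that can end with two distinct generators ends with a power of one, preceded by a
power of the other, preceded by the former generator. -/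
theorem LastRelUpTo.exists_blocks (hlarge : ∀ s t : S, s ≠ t → 3 ≤ A.m s t)
    (hn : LastRelUpTo A n) (hG : Good A y) (hle : y.length ≤ n) (hab : a ≠ b) {e e' : Bool}
    (ha : Desc A y (a, e)) (hb : Desc A y (b, e')) :
    ∃ q ε l ρ k σ, 1 ≤ l ∧ 1 ≤ k ∧
      Linked A y (q ++ List.replicate l (b, ρ) ++ List.replicate k (a, σ)) ∧
      Desc A q (a, ε) ∧ NoDesc A {b} q ∧ NoDesc A {a} (q ++ List.replicate l (b, ρ)) := by
  obtain ⟨z, v, h1, h2, h3⟩ := exists_decomp A {a, b} y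
  have hG' := hG.linked h1
  have hle' := h1.length_eq ▸ hle
  have hv := hG'.right.geodOver h2
  obtain ⟨x, ε, l, ρ, k, σ, hl, hk, e1, e2, e3, e4⟩ := hv.exists_blocks hlarge hab
    (hn.descOver hG' hle' h2 h3 (by simp) (ha.linked h1))
    (hn.descOver hG' hle' h2 h3 (by simp) (hb.linked h1))
  have hlink : Linked A y (z ++ (x ++ [(a, ε)]) ++ List.replicate l (b, ρ) ++
      List.replicate k (a, σ)) := by
    simpa using h1.trans ((e2.linked hv e1).append_left z)
  have hG2 := hG.linked hlink
  have hle2 := hlink.length_eq ▸ hle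
  simp only [List.length_append, List.length_replicate, List.length_singleton] at hle2
  refine ⟨z ++ (x ++ [(a, ε)]), ε, l, ρ, k, σ, hl, hk, hlink, ?_, ?_, ?_⟩
  · rw [← List.append_assoc]
    exact desc_append_singleton _ _
  · exact hn.noDesc_append hG2.left.left (by simp; omega) e1.of_append_left.of_append_left.1 h3
      (by simp) e3
  · have := hG2.left
    rw [List.append_assoc] at this ⊢
    exact hn.noDesc_append this (by simp; omega) e1.of_append_left.1 h3 (by simp) e4

theorem LastRelUpTo.strip_unique {c : S} (hn : LastRelUpTo A n) (hG : Good A (z ++ v))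
    (hle : (z ++ v).length ≤ n) (hl : Linked A (z ++ v) (z' ++ v')) (hv : WordOver {c} v)
    (hv' : WordOver {c} v') (hz : NoDesc A {c} z) (hz' : NoDesc A {c} z') : Linked A z z' := by
  rw [← Set.pair_eq_singleton] at hv hv' hz hz'
  exact (hn.decomp_unique hG hle hl hv hv' hz hz').1

theorem LastRelUpTo.no_three (hlarge : ∀ s t : S, s ≠ t → 3 ≤ A.m s t) (hn : LastRelUpTo A n)
    (hle : y.length ≤ n) (hG : Good A y) (had : a ≠ d) (hdb : d ≠ b) (hba : b ≠ a)
    {e₁ e₂ e₃ : Bool} (ha : Desc A y (a, e₁)) (hd : Desc A y (d, e₂)) (hl : Linked A y (x ++ u))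
    (hu : WordOver {a} u) (hx : NoDesc A {a} x) (hb : Desc A x (b, e₃)) : False := by
  induction hN : y.length using Nat.strong_induction_on
    generalizing y x u a d b e₁ e₂ e₃ with
  | _ N ih =>
  obtain ⟨q, ε, l, ρ, k, σ, hl1, hk, h1, h2, h3, h4⟩ := hn.exists_blocks hlarge hG hle had ha hd
  have hlen := h1.length_eq
  have hxq := hn.strip_unique (hG.linked hl) (hl.length_eq ▸ hle) (hl.symm.trans h1) hu
    (wordOver_replicate (by simp) _) hx h4
  simp only [List.length_append, List.length_replicate] at hlen
  exact ih _ (by simp; omega) (y := q ++ List.replicate l (d, ρ)) (by simp; omega)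
    (hG.linked h1).left hdb hba had (desc_append_replicate _ _ hl1) (hb.linked hxq)
    (.refl _) (wordOver_replicate (by simp) _) h3 h2 rfl

end Three

/-! ### The induction -/

section Step

variable {A : ArtinData S} {n : ℕ} {a b d : S} {w w' w'' x y z z' u u' v v' : Word S}
  {f g h : S × Bool}

theorem LastRelUpTo.exists_strip_last (hlarge : ∀ s t : S, s ≠ t → 3 ≤ A.m s t)
    (hn : LastRelUpTo A n) (hle : w.length ≤ n) (hG : Good A w) (hd : ¬ Desc A w (linv h))
    (hne : h.1 ≠ g.1) (hl : Linked A w (z ++ u')) (hu : GeodOver A {h.1, g.1} (u ++ [g]))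
    (hu' : GeodOver A {h.1, g.1} (u' ++ [h]))
    (he : EqOver A {h.1, g.1} (u' ++ [h]) (u ++ [g])) :
    ∃ q ε l ρ k σ, 1 ≤ l ∧
      Linked A w (q ++ List.replicate l (g.1, ρ) ++ List.replicate k (h.1, σ)) ∧
      Desc A q (h.1, ε) ∧ NoDesc A {g.1} q ∧ NoDesc A {h.1} (q ++ List.replicate l (g.1, ρ)) := by
  obtain ⟨z, t, h1, h2, h3⟩ := exists_decomp A {h.1, g.1} z
  have hw : Linked A w (z ++ (t ++ u')) := by simpa using hl.trans (h1.append_right u')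
  have hwu' := wordOver_append.1 hu'.1
  have hwu := wordOver_append.1 hu.1
  have hP : WordOver {h.1, g.1} (t ++ u') := wordOver_append.2 ⟨h2, hwu'.1⟩
  have hPg := hG.geodOver_append hd hw hP (wordOver_singleton.1 hwu'.2)
  have hlu := hu'.length_eq hu he
  simp only [List.length_append, List.length_singleton] at hlu
  obtain ⟨p, ε, l, ρ, k, σ, hl1, hk, e1, e2, e3, e4⟩ := hPg.exists_blocks hlarge hne
    (e := h.2) (e' := g.2) (GeodOver.descOver_last hPg.1)
    ⟨t ++ u, wordOver_append.2 ⟨h2, hwu.1⟩, by simp; omega, by simpa using he.append_left t⟩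
  obtain ⟨k, rfl⟩ : ∃ j, k = j + 1 := ⟨k - 1, by omega⟩
  rw [List.replicate_succ', ← List.append_assoc] at e1 e2
  by_cases hσ : σ = h.2
  · subst hσ
    have e5 := e2.of_append_right
    have hlink : Linked A w (z ++ (p ++ [(h.1, ε)]) ++ List.replicate l (g.1, ρ) ++
        List.replicate k (h.1, h.2)) := by
      simpa using hw.trans ((e5.linked hPg.of_append_left e1.of_append_left).append_left z)
    have hG2 := hG.linked hlink
    have hle2 := hlink.length_eq ▸ hle
    simp only [List.length_append, List.length_replicate, List.length_singleton] at hle2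
    refine ⟨z ++ (p ++ [(h.1, ε)]), ε, l, ρ, k, h.2, hl1, hlink, ?_, ?_, ?_⟩
    · rw [← List.append_assoc]
      exact desc_append_singleton _ _
    · exact hn.noDesc_append hG2.left.left (by simp; omega)
        e1.of_append_left.of_append_left.of_append_left.1 h3 (by simp) e3
    · have := hG2.left
      rw [List.append_assoc] at this ⊢
      exact hn.noDesc_append this (by simp; omega) e1.of_append_left.of_append_left.1 h3
        (by simp) e4
  · obtain rfl : σ = !h.2 := by
      revert hσ; cases σ <;> cases h.2 <;> simp
    exact (GeodOver.last_sign hPg e1 e2).elim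

/-- The word `w` is good and stays so when `g` is appended without cancelling. -/
def Extends (A : ArtinData S) (w : Word S) (g : S × Bool) : Prop :=
  Good A w ∧ ¬ Desc A w (linv g)

theorem Extends.linked (hw : Extends A w g) (hl : Linked A w w') : Extends A w' g :=
  ⟨hw.1.linked hl, fun hd => hw.2 (hd.linked hl.symm)⟩

theorem LastRel.trans (hlarge : ∀ s t : S, s ≠ t → 3 ≤ A.m s t) (hn : LastRelUpTo A n)
    (hle : w'.length ≤ n) (hw : Extends A w g) (hw' : Extends A w' h) (hw'' : Extends A w'' f)
    (h1 : LastRel A w g w' h) (h2 : LastRel A w' h w'' f) : LastRel A w g w'' f := by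
  rcases h1 with ⟨rfl, h1⟩ | ⟨hne, h1⟩
  · exact h2.linked_left h1
  rcases h2 with ⟨rfl, h2⟩ | ⟨hne', h2⟩
  · exact (LastRel.linked_left (LastRel.symm (Or.inr ⟨hne, h1⟩)) h2.symm).symm
  obtain ⟨z, u, u', l1, l2, g1, g2, he⟩ := h1
  obtain ⟨y, p, p', l3, l4, g3, g4, he'⟩ := h2
  by_cases hfg : f.1 = g.1
  · left
    rw [hfg, Set.pair_comm] at g3 g4 he'
    have hu := wordOver_append.1 g1.1
    have hu' := wordOver_append.1 g2.1
    have hp := wordOver_append.1 g3.1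
    have hp' := wordOver_append.1 g4.1
    obtain ⟨x, t, d1, d2, d3⟩ := exists_decomp A {g.1, h.1} z
    obtain ⟨x', t', d1', d2', d3'⟩ := exists_decomp A {g.1, h.1} y
    have m1 : Linked A w (x ++ (t ++ u)) := by simpa using l1.trans (d1.append_right u)
    have m2 : Linked A w' (x ++ (t ++ u')) := by simpa using l2.trans (d1.append_right u')
    have m3 : Linked A w' (x' ++ (t' ++ p)) := by simpa using l3.trans (d1'.append_right p)
    have m4 : Linked A w'' (x' ++ (t' ++ p')) := by simpa using l4.trans (d1'.append_right p')
    obtain ⟨c1, c2⟩ := hn.decomp_unique (hw'.1.linked m2) (m2.length_eq ▸ hle) (m2.symm.trans m3)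
      (wordOver_append.2 ⟨d2, hu'.1⟩) (wordOver_append.2 ⟨d2', hp.1⟩) d3 d3'
    have hE : EqOver A {g.1, h.1} (t ++ u ++ [g]) (t' ++ p' ++ [f]) := by
      have c3 := he.append_left t
      have c4 := c2.append_right [h]
      have c5 := he'.append_left t'
      simp only [← List.append_assoc] at c3 c4 c5
      exact c3.trans (c4.trans c5)
    have G1 := hw.1.geodOver_append hw.2 m1 (wordOver_append.2 ⟨d2, hu.1⟩)
      (wordOver_singleton.1 hu.2)
    have G2 := hw''.1.geodOver_append hw''.2 m4 (wordOver_append.2 ⟨d2', hp'.1⟩)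
      (wordOver_singleton.1 hp'.2)
    obtain ⟨s, e⟩ := g
    obtain ⟨s', e'⟩ := f
    obtain rfl : s' = s := hfg
    by_cases hee : e' = e
    · subst hee
      refine ⟨rfl, m1.trans (Linked.trans ?_ m4.symm)⟩
      exact (c1.append_right _).trans
        ((hE.of_append_right.linked G1.of_append_left G2.of_append_left).append_left x')
    · obtain rfl : e' = !e := by revert hee; cases e <;> cases e' <;> simp
      exact (G1.last_sign G2 hE).elim
  · exfalso
    rw [Set.pair_comm] at g1 g2 he
    obtain ⟨q, ε, l, ρ, k, σ, hl, n1, n2, n3, n4⟩ :=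
      hn.exists_strip_last hlarge hle hw'.1 hw'.2 hne.symm l2 g1 g2 he.symm
    obtain ⟨q', ε', l', ρ', k', σ', hl', n1', n2', n3', n4'⟩ :=
      hn.exists_strip_last hlarge hle hw'.1 hw'.2 hne' l3 g4 g3 he'
    have hs := hn.strip_unique (hw'.1.linked n1) (n1.length_eq ▸ hle) (n1.symm.trans n1')
      (wordOver_replicate (by simp) _) (wordOver_replicate (by simp) _) n4 n4'
    have hlen := n1.length_eq
    simp only [List.length_append, List.length_replicate] at hlen
    exact hn.no_three hlarge (y := q ++ List.replicate l (g.1, ρ)) (by simp; omega)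
      (hw'.1.linked n1).left (fun e => hfg e.symm) hne'.symm hne.symm
      (desc_append_replicate _ _ hl)
      ((desc_append_replicate _ _ hl').linked hs.symm) (.refl _)
      (wordOver_replicate (by simp) _) n3 n2

theorem Extends.move (hn : LastRelUpTo A n) (hn' : GoodAppendUpTo A n) (hle : w.length ≤ n)
    (hw : Extends A w g) (hm : Move A (w ++ [g]) y) :
    ∃ w' h, y = w' ++ [h] ∧ Extends A w' h ∧ LastRel A w g w' h := by
  obtain ⟨a, b, α, β, u, u', he, rfl, hu, hu', heq⟩ := hm
  have same : ∀ w', Linked A w w' → w' ++ [g] = α ++ u' ++ β →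
      ∃ w' h, α ++ u' ++ β = w' ++ [h] ∧ Extends A w' h ∧ LastRel A w g w' h :=
    fun w' hl e => ⟨w', g, e.symm, hw.linked hl, Or.inl ⟨rfl, hl⟩⟩
  rcases List.eq_nil_or_concat' β with rfl | ⟨β, x, rfl⟩
  · rw [List.append_nil] at he same ⊢
    have hlen := hu.length_eq hu' heq
    rcases List.eq_nil_or_concat' u with rfl | ⟨p, x, rfl⟩
    · obtain rfl : u' = [] := List.length_eq_zero_iff.1 hlen.symm
      exact same w (.refl _) he
    rcases List.eq_nil_or_concat' u' with rfl | ⟨p', h, rfl⟩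
    · simp at hlen
    rw [← List.append_assoc] at he
    obtain ⟨rfl, hx⟩ := List.append_inj' he rfl
    obtain rfl : g = x := by simpa using hx
    have hwp := wordOver_append.1 hu.1
    have hwp' := wordOver_append.1 hu'.1
    by_cases hgh : g.1 = h.1
    · obtain ⟨s, e⟩ := g
      obtain ⟨s', e'⟩ := h
      obtain rfl : s = s' := hgh
      by_cases hee : e' = e
      · subst hee
        exact same _ ((heq.of_append_right.linked hu.of_append_left hu'.of_append_left).append_left
          α) (by simp)
      · obtain rfl : e' = !e := by revert hee; cases e <;> cases e' <;> simp
        exact (hu.last_sign hu' heq).elim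
    · refine ⟨α ++ p', h, by simp, ?_, Or.inr ⟨hgh, α, p, p', .refl _, .refl _, ?_⟩⟩
      · obtain ⟨z, t, d1, d2, d3⟩ := exists_decomp A {a, b} α
        have m1 : Linked A (α ++ p) (z ++ (t ++ p)) := by simpa using d1.append_right p
        have m2 : Linked A (z ++ (t ++ p')) (α ++ p') := by
          simpa using (d1.append_right p').symm
        have G1 := hw.1.geodOver_append hw.2 m1 (wordOver_append.2 ⟨d2, hwp.1⟩)
          (wordOver_singleton.1 hwp.2)
        have G2 : GeodOver A {a, b} (t ++ p' ++ [h]) := by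
          refine G1.of_eq_length ?_ ?_ ?_
          · rw [List.append_assoc]
            exact wordOver_append.2 ⟨d2, hu'.1⟩
          · simpa using heq.append_left t
          · simp at hlen ⊢; omega
        have hle' : (z ++ (t ++ p')).length ≤ n := by
          have := d1.length_eq
          simp at *
          omega
        have hgood := hn.good_append hn' (hw.1.linked m1).left d3 G2.of_append_left hle'
        exact Extends.linked ⟨hgood, hn.not_desc hgood hle' d3 G2⟩ m2
      · rw [pair_eq_of_mem (wordOver_singleton.1 hwp.2) (wordOver_singleton.1 hwp'.2) hgh]
        exact ⟨hu, hu', heq⟩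
  · rw [← List.append_assoc] at he
    obtain ⟨rfl, hx⟩ := List.append_inj' he rfl
    obtain rfl : g = x := by simpa using hx
    exact same _ ((heq.linked hu hu').context α β) (by simp)

theorem Extends.of_linked (hlarge : ∀ s t : S, s ≠ t → 3 ≤ A.m s t) (hn : LastRelUpTo A n)
    (hn' : GoodAppendUpTo A n) (hle : w.length ≤ n) (hw : Extends A w g)
    (hl : Linked A (w ++ [g]) y) :
    ∃ w' h, y = w' ++ [h] ∧ Extends A w' h ∧ LastRel A w g w' h := by
  induction hl with
  | refl => exact ⟨w, g, rfl, hw, Or.inl ⟨rfl, .refl _⟩⟩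
  | tail hl hm ih =>
    obtain ⟨w', h, rfl, h1, h2⟩ := ih
    have hlen := Linked.length_eq hl
    simp only [List.length_append, List.length_singleton] at hlen
    obtain ⟨w'', f, rfl, h3, h4⟩ := h1.move hn hn' (by omega) hm
    exact ⟨w'', f, rfl, h3, h2.trans hlarge hn (by omega) hw h1 h3 h4⟩

theorem Extends.good_append (hlarge : ∀ s t : S, s ≠ t → 3 ≤ A.m s t) (hn : LastRelUpTo A n)
    (hn' : GoodAppendUpTo A n) (hle : w.length ≤ n) (hw : Extends A w g) :
    Good A (w ++ [g]) := by
  intro y hy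
  obtain ⟨w', h, rfl, h1, -⟩ := hw.of_linked hlarge hn hn' hle hy
  intro w₁ w₂ s e he
  rcases List.eq_nil_or_concat' w₂ with rfl | ⟨w₂, x, rfl⟩
  · have he' : w' ++ [h] = w₁ ++ [(s, e)] ++ [(s, !e)] := by simpa using he
    obtain ⟨rfl, hx⟩ := List.append_inj' he' rfl
    obtain rfl : h = (s, !e) := by simpa using hx
    refine h1.2 ⟨w₁, ?_⟩
    simpa [linv] using Linked.refl _
  · rw [← List.append_assoc] at he
    obtain ⟨rfl, -⟩ := List.append_inj' he rfl
    exact h1.1 _ (.refl _) w₁ w₂ s e rfl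

theorem lastRelUpTo_and_goodAppendUpTo (hlarge : ∀ s t : S, s ≠ t → 3 ≤ A.m s t) (n : ℕ) :
    LastRelUpTo A n ∧ GoodAppendUpTo A n := by
  induction n with
  | zero => exact ⟨fun w g w' h hl => by omega, fun w g hl => by omega⟩
  | succ n ih =>
    obtain ⟨hn, hn'⟩ := ih
    constructor
    · intro w g w' h hle hG hl
      obtain ⟨x, f, he, -, h1⟩ :=
        Extends.of_linked hlarge hn hn' (by omega) ⟨hG.left, hG.not_desc⟩ hl
      obtain ⟨rfl, hx⟩ := List.append_inj' he rfl
      obtain rfl : h = f := by simpa using hx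
      exact h1
    · intro w g hle hG hd
      exact Extends.good_append hlarge hn hn' (by omega) ⟨hG, hd⟩

end Step

/-! ### The action on classes of good words -/

section Action

variable {A : ArtinData S} {a b : S} {w w' w₁ w₂ u v z : Word S} {g : S × Bool}

/-- The good word `w'` is obtained from the good word `w` by multiplication with `g`. -/
def Acts (A : ArtinData S) (g : S × Bool) (w w' : Word S) : Prop :=
  Good A w ∧ Good A w' ∧ (Linked A w (w' ++ [linv g]) ∨ Linked A w' (w ++ [g]))

theorem Acts.symm (h : Acts A g w w') : Acts A (linv g) w' w := by
  refine ⟨h.2.1, h.1, ?_⟩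
  rw [linv_linv]
  exact h.2.2.symm

theorem exists_acts (hlarge : ∀ s t : S, s ≠ t → 3 ≤ A.m s t) (g : S × Bool) (hw : Good A w) :
    ∃ w', Acts A g w w' := by
  by_cases hd : Desc A w (linv g)
  · obtain ⟨w', h⟩ := hd
    exact ⟨w', hw, (hw.linked h).left, Or.inl h⟩
  · exact ⟨w ++ [g], hw, (lastRelUpTo_and_goodAppendUpTo hlarge _).2 w g le_rfl hw hd,
      Or.inr (.refl _)⟩

theorem Acts.linked_left (h : Acts A g w w') (hl : Linked A w w₁) : Acts A g w₁ w' :=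
  ⟨h.1.linked hl, h.2.1, h.2.2.imp (fun h => hl.symm.trans h)
    (fun h => h.trans (hl.append_right [g]))⟩

theorem Acts.unique (hlarge : ∀ s t : S, s ≠ t → 3 ≤ A.m s t) (h₁ : Acts A g w w₁)
    (h₂ : Acts A g w w₂) : Linked A w₁ w₂ := by
  have mixed : ∀ {x y : Word S}, Good A y → Linked A w (x ++ [linv g]) →
      Linked A y (w ++ [g]) → False := fun hy h h' =>
    not_good_cancel _ g (hy.linked (h'.trans (h.append_right [g])))
  obtain ⟨hw, hw₁, h₁ | h₁⟩ := h₁ <;> obtain ⟨-, hw₂, h₂ | h₂⟩ := h₂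
  · rcases (lastRelUpTo_and_goodAppendUpTo hlarge _).1 _ _ _ _ le_rfl (hw.linked h₁)
      (h₁.symm.trans h₂) with ⟨-, h⟩ | ⟨h, -⟩
    · exact h
    · exact absurd rfl h
  · exact (mixed hw₂ h₁ h₂).elim
  · exact (mixed hw₁ h₂ h₁).elim
  · exact h₁.trans h₂.symm

/-- Being linked, as an equivalence relation on good words. -/
def goodSetoid (A : ArtinData S) : Setoid {w : Word S // Good A w} where
  r w w' := Linked A w.1 w'.1
  iseqv := ⟨fun w => .refl w.1, Linked.symm, Linked.trans⟩

/-- Multiplication by a letter on classes of good words. -/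
noncomputable def goodAct (hlarge : ∀ s t : S, s ≠ t → 3 ≤ A.m s t) (g : S × Bool)
    (x : Quotient (goodSetoid A)) : Quotient (goodSetoid A) :=
  Quotient.mk _ ⟨(exists_acts hlarge g x.out.2).choose,
    (exists_acts hlarge g x.out.2).choose_spec.2.1⟩

theorem Acts.goodAct_eq (hlarge : ∀ s t : S, s ≠ t → 3 ≤ A.m s t) (h : Acts A g w w') :
    goodAct hlarge g (Quotient.mk (goodSetoid A) ⟨w, h.1⟩) =
      Quotient.mk (goodSetoid A) ⟨w', h.2.1⟩ := by
  refine Quotient.sound ?_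
  have h1 := (exists_acts hlarge g (Quotient.mk (goodSetoid A) ⟨w, h.1⟩).out.2).choose_spec
  have h2 : Linked A (Quotient.mk (goodSetoid A) ⟨w, h.1⟩).out.1 w :=
    Quotient.mk_out (s := goodSetoid A) (⟨w, h.1⟩ : {w : Word S // Good A w})
  exact (h1.linked_left h2).unique hlarge h

theorem goodAct_goodAct (hlarge : ∀ s t : S, s ≠ t → 3 ≤ A.m s t) (s : S) (e : Bool)
    (x : Quotient (goodSetoid A)) : goodAct hlarge (s, !e) (goodAct hlarge (s, e) x) = x := by
  induction x using Quotient.inductionOn with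
  | _ x =>
  obtain ⟨w, hw⟩ := x
  obtain ⟨w', h⟩ := exists_acts hlarge (s, e) hw
  rw [h.goodAct_eq hlarge]
  exact h.symm.goodAct_eq hlarge

theorem good_append_geodOver (hlarge : ∀ s t : S, s ≠ t → 3 ≤ A.m s t) (hG : Good A z)
    (hz : NoDesc A {a, b} z) (hv : GeodOver A {a, b} v) : Good A (z ++ v) :=
  (lastRelUpTo_and_goodAppendUpTo hlarge _).1.good_append
    (lastRelUpTo_and_goodAppendUpTo hlarge _).2 hG hz hv le_rfl

theorem run_goodAct (hlarge : ∀ s t : S, s ≠ t → 3 ≤ A.m s t) (hG : Good A z)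
    (hz : NoDesc A {a, b} z) (hv : GeodOver A {a, b} v) (hu : WordOver {a, b} u)
    (hw : GeodOver A {a, b} w) (he : EqOver A {a, b} (v ++ u) w) :
    run (goodAct hlarge) u (Quotient.mk (goodSetoid A)
      ⟨z ++ v, good_append_geodOver hlarge hG hz hv⟩) =
      Quotient.mk (goodSetoid A) ⟨z ++ w, good_append_geodOver hlarge hG hz hw⟩ := by
  induction u generalizing v with
  | nil =>
    rw [List.append_nil] at he
    exact Quotient.sound ((he.linked hv hw).append_left z)
  | cons g u ih =>
    rw [wordOver_cons] at hu
    obtain ⟨x, hx, hl, hact⟩ : ∃ x, ∃ hx : GeodOver A {a, b} x, EqOver A {a, b} (v ++ [g]) x ∧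
        Acts A g (z ++ v) (z ++ x) := by
      have hgv := good_append_geodOver hlarge hG hz hv
      by_cases hn : GeodOver A {a, b} (v ++ [g])
      · exact ⟨_, hn, .refl _, hgv, good_append_geodOver hlarge hG hz hn,
          Or.inr (by simpa using Linked.refl _)⟩
      · obtain ⟨x, hx, hxe⟩ := hv.exists_of_not hu.1 hn
        exact ⟨x, hx.of_append_left, (hxe.append_right [g]).trans (eqOver_cancel x g), hgv,
          good_append_geodOver hlarge hG hz hx.of_append_left,
          Or.inl (by simpa using (hxe.linked hv hx).append_left z)⟩
    rw [run_cons, hact.goodAct_eq hlarge]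
    exact ih hx hu.2 ((hl.symm.append_right u).trans (by simpa using he))

theorem wordOver_altWord (s t : S) (k : ℕ) : WordOver {s, t} (altWord s t k) := by
  induction k generalizing s t with
  | zero => exact .nil
  | succ k ih =>
    rw [altWord, wordOver_cons, Set.pair_comm]
    exact ⟨by simp, ih t s⟩

theorem good_nil (A : ArtinData S) : Good A [] := by
  intro w hw w₁ w₂ s e he
  have := hw.length_eq
  simp [he] at this

theorem run_goodAct_good (hlarge : ∀ s t : S, s ≠ t → 3 ≤ A.m s t) (hw : Good A w) :
    run (goodAct hlarge) w (Quotient.mk (goodSetoid A) ⟨[], good_nil A⟩) =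
      Quotient.mk (goodSetoid A) ⟨w, hw⟩ := by
  induction w using List.reverseRecOn with
  | nil => rfl
  | append_singleton w g ih =>
    rw [run_append, ih hw.left, run_cons, run_nil]
    exact Acts.goodAct_eq hlarge ⟨hw.left, hw, Or.inr (.refl _)⟩

/-- The only good word representing the identity is the empty one. -/
theorem Good.eq_nil (hlarge : ∀ s t : S, s ≠ t → 3 ≤ A.m s t) (hw : Good A w)
    (h : wbar A w = 1) : w = [] := by
  have hrun := run_eq_of_cls_eq (R := rels A) (goodAct hlarge) (goodAct_goodAct hlarge) (by
    rintro r ⟨p, q, ⟨s, t, k, hst, hk, rfl, rfl⟩, rfl⟩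
    refine ⟨_, _, rfl, fun x => ?_⟩
    induction x using Quotient.inductionOn with
    | _ x =>
    obtain ⟨y, hy⟩ := x
    obtain ⟨z, v, h1, h2, h3⟩ := exists_decomp A {s, t} y
    have hG := hy.linked h1
    have hv := hG.right.geodOver h2
    rw [show Quotient.mk (goodSetoid A) ⟨y, hy⟩ = Quotient.mk (goodSetoid A) ⟨z ++ v, hG⟩ from
      Quotient.sound h1]
    have hw1 := wordOver_altWord s t k
    have hw2 : WordOver {s, t} (altWord t s k) := Set.pair_comm t s ▸ wordOver_altWord t s k
    obtain ⟨x, hx, hxe⟩ := exists_geodOver (A := A) (wordOver_append.2 ⟨h2, hw1⟩)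
    have hrel : EqOver A {s, t} (altWord s t k) (altWord t s k) :=
      cls_rel ⟨s, t, k, by simp, by simp, hst, hk, rfl⟩
    rw [run_goodAct hlarge hG.left h3 hv hw1 hx hxe,
      run_goodAct hlarge hG.left h3 hv hw2 hx ((hrel.symm.append_left v).trans hxe)])
    (u := w) (v := []) (by rw [← wbar_eq_cls, h, cls_nil])
    (Quotient.mk (goodSetoid A) ⟨[], good_nil A⟩)
  rw [run_goodAct_good hlarge hw, run_nil] at hrun
  have hl : Linked A w [] := Quotient.exact hrun
  simpa using hl.length_eq

end Action

/-! ### Conclusion -/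

section Conclusion

variable {A : ArtinData S} {w w' : Word S}

theorem exists_endsOff (T : Set S) (α : Word S) :
    ∃ x y, α = x ++ y ∧ EndsOff T x ∧ WordOver T y := by
  induction α using List.reverseRecOn with
  | nil => exact ⟨[], [], rfl, fun g t h => by simp at h, .nil⟩
  | append_singleton α g ih =>
    by_cases hg : g.1 ∈ T
    · obtain ⟨x, y, rfl, h1, h2⟩ := ih
      exact ⟨x, y ++ [g], by simp, h1, wordOver_append.2 ⟨h2, wordOver_singleton.2 hg⟩⟩
    · refine ⟨α ++ [g], [], by simp, fun g' t h => ?_, .nil⟩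
      obtain ⟨-, h⟩ := List.append_inj' h rfl
      obtain rfl : g = g' := by simpa using h
      exact hg

theorem exists_startsOff (T : Set S) (β : Word S) :
    ∃ x y, β = x ++ y ∧ WordOver T x ∧ StartsOff T y := by
  induction β with
  | nil => exact ⟨[], [], rfl, .nil, fun g t h => by simp at h⟩
  | cons g β ih =>
    by_cases hg : g.1 ∈ T
    · obtain ⟨x, y, rfl, h1, h2⟩ := ih
      exact ⟨g :: x, y, by simp, wordOver_cons.2 ⟨hg, h1⟩, h2⟩
    · refine ⟨[], g :: β, rfl, .nil, fun g' t h => ?_⟩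
      obtain ⟨rfl, -⟩ := List.cons.inj h
      exact hg

theorem Move.steps (h : Move A w w') :
    Steps012Star A w w' ∨ ∃ v, v.length < w.length ∧ Steps012Star A w v := by
  obtain ⟨a, b, α, β, u, u', rfl, rfl, hu, hu', he⟩ := h
  obtain ⟨α, x, rfl, hα, hx⟩ := exists_endsOff {a, b} α
  obtain ⟨y, β, rfl, hy, hβ⟩ := exists_startsOff {a, b} β
  have hxu : WordOver {a, b} (x ++ u ++ y) := wordOver_append.2 ⟨wordOver_append.2 ⟨hx, hu.1⟩, hy⟩
  have hxu' : WordOver {a, b} (x ++ u' ++ y) :=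
    wordOver_append.2 ⟨wordOver_append.2 ⟨hx, hu'.1⟩, hy⟩
  have hE := he.context x y
  have e1 : ∀ p : Word S, α ++ x ++ p ++ (y ++ β) = α ++ (x ++ p ++ y) ++ β := fun p => by simp
  rw [e1, e1]
  by_cases hG : GeodOver A {a, b} (x ++ u' ++ y)
  · exact hE.steps hxu hG hα hβ
  · obtain ⟨v, hv, hve⟩ := exists_geodOver (A := A) hxu'
    have hlt : v.length < (x ++ u' ++ y).length := by
      by_contra hlt
      exact hG (hv.of_eq_length hxu' hve.symm (not_lt.1 hlt))
    rcases (hE.trans hve).steps hxu hv hα hβ with h | h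
    · refine Or.inr ⟨_, ?_, h⟩
      have := hu.length_eq hu' he
      simp at *
      omega
    · exact Or.inr h

theorem Linked.steps (h : Linked A w w') :
    Steps012Star A w w' ∨ ∃ v, v.length < w.length ∧ Steps012Star A w v := by
  induction h with
  | refl => exact Or.inl .refl
  | tail hl hm ih =>
    rcases ih with ih | ih
    · rcases hm.steps with h | ⟨v, hv, h⟩
      · exact Or.inl (Relation.ReflTransGen.trans ih h)
      · exact Or.inr ⟨v, (Linked.length_eq hl) ▸ hv, Relation.ReflTransGen.trans ih h⟩
    · exact Or.inr ih

theorem steps_nil_of_wbar_eq_one (hlarge : ∀ s t : S, s ≠ t → 3 ≤ A.m s t)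
    (h : wbar A w = 1) : Steps012Star A w [] := by
  induction hn : w.length using Nat.strong_induction_on generalizing w with
  | _ n ih =>
  by_cases hw : Good A w
  · rw [hw.eq_nil hlarge h]
    exact .refl
  · obtain ⟨v, hv, hs⟩ : ∃ v, v.length < w.length ∧ Steps012Star A w v := by
      simp only [Good, not_forall] at hw
      obtain ⟨w', hl, hr⟩ := hw
      rcases hl.steps with hs | hs
      · simp only [FreelyReduced, not_forall, not_not] at hr
        obtain ⟨w₁, w₂, s, e, rfl⟩ := hr
        refine ⟨w₁ ++ w₂, ?_, hs.tail (Or.inl ⟨w₁, w₂, s, e, rfl, rfl⟩)⟩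
        rw [hl.length_eq]
        simp
      · exact hs
    exact Relation.ReflTransGen.trans hs
      (ih _ (hn ▸ hv) ((hs.cls_eq (A := A)).symm.trans h) rfl)

end Conclusion

/-- Corollary 2.25: in an Artin–Tits group of large type,
`w →_{0,1,2⋆} ε ↔ w̄ = 1`. -/
theorem stmt12 {S : Type*} [Finite S] (A : ArtinData S)
    (hlarge : ∀ s t : S, s ≠ t → 3 ≤ A.m s t) (w : Word S) :
    Steps012Star A w [] ↔ wbar A w = 1 :=
  ⟨fun h => h.cls_eq.trans (cls_nil _), steps_nil_of_wbar_eq_one hlarge⟩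

end ArtinTits
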